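/- Let (F₀,σ) be a closed oriented surface with an area form, D its group of symplectomorphisms, D₀ the identity component. If g ∈ D is such that the induced linear map g*: H¹(F₀;ℝ) → H¹(F₀;ℝ) has no eigenvalue equal to 1, then the map f ↦ Flux([g,f]) sends D₀ onto H¹(F₀;ℝ) (onto H¹(F₀;ℝ/ℤ) if F₀ is the torus). Consequently, for such a fixed g, every Hamiltonian isotopy class in D₀ can be represented as a commutator [g,f] of g and a diffeomorphism f ∈ D₀, with f Hamiltonian when the class is trivial adjusted appropriately; in particular every element of D₀ is, up to Hamiltonian isotopy, a single commutator in D. -/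

import Mathlib

open Set Function
open scoped Manifold

noncomputable section

instance factZeroLtOne : Fact ((0:ℝ) < 1) := ⟨zero_lt_one⟩

/-- Euclidean model space. -/
abbrev Esp (n : ℕ) : Type := EuclideanSpace ℝ (Fin n)

section Forms

variable {E : Type*} [NormedAddCommGroup E] [NormedSpace ℝ E]
  {H : Type*} [TopologicalSpace H]
  {E' : Type*} [NormedAddCommGroup E'] [NormedSpace ℝ E']
  {H' : Type*} [TopologicalSpace H']

/-- A raw `k`-form on a manifold `M`: an assignment, to each point, of a value on `k`-tuples
of tangent vectors.  (Multilinearity/alternation/smoothness are imposed separately.) -/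
def RawForm (I : ModelWithCorners ℝ E H) (M : Type*) [TopologicalSpace M]
    [ChartedSpace H M] (k : ℕ) : Type _ :=
  ∀ x : M, (Fin k → TangentSpace I x) → ℝ

variable {I : ModelWithCorners ℝ E H} {M : Type*} [TopologicalSpace M] [ChartedSpace H M]
  {I' : ModelWithCorners ℝ E' H'} {N : Type*} [TopologicalSpace N] [ChartedSpace H' N]

/-- The representative of a raw form in the preferred chart at a basepoint `x`. -/
def chartRep {k : ℕ} (ω : RawForm I M k) (x : M) : E → (Fin k → E) → ℝ :=
  fun y v => ω ((extChartAt I x).symm y)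
    (fun i => mfderiv 𝓘(ℝ, E) I (extChartAt I x).symm y (v i))

/-- Chart-level value of a raw form at a point. -/
def valC {k : ℕ} (ω : RawForm I M k) (x : M) (v : Fin k → E) : ℝ :=
  chartRep ω x (extChartAt I x x) v

/-- Chart-level value of the exterior derivative of a raw `k`-form at `x`, evaluated on
chart-constant vectors (the usual alternating sum of directional derivatives of the chart
representative). -/
def dValC {k : ℕ} (ω : RawForm I M k) (x : M) (v : Fin (k + 1) → E) : ℝ :=
  ∑ i : Fin (k + 1), (-1 : ℝ) ^ (i : ℕ) *
    fderivWithin ℝ (fun y => chartRep ω x y (v ∘ i.succAbove))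
      (extChartAt I x).target (extChartAt I x x) (v i)

/-- Smoothness of a raw form, expressed through its chart representatives. -/
def IsSmoothRaw {k : ℕ} (ω : RawForm I M k) : Prop :=
  ∀ (x : M) (v : Fin k → E),
    ContDiffOn ℝ (⊤ : ℕ∞) (fun y => chartRep ω x y v) (extChartAt I x).target

/-- Closedness (`dω = 0`) of a raw form. -/
def IsClosedRaw {k : ℕ} (ω : RawForm I M k) : Prop :=
  ∀ (x : M) (v : Fin (k + 1) → E), dValC ω x v = 0

/-- The pullback of a raw form under a map of manifolds. -/
def pullbackRaw {k : ℕ} (f : M → N) (ω : RawForm I' N k) : RawForm I M k :=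
  fun x v => ω (f x) (fun i => mfderiv I I' f x (v i))

/-- A (smooth) differential `k`-form: a raw form which is pointwise a continuous alternating
multilinear map and is smooth in charts. -/
structure SForm (I : ModelWithCorners ℝ E H) (M : Type*) [TopologicalSpace M]
    [ChartedSpace H M] (k : ℕ) where
  val : RawForm I M k
  alt : ∀ x : M, ∃ A : E [⋀^Fin k]→L[ℝ] ℝ,
    ∀ v : Fin k → TangentSpace I x, val x v = A v
  smooth : IsSmoothRaw val

/-- "`ω = dθ`" at the level of chart values: exactness witness. -/
def IsPrimitiveOf {k : ℕ} (θ : RawForm I M k) (ω : RawForm I M (k + 1)) : Prop :=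
  ∀ (x : M) (v : Fin (k + 1) → E), valC ω x v = dValC θ x v

/-- Chart-level value of `α ∧ dα` for a 1-form `α` (relevant on 3-manifolds). -/
def contactVolC (α : RawForm I M 1) (x : M) (v : Fin 3 → E) : ℝ :=
  valC α x ![v 0] * dValC α x ![v 1, v 2]
    - valC α x ![v 1] * dValC α x ![v 0, v 2]
    + valC α x ![v 2] * dValC α x ![v 0, v 1]

/-- The angular derivative of a circle-valued map along a tangent vector: the coefficient
of the counterclockwise unit tangent `i·c(x)` in the derivative of `c` in the direction `v`. -/
def dCircleC (c : M → Circle) (x : M) (v : TangentSpace I x) : ℝ :=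
  ((show ℂ from mfderiv I 𝓘(ℝ, ℂ) (fun y => ((c y : ℂ))) x v) *
    (starRingEnd ℂ) (Complex.I * (c x : ℂ))).re

/-- Chart-level differential of a vector-valued function on a manifold. -/
def dMapC {F' : Type*} [NormedAddCommGroup F'] [NormedSpace ℝ F']
    (f : M → F') (x : M) (u : E) : F' :=
  fderivWithin ℝ (fun y => f ((extChartAt I x).symm y))
    (extChartAt I x).target (extChartAt I x x) u

end Forms

section ThreeManifolds

variable {V : Type*} [TopologicalSpace V] [ChartedSpace (Esp 3) V]

/-- A volume form (orientation) on a 3-manifold: nowhere vanishing 3-form. -/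
def IsVolForm3 (μ : SForm (𝓡 3) V 3) : Prop :=
  ∀ x : V, ∃ v : Fin 3 → Esp 3, μ.val x v ≠ 0

/-- `α` is a positive contact form on the oriented 3-manifold `(V, μ)`:
`α ∧ dα` is a positive multiple of the orientation. -/
def IsPosContactForm (μ : SForm (𝓡 3) V 3) (α : SForm (𝓡 3) V 1) : Prop :=
  ∀ (x : V) (v : Fin 3 → Esp 3), 0 < valC μ.val x v → 0 < contactVolC α.val x v

/-- `ω` restricts to the (cooriented) contact planes `ξ = ker α` positively: `ω|_ξ > 0`. -/
def PosOnContactPlanes (α : SForm (𝓡 3) V 1) (ω : RawForm (𝓡 3) V 2) : Prop :=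
  ∀ (x : V) (u w : Esp 3), valC α.val x ![u] = 0 → valC α.val x ![w] = 0 →
    0 < dValC α.val x ![u, w] → 0 < valC ω x ![u, w]

end ThreeManifolds

section FourManifolds

variable {E : Type*} [NormedAddCommGroup E] [NormedSpace ℝ E]
  {H : Type*} [TopologicalSpace H] {I : ModelWithCorners ℝ E H}
  {W : Type*} [TopologicalSpace W] [ChartedSpace H W]

/-- Chart-level value of `Ω ∧ Ω` for a 2-form on a 4-manifold. -/
def sympVolC (Ω : RawForm I W 2) (x : W) (v : Fin 4 → E) : ℝ :=
  valC Ω x ![v 0, v 1] * valC Ω x ![v 2, v 3]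
    - valC Ω x ![v 0, v 2] * valC Ω x ![v 1, v 3]
    + valC Ω x ![v 0, v 3] * valC Ω x ![v 1, v 2]

/-- Intrinsic value of `Ω ∧ Ω` on four tangent vectors. -/
def sympVolI (Ω : RawForm I W 2) (x : W) (v : Fin 4 → TangentSpace I x) : ℝ :=
  Ω x ![v 0, v 1] * Ω x ![v 2, v 3]
    - Ω x ![v 0, v 2] * Ω x ![v 1, v 3]
    + Ω x ![v 0, v 3] * Ω x ![v 1, v 2]

/-- A symplectic form on a 4-manifold: closed and nondegenerate (`Ω ∧ Ω ≠ 0`). -/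
def IsSymplectic4 (Ω : SForm I W 2) : Prop :=
  IsClosedRaw Ω.val ∧ ∀ x : W, ∃ v : Fin 4 → E, sympVolC Ω.val x v ≠ 0

end FourManifolds

section Boundary

variable {W : Type*} [TopologicalSpace W] [ChartedSpace (EuclideanHalfSpace 4) W]

/-- `n` is an outward vector at a boundary point `p` of a 4-manifold with boundary:
in the preferred half-space chart (where the manifold lies in `{y 0 ≥ 0}`), the
0-th coordinate decreases in the direction `n`. -/
def IsOutward4 (p : W) (n : TangentSpace (𝓡∂ 4) p) : Prop :=
  p ∈ (𝓡∂ 4).boundary W ∧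
    (show Esp 4 from mfderiv (𝓡∂ 4) 𝓘(ℝ, Esp 4) (extChartAt (𝓡∂ 4) p) p n) 0 < 0

variable {V : Type*} [TopologicalSpace V] [ChartedSpace (Esp 3) V]

/-- `ι` realizes the closed 3-manifold `V` as (part of) the boundary of `W`. -/
structure IsBoundaryPatch (ι : V → W) : Prop where
  smooth : ContMDiff (𝓡 3) (𝓡∂ 4) (⊤ : ℕ∞) ι
  inj : Function.Injective ι
  sub : range ι ⊆ (𝓡∂ 4).boundary W
  imm : ∀ x : V, Function.Injective (mfderiv (𝓡 3) (𝓡∂ 4) ι x)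

/-- The boundary orientation induced by the symplectic form `Ω` (outward-normal-first
convention) agrees with `ε` times the orientation `μ` of `V` along the boundary patch `ι`.
Use `ε = 1` for `∂W ⊇ V` and `ε = -1` for `∂W ⊇ -V`. -/
def BoundaryOrient (ι : V → W) (Ω : SForm (𝓡∂ 4) W 2) (μ : SForm (𝓡 3) V 3) (ε : ℝ) : Prop :=
  ∀ (x : V) (n : TangentSpace (𝓡∂ 4) (ι x)) (v : Fin 3 → TangentSpace (𝓡 3) x),
    IsOutward4 (ι x) n → 0 < ε * μ.val x v →
      0 < sympVolI Ω.val (ι x)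
        ![n, mfderiv (𝓡 3) (𝓡∂ 4) ι x (v 0), mfderiv (𝓡 3) (𝓡∂ 4) ι x (v 1),
          mfderiv (𝓡 3) (𝓡∂ 4) ι x (v 2)]

end Boundary

section CircleFibrations

variable {V : Type*} [TopologicalSpace V] [ChartedSpace (Esp 3) V]

/-- `u` points in the positive (counterclockwise) fiber-transverse direction for the circle-valued
map `π` at `x`. -/
def PosBaseDir (π : V → Circle) (x : V) (u : TangentSpace (𝓡 3) x) : Prop :=
  ∃ r : ℝ, 0 < r ∧
    mfderiv (𝓡 3) 𝓘(ℝ, ℂ) (fun y => ((π y : ℂ))) x u = r • (Complex.I * (π x : ℂ))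

/-- The 2-form `ω` is positive (and nondegenerate) on the oriented fibers of `π : V → S¹`,
the fibers being oriented by the orientation `μ` of `V` and the counterclockwise orientation
of the base circle. -/
def FiberPos3 (π : V → Circle) (μ : SForm (𝓡 3) V 3) (ω : RawForm (𝓡 3) V 2) : Prop :=
  (∀ (x : V) (u v w : TangentSpace (𝓡 3) x), PosBaseDir π x u →
    mfderiv (𝓡 3) (𝓡 1) π x v = 0 → mfderiv (𝓡 3) (𝓡 1) π x w = 0 →
    0 < μ.val x ![u, v, w] → 0 < ω x ![v, w]) ∧
  (∀ (x : V) (v : TangentSpace (𝓡 3) x), mfderiv (𝓡 3) (𝓡 1) π x v = 0 → v ≠ 0 →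
    ∃ w : TangentSpace (𝓡 3) x, mfderiv (𝓡 3) (𝓡 1) π x w = 0 ∧ ω x ![v, w] ≠ 0)

/-- A symplectic fibration over the circle: a closed oriented 3-manifold `V` fibered over `S¹`
together with a closed 2-form positive on the (oriented) fibers. -/
structure SympFibS1 (V : Type*) [TopologicalSpace V] [ChartedSpace (Esp 3) V]
    [IsManifold (𝓡 3) (⊤ : ℕ∞) V] [CompactSpace V] [T2Space V] where
  π : V → Circle
  smooth : ContMDiff (𝓡 3) (𝓡 1) (⊤ : ℕ∞) π
  subm : ∀ x : V, Function.Surjective (mfderiv (𝓡 3) (𝓡 1) π x)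
  /-- the orientation of `V` -/
  μ : SForm (𝓡 3) V 3
  vol : IsVolForm3 μ
  /-- the closed 2-form -/
  ω : SForm (𝓡 3) V 2
  closed : IsClosedRaw ω.val
  pos : FiberPos3 π μ ω.val

end CircleFibrations

/-- Triviality of the first integral homology, expressed via the abelianized fundamental
group (Hurewicz). -/
def H1Trivial (X : Type*) [TopologicalSpace X] : Prop :=
  ∀ x : X, Subsingleton (Abelianization (FundamentalGroup X x))


section OpenBooks

variable {V : Type*} [TopologicalSpace V] [ChartedSpace (Esp 3) V]
  [IsManifold (𝓡 3) (⊤ : ℕ∞) V] [CompactSpace V] [T2Space V]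

/-- An open book decomposition of a closed 3-manifold `V`, presented by a smooth map
`Φ : V → ℂ` having `0` as a regular value: the binding is `B = Φ⁻¹(0)` and the (open)
pages are the preimages of rays, i.e. the fibers of the circle-valued map
`x ↦ Φ(x)/|Φ(x)|` on `V ∖ B`, which is required to be a submersion. -/
structure OpenBook (V : Type*) [TopologicalSpace V] [ChartedSpace (Esp 3) V]
    [IsManifold (𝓡 3) (⊤ : ℕ∞) V] [CompactSpace V] [T2Space V] where
  Φ : V → ℂ
  smooth : ContMDiff (𝓡 3) 𝓘(ℝ, ℂ) (⊤ : ℕ∞) Φ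
  regular : ∀ x : V, Φ x = 0 → Function.Surjective (mfderiv (𝓡 3) 𝓘(ℝ, ℂ) Φ x)
  fib : ∀ x : V, Φ x ≠ 0 → ∃ u : TangentSpace (𝓡 3) x,
    mfderiv (𝓡 3) 𝓘(ℝ, ℂ) (fun y => (Φ y / (‖Φ y‖ : ℂ))) x u ≠ 0

/-- The binding of an open book. -/
def OpenBook.binding (ob : OpenBook V) : Set V := ob.Φ ⁻¹' {0}

/-- The circle-valued page coordinate of an open book, away from the binding. -/
def OpenBook.angle (ob : OpenBook V) : V → ℂ := fun y => ob.Φ y / (‖ob.Φ y‖ : ℂ)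

/-- The cobordism from `V` to the surface fibration `V'` over `S¹` obtained by `0`-framed
Morse surgery along the binding of an open book (2-handles attached along the binding with
the page framing):  `W` is a compact 4-manifold with `∂W = V ⊔ V'`, the complement of the
binding embeds into `V'` compatibly with the fibrations, and `V'` fibers over the circle. -/
structure SurgeryCobordism (ob : OpenBook V) where
  W : Type
  [topW : TopologicalSpace W]
  [chW : ChartedSpace (EuclideanHalfSpace 4) W]
  [smW : IsManifold (𝓡∂ 4) (⊤ : ℕ∞) W]
  [cptW : CompactSpace W]
  [t2W : T2Space W]
  V' : Type
  [topV' : TopologicalSpace V']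
  [chV' : ChartedSpace (Esp 3) V']
  [smV' : IsManifold (𝓡 3) (⊤ : ℕ∞) V']
  [cptV' : CompactSpace V']
  [t2V' : T2Space V']
  ι : V → W
  ι' : V' → W
  bdV : IsBoundaryPatch ι
  bdV' : IsBoundaryPatch ι'
  disj : range ι ∩ range ι' = ∅
  cover : range ι ∪ range ι' = (𝓡∂ 4).boundary W
  /-- the fibration of `V'` over the circle (pages capped off by surgery discs) -/
  π' : V' → Circle
  smoothπ' : ContMDiff (𝓡 3) (𝓡 1) (⊤ : ℕ∞) π'
  subm' : ∀ y : V', Function.Surjective (mfderiv (𝓡 3) (𝓡 1) π' y)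
  /-- identification of the complement of the binding in `V` with the complement of the
  surgery solid tori in `V'`, compatible with the fibrations -/
  glue : V → V'
  glue_smooth : ContMDiffOn (𝓡 3) (𝓡 3) (⊤ : ℕ∞) glue {x | ob.Φ x ≠ 0}
  glue_inj : InjOn glue {x | ob.Φ x ≠ 0}
  glue_fib : ∀ x : V, ob.Φ x ≠ 0 → ((π' (glue x) : ℂ)) = ob.angle x

attribute [instance] SurgeryCobordism.topW SurgeryCobordism.chW SurgeryCobordism.smW
  SurgeryCobordism.cptW SurgeryCobordism.t2W SurgeryCobordism.topV' SurgeryCobordism.chV'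
  SurgeryCobordism.smV' SurgeryCobordism.cptV' SurgeryCobordism.t2V'

end OpenBooks

section Fillings

variable {V : Type*} [TopologicalSpace V] [ChartedSpace (Esp 3) V]
  [IsManifold (𝓡 3) (⊤ : ℕ∞) V] [CompactSpace V] [T2Space V]
  {W : Type*} [TopologicalSpace W] [ChartedSpace (EuclideanHalfSpace 4) W]
  [IsManifold (𝓡∂ 4) (⊤ : ℕ∞) W] [CompactSpace W] [T2Space W]

/-- `(W, Ω)` is a weak symplectic filling of the contact manifold `(V, ξ = ker α)` (oriented
by `μ`), via the boundary identification `ι`: `∂W = V` as oriented manifolds and `Ω|_ξ > 0`. -/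
def IsWeakFilling (μ : SForm (𝓡 3) V 3) (α : SForm (𝓡 3) V 1)
    (Ω : SForm (𝓡∂ 4) W 2) (ι : V → W) : Prop :=
  IsSymplectic4 Ω ∧ IsBoundaryPatch ι ∧ range ι = (𝓡∂ 4).boundary W ∧
    BoundaryOrient ι Ω μ 1 ∧ PosOnContactPlanes α (pullbackRaw ι Ω.val)

/-- `(W, Ω)` is a strong symplectic filling of `(V, ξ = ker α)`: a weak filling such that
`Ω` is exact near the boundary, with a primitive `A` restricting to `V` as a positive
multiple of the contact form `α` (so `ξ = ker (A|_V)` and `d(A|_V)|_ξ > 0`). -/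
def IsStrongFilling (μ : SForm (𝓡 3) V 3) (α : SForm (𝓡 3) V 1)
    (Ω : SForm (𝓡∂ 4) W 2) (ι : V → W) : Prop :=
  IsWeakFilling μ α Ω ι ∧
    ∃ U : Set W, IsOpen U ∧ (𝓡∂ 4).boundary W ⊆ U ∧
      ∃ A : SForm (𝓡∂ 4) W 1,
        (∀ x ∈ U, ∀ v : Fin 2 → Esp 4, valC Ω.val x v = dValC A.val x v) ∧
        ∃ f : V → ℝ, (∀ x : V, 0 < f x) ∧
          (∀ (x : V) (v : Fin 1 → TangentSpace (𝓡 3) x),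
            pullbackRaw ι A.val x v = f x * α.val x v)

end Fillings

/-- A bundled weak filling of the contact manifold `(V, μ, ker α)`. -/
structure WeakFillingB {V : Type*} [TopologicalSpace V] [ChartedSpace (Esp 3) V]
    [IsManifold (𝓡 3) (⊤ : ℕ∞) V] [CompactSpace V] [T2Space V]
    (μ : SForm (𝓡 3) V 3) (α : SForm (𝓡 3) V 1) where
  W : Type
  [topW : TopologicalSpace W]
  [chW : ChartedSpace (EuclideanHalfSpace 4) W]
  [smW : IsManifold (𝓡∂ 4) (⊤ : ℕ∞) W]
  [cptW : CompactSpace W]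
  [t2W : T2Space W]
  Ω : SForm (𝓡∂ 4) W 2
  ι : V → W
  fill : IsWeakFilling μ α Ω ι

attribute [instance] WeakFillingB.topW WeakFillingB.chW WeakFillingB.smW WeakFillingB.cptW
  WeakFillingB.t2W

/-- A bundled strong filling of the contact manifold `(V, μ, ker α)`. -/
structure StrongFillingB {V : Type*} [TopologicalSpace V] [ChartedSpace (Esp 3) V]
    [IsManifold (𝓡 3) (⊤ : ℕ∞) V] [CompactSpace V] [T2Space V]
    (μ : SForm (𝓡 3) V 3) (α : SForm (𝓡 3) V 1) where
  W : Type
  [topW : TopologicalSpace W]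
  [chW : ChartedSpace (EuclideanHalfSpace 4) W]
  [smW : IsManifold (𝓡∂ 4) (⊤ : ℕ∞) W]
  [cptW : CompactSpace W]
  [t2W : T2Space W]
  Ω : SForm (𝓡∂ 4) W 2
  ι : V → W
  fill : IsStrongFilling μ α Ω ι

attribute [instance] StrongFillingB.topW StrongFillingB.chW StrongFillingB.smW
  StrongFillingB.cptW StrongFillingB.t2W


section Surfaces

variable {F : Type*} [TopologicalSpace F] [ChartedSpace (Esp 2) F]
  [IsManifold (𝓡 2) (⊤ : ℕ∞) F] [CompactSpace F] [T2Space F]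

/-- An area form on a surface: a nowhere vanishing 2-form. -/
def IsAreaForm (σ : SForm (𝓡 2) F 2) : Prop :=
  ∀ x : F, ∃ v : Fin 2 → Esp 2, σ.val x v ≠ 0

/-- A smooth isotopy of a surface through diffeomorphisms preserving the area form `σ`,
starting at the identity. -/
structure SympIsotopy (σ : RawForm (𝓡 2) F 2) where
  h : ℝ → F → F
  smooth : ContMDiff (𝓘(ℝ, ℝ).prod (𝓡 2)) (𝓡 2) (⊤ : ℕ∞) (fun p : ℝ × F => h p.1 p.2)
  bij : ∀ t : ℝ, Function.Bijective (h t)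
  pres : ∀ (t : ℝ) (x : F) (v : Fin 2 → TangentSpace (𝓡 2) x),
    pullbackRaw (h t) σ x v = σ x v
  start : ∀ x : F, h 0 x = x

/-- A smooth loop of period 1 in a manifold. -/
def IsLoop {E H M : Type*} [NormedAddCommGroup E] [NormedSpace ℝ E] [TopologicalSpace H]
    {I : ModelWithCorners ℝ E H} [TopologicalSpace M] [ChartedSpace H M] (γ : ℝ → M) : Prop :=
  ContMDiff 𝓘(ℝ, ℝ) I (⊤ : ℕ∞) γ ∧ ∀ s : ℝ, γ (s + 1) = γ s

/-- The period (integral) of a raw 1-form over a loop. -/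
def loopPeriod (A : RawForm (𝓡 2) F 1) (γ : ℝ → F) : ℝ :=
  ∫ s in (0:ℝ)..1, A (γ s) ![mfderiv 𝓘(ℝ, ℝ) (𝓡 2) γ s (1:ℝ)]

/-- The (signed) area swept by the loop `γ` under the isotopy `h`, i.e. the integral of `σ`
over the traced cylinder.  The flux of the isotopy is this quantity, as a function of `γ`. -/
def sweptArea (σ : RawForm (𝓡 2) F 2) (h : ℝ → F → F) (γ : ℝ → F) : ℝ :=
  ∫ t in (0:ℝ)..1, ∫ s in (0:ℝ)..1,
    σ (h t (γ s)) ![mfderiv 𝓘(ℝ, ℝ) (𝓡 2) (fun τ => h τ (γ s)) t (1:ℝ),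
      mfderiv 𝓘(ℝ, ℝ) (𝓡 2) (fun τ => h t (γ τ)) s (1:ℝ)]

/-- `φ` (an area-preserving diffeomorphism isotopic to the identity) has flux (i.e. Calabi
invariant) equal to the cohomology class of the closed 1-form `A`: some generating symplectic
isotopy sweeps, on every loop, exactly the period of `A`.  (For the torus, the ambiguity of
the flux homomorphism is absorbed by the existential choice of the isotopy.) -/
def HasFluxForm (σ : RawForm (𝓡 2) F 2) (φ : F → F) (A : RawForm (𝓡 2) F 1) : Prop :=
  ∃ iso : SympIsotopy σ, (∀ x : F, iso.h 1 x = φ x) ∧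
    ∀ γ : ℝ → F, IsLoop (I := 𝓡 2) γ → sweptArea σ iso.h γ = loopPeriod A γ

/-- `φ` is a Hamiltonian diffeomorphism of `(F, σ)`: the time-one map of the flow of a
time-dependent vector field `X_t` with `X_t ⌟ σ = dH_t` for a time-dependent Hamiltonian. -/
def IsHamiltonianDiffeo (σ : RawForm (𝓡 2) F 2) (φ : F → F) : Prop :=
  ∃ (iso : SympIsotopy σ) (X : ∀ (_ : ℝ) (z : F), TangentSpace (𝓡 2) z) (Ham : ℝ → F → ℝ),
    (∀ x : F, iso.h 1 x = φ x) ∧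
    (∀ (t : ℝ) (z : F), mfderiv 𝓘(ℝ, ℝ) (𝓡 2) (fun s => iso.h s z) t (1:ℝ) = X t (iso.h t z)) ∧
    (∀ (t : ℝ) (z : F) (w : TangentSpace (𝓡 2) z),
      σ z ![X t z, w] = mfderiv (𝓡 2) 𝓘(ℝ, ℝ) (Ham t) z w)

/-- The set of symplectic (area- and orientation-preserving) diffeomorphisms inside the
permutation group of the surface. -/
def SympPermSet (σ : RawForm (𝓡 2) F 2) : Set (Equiv.Perm F) :=
  {e | ContMDiff (𝓡 2) (𝓡 2) (⊤ : ℕ∞) e ∧ ContMDiff (𝓡 2) (𝓡 2) (⊤ : ℕ∞) e.symm ∧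
    ∀ (x : F) (v : Fin 2 → TangentSpace (𝓡 2) x), pullbackRaw (⇑e) σ x v = σ x v}

/-- Membership in the identity component `D₀` of the symplectomorphism group: `e` is the
endpoint of a smooth symplectic isotopy starting at the identity. -/
def InIdentityComponent (σ : RawForm (𝓡 2) F 2) (e : F → F) : Prop :=
  ∃ iso : SympIsotopy σ, ∀ x : F, iso.h 1 x = e x

/-- The subgroup (of the permutation group) generated by the commutators of elements of the
symplectomorphism group `D`; membership in it is membership in `[D, D]`. -/
def commutatorSubgroupOfSymp (σ : RawForm (𝓡 2) F 2) : Subgroup (Equiv.Perm F) :=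
  Subgroup.closure {c | ∃ a ∈ SympPermSet σ, ∃ b ∈ SympPermSet σ, c = a * b * a⁻¹ * b⁻¹}

/-- A closed orientable surface has genus at least `g`: its first homology (the abelianized
fundamental group) surjects onto `ℤ^{2g}`. -/
def GenusAtLeast (F : Type*) [TopologicalSpace F] (g : ℕ) : Prop :=
  ∃ (x : F) (φ : Abelianization (FundamentalGroup F x) →* Multiplicative (Fin (2 * g) → ℤ)),
    Function.Surjective φ

/-- Exactness of a raw 1-form on a surface: it is the differential of a smooth function. -/
def IsExact1 (A : RawForm (𝓡 2) F 1) : Prop :=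
  ∃ u : F → ℝ, ContMDiff (𝓡 2) 𝓘(ℝ, ℝ) (⊤ : ℕ∞) u ∧
    ∀ (x : F) (v : Fin 1 → TangentSpace (𝓡 2) x),
      A x v = mfderiv (𝓡 2) 𝓘(ℝ, ℝ) u x (v 0)

end Surfaces

section DehnTwists

variable {F : Type*} [TopologicalSpace F] [ChartedSpace (Esp 2) F]
  [IsManifold (𝓡 2) (⊤ : ℕ∞) F] [CompactSpace F] [T2Space F]

/-- The model annulus `S¹ × [0,1]`. -/
abbrev Ann : Type := Circle × (Set.Icc (0:ℝ) 1)

/-- The model for the annulus as a manifold with boundary. -/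
abbrev IAnn := (𝓡 1).prod (𝓡∂ 1)

/-- The angular component of a tangent vector to the annulus. -/
def dphiA (p : Ann) (v : TangentSpace IAnn p) : ℝ :=
  ((show ℂ from mfderiv IAnn 𝓘(ℝ, ℂ) (fun q : Ann => ((q.1 : ℂ))) p v) *
    (starRingEnd ℂ) (Complex.I * (p.1 : ℂ))).re

/-- The radial component of a tangent vector to the annulus. -/
def dtA (p : Ann) (v : TangentSpace IAnn p) : ℝ :=
  mfderiv IAnn 𝓘(ℝ, ℝ) (fun q : Ann => (q.2 : ℝ)) p v

/-- The model positive (right-handed) Dehn twist of the annulus. -/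
def twistP : Ann → Ann := fun p => (p.1 * Circle.exp (2 * Real.pi * (p.2 : ℝ)), p.2)

/-- The model negative (left-handed) Dehn twist of the annulus. -/
def twistN : Ann → Ann := fun p => (p.1 * (Circle.exp (2 * Real.pi * (p.2 : ℝ)))⁻¹, p.2)

/-- `d` is a Dehn twist along an embedded annulus in the oriented surface `(F, μ)`, with
model `tw` (`twistP` for a positive twist w.r.t. the orientation, `twistN` for a negative
one): `d` is supported in an oriented embedded annulus, where it is conjugate to the model
twist. -/
def IsDehnTwistWithModel (μ : SForm (𝓡 2) F 2) (tw : Ann → Ann) (d : F → F) : Prop :=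
  ContMDiff (𝓡 2) (𝓡 2) (⊤ : ℕ∞) d ∧ Function.Bijective d ∧
  ∃ e : Ann → F, ContMDiff IAnn (𝓡 2) (⊤ : ℕ∞) e ∧ Function.Injective e ∧
    (∀ p : Ann, Function.Injective (mfderiv IAnn (𝓡 2) e p)) ∧
    (∀ (p : Ann) (v w : TangentSpace IAnn p),
      0 < dphiA p v * dtA p w - dphiA p w * dtA p v →
      0 < pullbackRaw e μ.val p ![v, w]) ∧
    (∀ p : Ann, d (e p) = e (tw p)) ∧ (∀ x : F, x ∉ range e → d x = x)

/-- A positive (right-handed) Dehn twist on the oriented surface `(F, μ)`. -/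
def IsPosDehnTwist (μ : SForm (𝓡 2) F 2) (d : F → F) : Prop :=
  IsDehnTwistWithModel μ twistP d

/-- A negative (left-handed) Dehn twist on the oriented surface `(F, μ)`. -/
def IsNegDehnTwist (μ : SForm (𝓡 2) F 2) (d : F → F) : Prop :=
  IsDehnTwistWithModel μ twistN d

/-- Two self-maps of `F` are smoothly isotopic (through diffeomorphisms). -/
def IsIsotopic (d₀ d₁ : F → F) : Prop :=
  ∃ h : ℝ → F → F, ContMDiff (𝓘(ℝ, ℝ).prod (𝓡 2)) (𝓡 2) (⊤ : ℕ∞) (fun p : ℝ × F => h p.1 p.2) ∧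
    (∀ t : ℝ, Function.Bijective (h t)) ∧ (∀ x, h 0 x = d₀ x) ∧ (∀ x, h 1 x = d₁ x)

/-- An orientation-preserving diffeomorphism of the oriented surface `(F, μ)`. -/
def IsOrientPresDiffeo (μ : SForm (𝓡 2) F 2) (φ : F → F) : Prop :=
  ContMDiff (𝓡 2) (𝓡 2) (⊤ : ℕ∞) φ ∧ Function.Bijective φ ∧
    (∃ ψ : F → F, ContMDiff (𝓡 2) (𝓡 2) (⊤ : ℕ∞) ψ ∧ ∀ x, ψ (φ x) = x) ∧
    ∀ (x : F) (v : Fin 2 → TangentSpace (𝓡 2) x),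
      0 < μ.val x v → 0 < pullbackRaw φ μ.val x v

end DehnTwists


section FiberData

variable {V : Type*} [TopologicalSpace V] [ChartedSpace (Esp 3) V]
  [IsManifold (𝓡 3) (⊤ : ℕ∞) V] [CompactSpace V] [T2Space V]

/-- The fiber over `1 ∈ S¹` of a fibration `π : V → S¹`, realized as an embedded closed
surface. -/
structure FiberData (π : V → Circle) where
  F : Type
  [topF : TopologicalSpace F]
  [chF : ChartedSpace (Esp 2) F]
  [smF : IsManifold (𝓡 2) (⊤ : ℕ∞) F]
  [cptF : CompactSpace F]
  [t2F : T2Space F]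
  j : F → V
  smoothj : ContMDiff (𝓡 2) (𝓡 3) (⊤ : ℕ∞) j
  injj : Function.Injective j
  immj : ∀ z : F, Function.Injective (mfderiv (𝓡 2) (𝓡 3) j z)
  rangej : range j = π ⁻¹' {1}

attribute [instance] FiberData.topF FiberData.chF FiberData.smF FiberData.cptF FiberData.t2F

/-- `hol` is the holonomy (first-return) map of the characteristic foliation `ker ω` of the
symplectic fibration `(V, ω)` over `S¹`, on the fiber over `1`: every point is joined to its
image by a path tangent to `ker ω` lifting the counterclockwise parametrization
`t ↦ exp(2πit)` of the base circle. -/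
def IsHolonomy (π : V → Circle) (ω : RawForm (𝓡 3) V 2) (fd : FiberData π)
    (hol : fd.F → fd.F) : Prop :=
  ∀ z : fd.F, ∃ γ : ℝ → V, ContMDiff 𝓘(ℝ, ℝ) (𝓡 3) (⊤ : ℕ∞) γ ∧
    γ 0 = fd.j z ∧ γ 1 = fd.j (hol z) ∧
    (∀ t : ℝ, ((π (γ t) : ℂ)) = Complex.exp (2 * Real.pi * t * Complex.I)) ∧
    (∀ (t : ℝ) (w : TangentSpace (𝓡 3) (γ t)),
      ω (γ t) ![mfderiv 𝓘(ℝ, ℝ) (𝓡 3) γ t (1:ℝ), w] = 0)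

/-- As `IsHolonomy`, but traversing the base circle clockwise: the holonomy of the fibration
with the reversed orientation `-V`. -/
def IsHolonomyRev (π : V → Circle) (ω : RawForm (𝓡 3) V 2) (fd : FiberData π)
    (hol : fd.F → fd.F) : Prop :=
  ∀ z : fd.F, ∃ γ : ℝ → V, ContMDiff 𝓘(ℝ, ℝ) (𝓡 3) (⊤ : ℕ∞) γ ∧
    γ 0 = fd.j z ∧ γ 1 = fd.j (hol z) ∧
    (∀ t : ℝ, ((π (γ t) : ℂ)) = Complex.exp (-(2 * Real.pi * t) * Complex.I)) ∧
    (∀ (t : ℝ) (w : TangentSpace (𝓡 3) (γ t)),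
      ω (γ t) ![mfderiv 𝓘(ℝ, ℝ) (𝓡 3) γ t (1:ℝ), w] = 0)

end FiberData

section Lefschetz

variable {W : Type*} [TopologicalSpace W] [ChartedSpace (EuclideanHalfSpace 4) W]
  [IsManifold (𝓡∂ 4) (⊤ : ℕ∞) W] [CompactSpace W] [T2Space W]

/-- A Lefschetz fibration of a compact 4-manifold `W` over the closed unit disc `D² ⊂ ℂ`:
finitely many critical points in the interior, lying in distinct fibers, near which the map
is modeled on the nondegenerate holomorphic singularity `(z₁, z₂) ↦ z₁² + z₂²`; the map is a
submersion elsewhere, and the boundary of `W` is the preimage of the boundary circle. -/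
structure LefschetzFibration (W : Type*) [TopologicalSpace W]
    [ChartedSpace (EuclideanHalfSpace 4) W] [IsManifold (𝓡∂ 4) (⊤ : ℕ∞) W]
    [CompactSpace W] [T2Space W] where
  f : W → ℂ
  smooth : ContMDiff (𝓡∂ 4) 𝓘(ℝ, ℂ) (⊤ : ℕ∞) f
  im : range f ⊆ Metric.closedBall (0:ℂ) 1
  bd : f ⁻¹' (Metric.sphere (0:ℂ) 1) = (𝓡∂ 4).boundary W
  crit : Set W
  critFin : crit.Finite
  critInt : ∀ c ∈ crit, c ∉ (𝓡∂ 4).boundary W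
  critFibers : InjOn f crit
  subm : ∀ x : W, x ∉ crit → Function.Surjective (mfderiv (𝓡∂ 4) 𝓘(ℝ, ℂ) f x)
  model : ∀ c ∈ crit, ∃ (U : Set W) (ψ : W → ℂ × ℂ), IsOpen U ∧ c ∈ U ∧
    ContMDiffOn (𝓡∂ 4) 𝓘(ℝ, ℂ × ℂ) (⊤ : ℕ∞) ψ U ∧ InjOn ψ U ∧
    (∀ x ∈ U, Function.Injective (mfderiv (𝓡∂ 4) 𝓘(ℝ, ℂ × ℂ) ψ x)) ∧ ψ c = 0 ∧
    ∀ x ∈ U, f x = f c + (ψ x).1 ^ 2 + (ψ x).2 ^ 2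

/-- The symplectic form `Ω` is positive (and nondegenerate) on the fibers of the Lefschetz
fibration `L`, the fibers being oriented compatibly with the `Ω²`-orientation of `W` and the
complex orientation of the base. -/
def LefFiberPos (L : LefschetzFibration W) (Ω : RawForm (𝓡∂ 4) W 2) : Prop :=
  (∀ x : W, x ∉ L.crit → ∀ v w u₁ u₂ : TangentSpace (𝓡∂ 4) x,
    mfderiv (𝓡∂ 4) 𝓘(ℝ, ℂ) L.f x v = 0 → mfderiv (𝓡∂ 4) 𝓘(ℝ, ℂ) L.f x w = 0 →
    (show ℂ from mfderiv (𝓡∂ 4) 𝓘(ℝ, ℂ) L.f x u₁) = 1 →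
    (show ℂ from mfderiv (𝓡∂ 4) 𝓘(ℝ, ℂ) L.f x u₂) = Complex.I →
    0 < sympVolI Ω x ![u₁, u₂, v, w] → 0 < Ω x ![v, w]) ∧
  (∀ x : W, x ∉ L.crit → ∀ v : TangentSpace (𝓡∂ 4) x,
    mfderiv (𝓡∂ 4) 𝓘(ℝ, ℂ) L.f x v = 0 → v ≠ 0 →
    ∃ w : TangentSpace (𝓡∂ 4) x, mfderiv (𝓡∂ 4) 𝓘(ℝ, ℂ) L.f x w = 0 ∧ Ω x ![v, w] ≠ 0)

variable {V : Type*} [TopologicalSpace V] [ChartedSpace (Esp 3) V]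
  [IsManifold (𝓡 3) (⊤ : ℕ∞) V] [CompactSpace V] [T2Space V]

/-- The boundary restriction of the Lefschetz fibration `L` is the circle fibration
`π : V → S¹`, via the boundary identification `ι`. -/
def LefBoundaryFib (L : LefschetzFibration W) (ι : V → W) (π : V → Circle) : Prop :=
  IsBoundaryPatch ι ∧ range ι = (𝓡∂ 4).boundary W ∧ ∀ x : V, L.f (ι x) = (π x : ℂ)

/-- The fiber of a Lefschetz fibration over the base point `1 ∈ ∂D²`, realized as an
embedded closed surface. -/
structure LefFiber (L : LefschetzFibration W) where
  F : Type
  [topF : TopologicalSpace F]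
  [chF : ChartedSpace (Esp 2) F]
  [smF : IsManifold (𝓡 2) (⊤ : ℕ∞) F]
  [cptF : CompactSpace F]
  [t2F : T2Space F]
  j : F → W
  smoothj : ContMDiff (𝓡 2) (𝓡∂ 4) (⊤ : ℕ∞) j
  injj : Function.Injective j
  immj : ∀ z : F, Function.Injective (mfderiv (𝓡 2) (𝓡∂ 4) j z)
  rangej : range j = L.f ⁻¹' {1}

attribute [instance] LefFiber.topF LefFiber.chF LefFiber.smF LefFiber.cptF LefFiber.t2F

/-- `γ` (a loop in the reference fiber `fb`) is a vanishing cycle of the Lefschetz fibration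
`L`: it bounds a thimble, i.e. a disc fibered over an arc in the base which collapses onto a
critical point. -/
def IsVanishingCycle (L : LefschetzFibration W) (fb : LefFiber L) (γ : ℝ → fb.F) : Prop :=
  IsLoop (I := 𝓡 2) γ ∧
  ∃ Θ : ℝ → ℝ → W, Continuous (fun p : ℝ × ℝ => Θ p.1 p.2) ∧
    (∀ s : ℝ, Θ s 1 = fb.j (γ s)) ∧ (∀ s r : ℝ, Θ (s + 1) r = Θ s r) ∧
    (∃ c ∈ L.crit, ∀ s : ℝ, Θ s 0 = c) ∧
    (∀ s s' r : ℝ, L.f (Θ s r) = L.f (Θ s' r))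

end Lefschetz

section Homotopies

variable {V : Type*} [TopologicalSpace V] [ChartedSpace (Esp 3) V]
  [IsManifold (𝓡 3) (⊤ : ℕ∞) V] [CompactSpace V] [T2Space V]

/-- Two fiberwise-positive closed 2-forms on the fibration `π : V → S¹` are homotopic:
they are joined by a (pointwise-continuous) path of closed 2-forms positive on the fibers. -/
def FibHomotopic (π : V → Circle) (μ : SForm (𝓡 3) V 3)
    (ω₀ ω₁ : RawForm (𝓡 3) V 2) : Prop :=
  ∃ Θ : ℝ → SForm (𝓡 3) V 2,
    (∀ x v, (Θ 0).val x v = ω₀ x v) ∧ (∀ x v, (Θ 1).val x v = ω₁ x v) ∧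
    (∀ t : ℝ, t ∈ Icc (0:ℝ) 1 → IsClosedRaw (Θ t).val ∧ FiberPos3 π μ (Θ t).val) ∧
    (∀ (x : V) (v : Fin 2 → TangentSpace (𝓡 3) x), Continuous fun t : ℝ => (Θ t).val x v)

end Homotopies

section FundamentalGroupMaps

open CategoryTheory

/-- The homomorphism of fundamental groups induced by a continuous map. -/
def pi1Map {X Y : Type} [TopologicalSpace X] [TopologicalSpace Y] (f : C(X, Y)) (x : X) :
    FundamentalGroup X x →* FundamentalGroup Y (f x) :=
  CategoryTheory.Functor.mapEnd _
    (FundamentalGroupoid.fundamentalGroupoidFunctor.map (X := TopCat.of X) (Y := TopCat.of Y)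
      (TopCat.ofHom f))

/-- The class of a (continuous, period-1) loop based at `x₀` in the fundamental group. -/
def loopClass {X : Type} [TopologicalSpace X] {x₀ : X} (γ : ℝ → X) (hγ : Continuous γ)
    (h0 : γ 0 = x₀) (h1 : γ 1 = x₀) : FundamentalGroup X x₀ :=
  FundamentalGroup.fromPath (X := TopCat.of X)
    (Quotient.mk (Path.Homotopic.setoid x₀ x₀)
      { toFun := fun t : unitInterval => γ t
        continuous_toFun := hγ.comp continuous_subtype_val
        source' := h0
        target' := h1 })

end FundamentalGroupMaps


section BindingModel

/-- The model (solid-torus) neighborhood `[0, R] × S¹ × S¹` of an open book binding, with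
coordinates `(r, φ, u)`. -/
abbrev NbModel (R : ℝ) [Fact ((0:ℝ) < R)] : Type := (Set.Icc (0:ℝ) R) × (Circle × Circle)

/-- The model-with-corners for `NbModel`. -/
abbrev INb := (𝓡∂ 1).prod ((𝓡 1).prod (𝓡 1))

variable {R : ℝ} [Fact ((0:ℝ) < R)]

/-- The `dφ`-component of a tangent vector to the model neighborhood. -/
def dphiNb (p : NbModel R) (v : TangentSpace INb p) : ℝ :=
  ((show ℂ from mfderiv INb 𝓘(ℝ, ℂ) (fun q : NbModel R => ((q.2.1 : ℂ))) p v) *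
    (starRingEnd ℂ) (Complex.I * (p.2.1 : ℂ))).re

/-- The `du`-component of a tangent vector to the model neighborhood. -/
def duNb (p : NbModel R) (v : TangentSpace INb p) : ℝ :=
  ((show ℂ from mfderiv INb 𝓘(ℝ, ℂ) (fun q : NbModel R => ((q.2.2 : ℂ))) p v) *
    (starRingEnd ℂ) (Complex.I * (p.2.2 : ℂ))).re

/-- The model contact form `h(r)(du + r² dφ)` on the model neighborhood, as a raw 1-form. -/
def modelFormRaw (R : ℝ) [Fact ((0:ℝ) < R)] (h : ℝ → ℝ) : RawForm INb (NbModel R) 1 :=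
  fun p v => h (p.1 : ℝ) * (duNb p (v 0) + ((p.1 : ℝ)) ^ 2 * dphiNb p (v 0))

/-- The conditions on the coefficient function `h` of the normal form of a contact form
compatible with an open book: smooth, `h > 0`, `h(r) - h(0) = -r²` near `r = 0`, and
`h' < 0` for `r > 0`. -/
def NormalFormFun (R : ℝ) (h : ℝ → ℝ) : Prop :=
  ContDiffOn ℝ (⊤ : ℕ∞) h (Icc 0 R) ∧ (∀ r ∈ Icc (0:ℝ) R, 0 < h r) ∧
    (∃ δ > (0:ℝ), ∀ r ∈ Icc (0:ℝ) δ, h r - h 0 = -(r ^ 2)) ∧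
    (∀ r : ℝ, 0 < r → r ≤ R → deriv h r < 0)

variable {V : Type*} [TopologicalSpace V] [ChartedSpace (Esp 3) V]
  [IsManifold (𝓡 3) (⊤ : ℕ∞) V] [CompactSpace V] [T2Space V]

/-- The contact form `lam` on `V` is compatible with the open book `ob`, with normal form
`h(r)(du + r²dφ)` on the model tubular neighborhood `[0,R] × S¹ × S¹` of the binding
(embedded by `Ψ`): the pages intersect the neighborhood in `{φ = const}`, and `d(lam)` is
nonvanishing on the pages off the binding. -/
structure CompatibleNormalForm (ob : OpenBook V) (lam : SForm (𝓡 3) V 1) (R : ℝ)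
    [Fact ((0:ℝ) < R)] (h : ℝ → ℝ) where
  hfun : NormalFormFun R h
  /-- the tubular neighborhood embedding of the model around the binding -/
  Ψ : NbModel R → V
  smoothΨ : ContMDiff INb (𝓡 3) (⊤ : ℕ∞) Ψ
  injΨ : Function.Injective Ψ
  immΨ : ∀ p : NbModel R, Function.Injective (mfderiv INb (𝓡 3) Ψ p)
  bindingEq : Ψ '' {p : NbModel R | (p.1 : ℝ) = 0} = ob.binding
  offBinding : ∀ p : NbModel R, 0 < (p.1 : ℝ) → ob.Φ (Ψ p) ≠ 0
  /-- the pages are `{φ = const}` in the model neighborhood -/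
  pagesAlign : ∀ p : NbModel R, 0 < (p.1 : ℝ) → ob.angle (Ψ p) = (p.2.1 : ℂ)
  /-- the normal form `Ψ^* lam = h(r)(du + r² dφ)` -/
  normal : ∀ (p : NbModel R) (v : Fin 1 → TangentSpace INb p),
    pullbackRaw Ψ lam.val p v = modelFormRaw R h p v
  /-- `d(lam)` does not vanish on the pages with the binding deleted -/
  pagesSymp : ∀ x : V, ob.Φ x ≠ 0 → ∃ u w : Esp 3,
    dMapC (I := 𝓡 3) ob.angle x u = 0 ∧ dMapC (I := 𝓡 3) ob.angle x w = 0 ∧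
    dValC lam.val x ![u, w] ≠ 0

end BindingModel


set_option linter.unusedSectionVars false
set_option linter.unusedSimpArgs false
set_option linter.unusedVariables false

section FlowBanach
open Topology Filter

variable {K : Type*} [TopologicalSpace K] [CompactSpace K]
  {E : Type} [NormedAddCommGroup E] [NormedSpace ℝ E]
  {G : Type*} [NormedAddCommGroup G] [NormedSpace ℝ G]

/-- Pointwise application of a continuous family of operators. -/
def nemApply : C(K, E →L[ℝ] G) →L[ℝ] (C(K, E) →L[ℝ] C(K, G)) :=
  LinearMap.mkContinuous₂
    (LinearMap.mk₂ ℝ (fun (A : C(K, E →L[ℝ] G)) (y : C(K, E)) =>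
      (⟨fun k => A k (y k), by fun_prop⟩ : C(K, G)))
      (by intros; ext; simp) (by intros; ext; simp) (by intros; ext; simp) (by intros; ext; simp))
    1 (by
      intro A y
      rw [one_mul, ContinuousMap.norm_le _ (by positivity)]
      intro k
      exact (A k).le_opNorm_of_le (y.norm_coe_le_norm k) |>.trans
        (by gcongr; exact A.norm_coe_le_norm k))

@[simp] lemma nemApply_apply (A : C(K, E →L[ℝ] G)) (y : C(K, E)) (k : K) :
    nemApply A y k = A k (y k) := rfl

/-- The Nemytskii operator. -/
def nem (f : C(E, G)) (y : C(K, E)) : C(K, G) := f.comp y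

lemma nem_continuous (f : C(E, G)) : Continuous (nem (K := K) f) :=
  ContinuousMap.continuous_postcomp f

lemma nem_hasFDerivAt (f : C(E, G)) (f' : C(E, E →L[ℝ] G))
    (hf : ∀ x, HasFDerivAt f (f' x) x) (y : C(K, E)) :
    HasFDerivAt (nem (K := K) f) (nemApply (nem f' y)) y := by
  rw [hasFDerivAt_iff_isLittleO_nhds_zero, Asymptotics.isLittleO_iff]
  intro c hc
  have h1 := Metric.continuous_iff.1 (nem_continuous (K := K) f') y c hc
  obtain ⟨δ, hδ, h1⟩ := h1
  filter_upwards [Metric.ball_mem_nhds (0 : C(K, E)) hδ] with h hh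
  rw [ContinuousMap.norm_le _ (by positivity)]
  intro k
  have hbd : ∀ v : E, ‖v‖ < δ → ‖f' (y k + v) - f' (y k)‖ ≤ c := by
    intro v hv
    have h2 := h1 (y + ContinuousMap.const K v) (by
      rw [dist_eq_norm, add_sub_cancel_left]
      exact lt_of_le_of_lt ((ContinuousMap.norm_le _ (norm_nonneg v)).2 (fun k => le_rfl)) hv)
    rw [dist_eq_norm] at h2
    exact (ContinuousMap.norm_coe_le_norm (nem f' (y + ContinuousMap.const K v) - nem f' y) k).trans
      h2.le
  have hk : ‖h k‖ < δ := lt_of_le_of_lt (h.norm_coe_le_norm k) (by simpa using hh)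
  have hmv := (convex_ball (y k) δ).norm_image_sub_le_of_norm_hasFDerivWithin_le'
    (f := f) (f' := f') (φ := f' (y k)) (C := c) (x := y k) (y := y k + h k)
    (fun x _ => (hf x).hasFDerivWithinAt)
    (fun x hx => by
      have := hbd (x - y k) (by simpa [dist_eq_norm] using hx)
      simpa using this)
    (by simpa using hδ) (by simpa using hk)
  simp only [add_sub_cancel_left] at hmv
  refine le_trans ?_ (hmv.trans ?_)
  · simp [nem]
  · gcongr; exact h.norm_coe_le_norm k

lemma nem_contDiff (n : ℕ) : ∀ {G : Type} [NormedAddCommGroup G] [NormedSpace ℝ G]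
    (f : C(E, G)), ContDiff ℝ n f → ContDiff ℝ n (nem (K := K) f) := by
  induction n with
  | zero => intro G _ _ f hf; exact contDiff_zero.2 (nem_continuous f)
  | succ n ih =>
    intro G _ _ f hf
    have hf' := (contDiff_succ_iff_fderiv (n := (n : WithTop ℕ∞)) (𝕜 := ℝ) (f := f)).1 (by exact_mod_cast hf)
    let f' : C(E, E →L[ℝ] G) := ⟨fderiv ℝ f, hf'.2.2.continuous⟩
    have hd := nem_hasFDerivAt (K := K) f f' (fun x => (hf'.1 x).hasFDerivAt)
    have : ((n + 1 : ℕ) : WithTop ℕ∞) = n + 1 := by norm_cast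
    rw [this, contDiff_succ_iff_fderiv]
    refine ⟨fun y => (hd y).differentiableAt, by simp, ?_⟩
    have : fderiv ℝ (nem (K := K) f) = fun y => nemApply (nem f' y) := by
      ext1 y; exact (hd y).fderiv
    rw [this]
    exact nemApply.contDiff.comp (ih f' hf'.2.2)

end FlowBanach

section FlowBanach2
open Topology Filter MeasureTheory

variable {E : Type} [NormedAddCommGroup E] [NormedSpace ℝ E] [CompleteSpace E]

abbrev KI : Type := Icc (-1 : ℝ) 1

lemma KI_le : (-1 : ℝ) ≤ 1 := by norm_num

/-- Extension of a curve on `[-1,1]` by constants. -/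
abbrev kext (z : C(KI, E)) : ℝ → E := IccExtend KI_le z

lemma kext_continuous (z : C(KI, E)) : Continuous (kext z) := z.continuous.Icc_extend'

lemma kext_norm (z : C(KI, E)) (s : ℝ) : ‖kext z s‖ ≤ ‖z‖ := z.norm_coe_le_norm _

/-- integration operator. -/
def kint : C(KI, E) →L[ℝ] C(KI, E) :=
  LinearMap.mkContinuous
    { toFun := fun z => ⟨fun s => ∫ τ in (0:ℝ)..s, kext z τ, by
        have := intervalIntegral.continuous_primitive
          (fun a b => (kext_continuous z).intervalIntegrable a b) (μ := volume) 0
        exact this.comp continuous_subtype_val⟩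
      map_add' := by
        intro z w; ext s
        simp only [ContinuousMap.coe_mk, ContinuousMap.add_apply]
        rw [← intervalIntegral.integral_add ((kext_continuous z).intervalIntegrable _ _)
          ((kext_continuous w).intervalIntegrable _ _)]
        rfl
      map_smul' := by
        intro c z; ext s
        simp only [ContinuousMap.coe_mk, ContinuousMap.smul_apply, RingHom.id_apply]
        rw [← intervalIntegral.integral_smul]
        rfl }
    1 (by
      intro z
      rw [one_mul, ContinuousMap.norm_le _ (by positivity)]
      intro s
      refine (intervalIntegral.norm_integral_le_of_norm_le_const (C := ‖z‖)
        (fun x _ => kext_norm z x)).trans ?_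
      have : |(s:ℝ) - 0| ≤ 1 := by rw [sub_zero, abs_le]; exact s.2
      nlinarith [norm_nonneg z])

lemma kint_apply (z : C(KI, E)) (s : KI) : kint z s = ∫ τ in (0:ℝ)..s, kext z τ := rfl

lemma exists_param_curve (n : ℕ) (hn : n ≠ 0) (V : E → E) (hV : ContDiff ℝ n V) (x0 : E) :
    ∃ Y : ℝ × E → C(KI, E), ContDiffAt ℝ n Y (0, x0) ∧ Y (0, x0) = ContinuousMap.const _ x0 ∧
      ∀ᶠ p in 𝓝 ((0 : ℝ), x0), kext (Y p) 0 = p.2 ∧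
        ∀ s ∈ Ioo (-1 : ℝ) 1, HasDerivAt (kext (Y p)) (p.1 • V (kext (Y p) s)) s := by
  let Vc : C(E, E) := ⟨V, hV.continuous⟩
  let cst : E →L[ℝ] C(KI, E) := ContinuousLinearMap.const ℝ KI
  let F : (ℝ × E) × C(KI, E) → C(KI, E) := fun q => q.2 - cst q.1.2 - q.1.1 • kint (nem Vc q.2)
  have hF : ContDiff ℝ n F := by
    have h1 : ContDiff ℝ n (nem (K := KI) Vc) := nem_contDiff n Vc hV
    have h2 : ContDiff ℝ n (fun q : (ℝ × E) × C(KI, E) => kint (nem Vc q.2)) :=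
      kint.contDiff.comp (h1.comp contDiff_snd)
    have h3 : ContDiff ℝ n (fun q : (ℝ × E) × C(KI, E) => cst q.1.2) :=
      cst.contDiff.comp (contDiff_snd.comp contDiff_fst)
    exact (contDiff_snd.sub h3).sub ((contDiff_fst.comp contDiff_fst).smul h2)
  have hn' : (n : WithTop ℕ∞) ≠ 0 := by exact_mod_cast hn
  let u : (ℝ × E) × C(KI, E) := ((0, x0), cst x0)
  have cdf : ContDiffAt ℝ n F u := hF.contDiffAt
  have hinr : fderiv ℝ F u ∘L .inr ℝ (ℝ × E) C(KI, E) = .id ℝ _ := by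
    have h1 : HasFDerivAt F (fderiv ℝ F u) u := (cdf.differentiableAt hn').hasFDerivAt
    have h2 : HasFDerivAt (fun y : C(KI, E) => (((0 : ℝ), x0), y)) (.inr ℝ (ℝ × E) C(KI, E)) (cst x0) :=
      hasFDerivAt_prodMk_right _ _
    have h3 := HasFDerivAt.comp (cst x0) (f := fun y : C(KI, E) => (((0 : ℝ), x0), y)) (g := F) h1 h2
    have h4 : (F ∘ fun y : C(KI, E) => (((0 : ℝ), x0), y)) = fun y => y - cst x0 := by
      ext1 y; simp [F]
    rw [h4] at h3
    exact h3.unique ((hasFDerivAt_id _).sub_const _)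
  have hinv : (fderiv ℝ F u ∘L .inr ℝ (ℝ × E) C(KI, E)).IsInvertible := by
    rw [hinr]; exact ⟨ContinuousLinearEquiv.refl ℝ _, rfl⟩
  refine ⟨cdf.implicitFunction hn' hinv, cdf.contDiffAt_implicitFunction hn' hinv,
    cdf.implicitFunction_apply_self hn' hinv, ?_⟩
  filter_upwards [cdf.eventually_apply_implicitFunction hn' hinv] with p hp
  set y := cdf.implicitFunction hn' hinv p with hy
  have hFu : F u = 0 := by simp [F, u]
  rw [hFu] at hp
  have hp' : ∀ s : KI, y s = p.2 + p.1 • ∫ τ in (0:ℝ)..s, V (kext y τ) := by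
    intro s
    have := DFunLike.congr_fun hp s
    simp only [F, ContinuousMap.sub_apply, ContinuousMap.smul_apply, kint_apply,
      ContinuousMap.zero_apply] at this
    have h5 : (cst p.2) s = p.2 := rfl
    have h6 : kext (nem Vc y) = fun τ => V (kext y τ) := rfl
    rw [h5, h6, sub_sub, sub_eq_zero] at this
    exact this
  constructor
  · have := hp' ⟨0, by norm_num⟩
    simp only [intervalIntegral.integral_same, smul_zero, add_zero] at this
    rw [← this]
    exact IccExtend_of_mem KI_le _ _
  · intro s hs
    have hc : Continuous (fun τ => V (kext y τ)) := hV.continuous.comp (kext_continuous y)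
    have h1 : HasDerivAt (fun s : ℝ => p.2 + p.1 • ∫ τ in (0:ℝ)..s, V (kext y τ))
        (p.1 • V (kext y s)) s :=
      ((intervalIntegral.integral_hasDerivAt_right (hc.intervalIntegrable _ _)
        (hc.stronglyMeasurableAtFilter _ _) hc.continuousAt).const_smul p.1).const_add _
    refine h1.congr_of_eventuallyEq ?_
    filter_upwards [isOpen_Ioo.mem_nhds hs] with r hr
    rw [← hp' ⟨r, Ioo_subset_Icc_self hr⟩]
    exact IccExtend_of_mem KI_le _ _

end FlowBanach2

section ChartBasics
open Topology Filter

variable {F : Type*} [TopologicalSpace F] [ChartedSpace (Esp 2) F]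

/-- Preferred chart. -/
abbrev ch (x : F) : PartialEquiv F (Esp 2) := extChartAt (𝓡 2) x

/-- Derivative of the chart. -/
def dch (x z : F) : Esp 2 →L[ℝ] Esp 2 := mfderiv (𝓡 2) 𝓘(ℝ, Esp 2) (ch x) z

/-- Derivative of the inverse chart. -/
def dsy (x : F) (y : Esp 2) : Esp 2 →L[ℝ] Esp 2 := mfderiv 𝓘(ℝ, Esp 2) (𝓡 2) (ch x).symm y

/-- Derivative of a self-map. -/
def DD (f : F → F) (x : F) : Esp 2 →L[ℝ] Esp 2 := mfderiv (𝓡 2) (𝓡 2) f x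

/-- Derivative of a function. -/
def dfun (u : F → ℝ) (x : F) : Esp 2 →L[ℝ] ℝ := mfderiv (𝓡 2) 𝓘(ℝ, ℝ) u x

/-- velocity of a curve. -/
def vel (γ : ℝ → F) (t : ℝ) : Esp 2 := mfderiv 𝓘(ℝ, ℝ) (𝓡 2) γ t (1 : ℝ)

lemma ch_target_open (x : F) : IsOpen (ch x).target := isOpen_extChartAt_target x
lemma ch_source_open (x : F) : IsOpen (ch x).source := isOpen_extChartAt_source x
lemma mem_ch_source (x : F) : x ∈ (ch x).source := mem_extChartAt_source x
lemma ch_target_mem (x : F) {y : Esp 2} (hy : y ∈ (ch x).target) : (ch x).target ∈ 𝓝 y :=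
  (ch_target_open x).mem_nhds hy
lemma ch_symm_contAt (x : F) {y : Esp 2} (hy : y ∈ (ch x).target) :
    ContinuousAt (ch x).symm y := continuousAt_extChartAt_symm'' hy
lemma ch_contAt (x : F) {z : F} (hz : z ∈ (ch x).source) : ContinuousAt (ch x) z :=
  continuousAt_extChartAt' hz

variable [IsManifold (𝓡 2) (⊤ : ℕ∞) F]

instance isManifoldOneAux : IsManifold (𝓡 2) 1 F := IsManifold.of_le (n := (⊤ : ℕ∞)) (by exact_mod_cast le_top)

lemma ch_smooth (x : F) {z : F} (hz : z ∈ (ch x).source) :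
    ContMDiffAt (𝓡 2) 𝓘(ℝ, Esp 2) (⊤ : ℕ∞) (ch x) z :=
  contMDiffAt_extChartAt' (by simpa using hz)

lemma chsy_smooth (x : F) {y : Esp 2} (hy : y ∈ (ch x).target) :
    ContMDiffAt 𝓘(ℝ, Esp 2) (𝓡 2) (⊤ : ℕ∞) (ch x).symm y :=
  (contMDiffOn_extChartAt_symm x).contMDiffAt (ch_target_mem x hy)

lemma top_ne : ((⊤ : ℕ∞) : WithTop ℕ∞) ≠ 0 := by simp

lemma ch_hasMF (x : F) {z : F} (hz : z ∈ (ch x).source) :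
    HasMFDerivAt (𝓡 2) 𝓘(ℝ, Esp 2) (ch x) z (dch x z) :=
  ((ch_smooth x hz).mdifferentiableAt top_ne).hasMFDerivAt

lemma chsy_hasMF (x : F) {y : Esp 2} (hy : y ∈ (ch x).target) :
    HasMFDerivAt 𝓘(ℝ, Esp 2) (𝓡 2) (ch x).symm y (dsy x y) :=
  ((chsy_smooth x hy).mdifferentiableAt top_ne).hasMFDerivAt

lemma dch_dsy (x : F) {y : Esp 2} (hy : y ∈ (ch x).target) (v : Esp 2) :
    dch x ((ch x).symm y) (dsy x y v) = v := by
  have h1 := (ch_hasMF x ((ch x).map_target hy)).comp y (chsy_hasMF x hy)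
  have h2 : HasMFDerivAt 𝓘(ℝ, Esp 2) 𝓘(ℝ, Esp 2) (ch x ∘ (ch x).symm) y
      (ContinuousLinearMap.id ℝ (Esp 2)) := by
    refine (hasMFDerivAt_id (I := 𝓘(ℝ, Esp 2)) y).congr_of_eventuallyEq ?_
    filter_upwards [ch_target_mem x hy] with w hw
    exact (ch x).right_inv hw
  have := hasMFDerivAt_unique h1 h2
  exact DFunLike.congr_fun this v

lemma dsy_dch (x : F) {y : Esp 2} (hy : y ∈ (ch x).target) (v : Esp 2) :
    dsy x y (dch x ((ch x).symm y) v) = v := by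
  have hz := (ch x).map_target hy
  have e := (ch x).right_inv hy
  have h0 : HasMFDerivAt 𝓘(ℝ, Esp 2) (𝓡 2) (ch x).symm (ch x ((ch x).symm y)) (dsy x y) := by
    have := chsy_hasMF x hy
    rw [← e] at this
    convert this using 1
    rw [e]
  have h1 := h0.comp ((ch x).symm y) (ch_hasMF x hz)
  have h2 : HasMFDerivAt (𝓡 2) (𝓡 2) ((ch x).symm ∘ ch x) ((ch x).symm y)
      (ContinuousLinearMap.id ℝ (Esp 2)) := by
    refine (hasMFDerivAt_id (I := 𝓡 2) ((ch x).symm y)).congr_of_eventuallyEq ?_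
    filter_upwards [(ch_source_open x).mem_nhds hz] with w hw
    exact (ch x).left_inv hw
  have := hasMFDerivAt_unique h1 h2
  exact DFunLike.congr_fun this v

end ChartBasics

section Flow
open Topology Filter

variable {F : Type*} [TopologicalSpace F] [ChartedSpace (Esp 2) F]
  [IsManifold (𝓡 2) (⊤ : ℕ∞) F]

/-- vector field in a chart -/
def vch (X : F → Esp 2) (x : F) (y : Esp 2) : Esp 2 := dch x ((ch x).symm y) (X ((ch x).symm y))

/-- Smooth vector field (in charts). -/
def SmoothVF (X : F → Esp 2) : Prop :=
  ∀ x : F, ContDiffOn ℝ (⊤ : ℕ∞) (vch X x) (ch x).target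

/-- vector field viewed as tangent section -/
def tvf (X : F → Esp 2) : ∀ x : F, TangentSpace (𝓡 2) x := fun x => X x

lemma cutoff_exists (x0 : Esp 2) (O : Set (Esp 2)) (hO : O ∈ 𝓝 x0) (v : Esp 2 → Esp 2)
    (hv : ContDiffOn ℝ (⊤ : ℕ∞) v O) : ∃ r > 0, Metric.ball x0 r ⊆ O ∧ ∃ V : Esp 2 → Esp 2,
      ContDiff ℝ (⊤ : ℕ∞) V ∧ ∀ y ∈ Metric.ball x0 r, V y = v y := by
  obtain ⟨R, hR, hRO⟩ := Metric.mem_nhds_iff.1 hO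
  let χ : ContDiffBump x0 := ⟨R / 4, R / 2, by positivity, by linarith⟩
  refine ⟨R / 4, by positivity, (Metric.ball_subset_ball (by linarith)).trans hRO,
    fun y => χ y • v y, ?_, ?_⟩
  · rw [contDiff_iff_contDiffAt]
    intro y
    by_cases hy : y ∈ Metric.ball x0 R
    · exact χ.contDiff.contDiffAt.smul
        ((hv.mono hRO).contDiffAt (Metric.isOpen_ball.mem_nhds hy))
    · have : (fun y => χ y • v y) =ᶠ[𝓝 y] fun _ => 0 := by
        have hmem : (Metric.closedBall x0 (R / 2))ᶜ ∈ 𝓝 y := by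
          refine Metric.isClosed_closedBall.isOpen_compl.mem_nhds ?_
          simp only [Metric.mem_ball, not_lt] at hy
          simp only [mem_compl_iff, Metric.mem_closedBall, not_le]
          linarith
        filter_upwards [hmem] with z hz
        have : χ z = 0 := χ.zero_of_le_dist (by
          simp only [mem_compl_iff, Metric.mem_closedBall, not_le] at hz
          exact hz.le)
        rw [this, zero_smul]
      exact contDiffAt_const.congr_of_eventuallyEq this
  · intro y hy
    have : χ y = 1 := χ.one_of_mem_closedBall (Metric.ball_subset_closedBall hy)
    simp [this]

lemma local_flow (X : F → Esp 2) (hX : SmoothVF X) (x0 : F) (n : ℕ) (hn : n ≠ 0) :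
    ∃ ψ : ℝ × F → ℝ → F,
      ContMDiffAt (𝓘(ℝ, ℝ).prod (𝓡 2)) (𝓡 2) n (fun p => ψ p (1 / 2)) ((0 : ℝ), x0) ∧
      ∀ᶠ p in 𝓝 ((0 : ℝ), x0), ψ p 0 = p.2 ∧
        IsMIntegralCurveOn (ψ p) (tvf (p.1 • X)) (Ioo (-1) 1) := by
  set c := ch x0 with hc
  have hx0 : c x0 ∈ c.target := c.map_source (mem_ch_source x0)
  obtain ⟨r, hr, hrO, V, hV, hVv⟩ := cutoff_exists (c x0) c.target (ch_target_mem x0 hx0) _ (hX x0)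
  obtain ⟨Y, hY, hY0, hYe⟩ := exists_param_curve n hn V (hV.of_le (by exact_mod_cast le_top)) (c x0)
  have hp : ContMDiffAt (𝓘(ℝ, ℝ).prod (𝓡 2)) 𝓘(ℝ, ℝ × Esp 2) n
      (fun p : ℝ × F => (p.1, c p.2)) ((0 : ℝ), x0) := by
    refine contMDiffAt_fst.prodMk_space ?_
    exact ContMDiffAt.comp ((0 : ℝ), x0) (g := c) (f := fun p : ℝ × F => p.2)
      ((ch_smooth x0 (mem_ch_source x0)).of_le (by exact_mod_cast le_top)) contMDiffAt_snd
  refine ⟨fun p s => c.symm (kext (Y (p.1, c p.2)) s), ?_, ?_⟩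
  · have hev : ContDiffAt ℝ n (fun q : ℝ × Esp 2 => kext (Y q) (1 / 2)) ((0 : ℝ), c x0) := by
      have h1 : (fun q : ℝ × Esp 2 => kext (Y q) (1 / 2)) =
          fun q => (ContinuousMap.evalCLM ℝ (⟨1 / 2, by norm_num⟩ : KI)) (Y q) := by
        ext1 q
        exact IccExtend_of_mem KI_le _ (by norm_num)
      rw [h1]
      exact (ContinuousLinearMap.contDiff _).contDiffAt.comp _ hY
    have hval : kext (Y ((0 : ℝ), c x0)) (1 / 2) = c x0 := by rw [hY0]; rfl
    have h2 : ContMDiffAt (𝓘(ℝ, ℝ).prod (𝓡 2)) 𝓘(ℝ, Esp 2) n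
        (fun p : ℝ × F => kext (Y (p.1, c p.2)) (1 / 2)) ((0 : ℝ), x0) :=
      ContMDiffAt.comp ((0 : ℝ), x0) (g := fun q : ℝ × Esp 2 => kext (Y q) (1 / 2))
        (f := fun p : ℝ × F => (p.1, c p.2)) hev.contMDiffAt hp
    refine ContMDiffAt.comp ((0 : ℝ), x0) (g := c.symm) (f := fun p : ℝ × F => kext (Y (p.1, c p.2)) (1 / 2)) ?_ h2
    simp only [hval]
    exact (chsy_smooth x0 hx0).of_le (by exact_mod_cast le_top)
  · have hcont : ContinuousAt (fun p : ℝ × F => (p.1, c p.2)) ((0 : ℝ), x0) := hp.continuousAt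
    have hYc : ContinuousAt Y ((0 : ℝ), c x0) := hY.continuousAt
    have e1 : ∀ᶠ q in 𝓝 ((0 : ℝ), c x0), Y q ∈ Metric.ball (ContinuousMap.const KI (c x0)) r := by
      have := hYc.eventually_mem (Metric.ball_mem_nhds (Y (0, c x0)) hr)
      rwa [hY0] at this
    have e2 : ∀ᶠ p : ℝ × F in 𝓝 ((0 : ℝ), x0), p.2 ∈ c.source :=
      continuousAt_snd.eventually_mem ((ch_source_open x0).mem_nhds (mem_ch_source x0))
    filter_upwards [hcont.eventually hYe, hcont.eventually e1, e2] with p h1 h2 h3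
    have hball : ∀ s, kext (Y (p.1, c p.2)) s ∈ Metric.ball (c x0) r := by
      intro s
      exact lt_of_le_of_lt (ContinuousMap.dist_apply_le_dist (f := Y (p.1, c p.2))
        (g := ContinuousMap.const KI (c x0)) _) h2
    constructor
    · rw [h1.1]; exact c.left_inv h3
    · intro s hs
      refine HasMFDerivAt.hasMFDerivWithinAt ?_
      have hy := hrO (hball s)
      have hd := (h1.2 s hs).hasFDerivAt.hasMFDerivAt
      have := (chsy_hasMF x0 hy).comp s hd
      refine HasMFDerivAt.congr_mfderiv this ?_
      have h4 := hVv _ (hball s)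
      have h5 := dsy_dch x0 hy (X (c.symm (kext (Y (p.1, c p.2)) s)))
      refine ContinuousLinearMap.ext_ring ?_
      change dsy x0 _ ((1:ℝ) • (p.1 • V _)) = (1:ℝ) • (p.1 • X (c.symm (kext (Y (p.1, c p.2)) s)))
      rw [h4, one_smul, one_smul, map_smul, vch, h5]

end Flow

section Flow2
open Topology Filter

variable {F : Type*} [TopologicalSpace F] [ChartedSpace (Esp 2) F]
  [IsManifold (𝓡 2) (⊤ : ℕ∞) F]

lemma SmoothVF.asSection (X : F → Esp 2) (hX : SmoothVF X) :
    ContMDiff (𝓡 2) (𝓡 2).tangent 1 (fun x => (⟨x, tvf X x⟩ : TangentBundle (𝓡 2) F)) := by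
  intro x0
  refine (Bundle.contMDiffAt_section (F := Esp 2) (E := fun x : F => TangentSpace (𝓡 2) x)
    (s := tvf X) x0).2 ?_
  have h1 : ContMDiffAt (𝓡 2) 𝓘(ℝ, Esp 2) 1 (fun z => vch X x0 (ch x0 z)) x0 := by
    have h0 := (hX x0).contDiffAt (ch_target_mem x0 ((ch x0).map_source (mem_ch_source x0)))
    exact ContMDiffAt.comp x0 (g := vch X x0) (f := ch x0)
      (h0.contMDiffAt.of_le (by exact_mod_cast le_top))
      ((ch_smooth x0 (mem_ch_source x0)).of_le (by exact_mod_cast le_top))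
  refine h1.congr_of_eventuallyEq ?_
  filter_upwards [(ch_source_open x0).mem_nhds (mem_ch_source x0)] with z hz
  have hz' : z ∈ (chartAt (Esp 2) x0).source := by simpa using hz
  have h2 := TangentBundle.continuousLinearMapAt_trivializationAt (I := 𝓡 2) hz'
  have h3 : (trivializationAt (Esp 2) (TangentSpace (𝓡 2)) x0 ⟨z, tvf X z⟩).2 =
      (trivializationAt (Esp 2) (TangentSpace (𝓡 2)) x0).continuousLinearMapAt ℝ z (tvf X z) := by
    rw [Bundle.Trivialization.continuousLinearMapAt_apply,
      Bundle.Trivialization.linearMapAt_apply, if_pos (by simpa using hz')]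
  rw [h3, h2]
  unfold vch
  rw [(ch x0).left_inv hz]
  rfl

lemma SmoothVF.smul {X : F → Esp 2} (hX : SmoothVF X) (a : ℝ) : SmoothVF (a • X) := by
  intro x
  have : vch (a • X) x = fun y => a • vch X x y := by
    ext1 y; simp [vch]
  rw [this]
  exact (hX x).const_smul a

lemma tube_zero [CompactSpace F] {P : ℝ × F → Prop} (h : ∀ x : F, ∀ᶠ p in 𝓝 ((0 : ℝ), x), P p) :
    ∃ δ > 0, ∀ t : ℝ, |t| < δ → ∀ x, P (t, x) := by
  have h1 : ∀ᶠ t in 𝓝 (0 : ℝ), ∀ x ∈ (univ : Set F), P (t, x) :=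
    isCompact_univ.eventually_forall_of_forall_eventually
      (P := fun t x => P (t, x)) (x₀ := (0:ℝ)) (fun x _ => by exact h x)
  obtain ⟨δ, hδ, h2⟩ := Metric.eventually_nhds_iff.1 h1
  exact ⟨δ, hδ, fun t ht x => h2 (by simpa using ht) x (mem_univ x)⟩

theorem exists_flow [CompactSpace F] [T2Space F] (X : F → Esp 2) (hX : SmoothVF X) :
    ∃ φ : ℝ → F → F,
      ContMDiff (𝓘(ℝ, ℝ).prod (𝓡 2)) (𝓡 2) (⊤ : ℕ∞) (fun p : ℝ × F => φ p.1 p.2) ∧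
      (∀ x, φ 0 x = x) ∧ (∀ s t x, φ (s + t) x = φ s (φ t x)) ∧
      ∀ x, IsMIntegralCurve (fun t => φ t x) (tvf X) := by
  have hv := SmoothVF.asSection X hX
  have hex : ∀ x : F, ∃ γ : ℝ → F, γ 0 = x ∧ IsMIntegralCurve γ (tvf X) := by
    obtain ⟨δ, hδ, hP⟩ := tube_zero (F := F) (P := fun p => ∃ ψ : ℝ → F, ψ 0 = p.2 ∧
        IsMIntegralCurveOn ψ (tvf (p.1 • X)) (Ioo (-1) 1)) (fun x => by
      obtain ⟨ψ, _, h⟩ := local_flow X hX x 1 one_ne_zero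
      filter_upwards [h] with p hp
      exact ⟨ψ p, hp⟩)
    have ha : 0 < δ / 2 := by positivity
    refine exists_isMIntegralCurve_of_isMIntegralCurveOn hv ha (fun x => ?_)
    obtain ⟨ψ, h0, h1⟩ := hP (δ / 2) (by rw [abs_of_pos ha]; linarith) x
    refine ⟨ψ ∘ (· * (δ / 2)⁻¹), by simpa using h0, ?_⟩
    have h2 := h1.comp_mul (δ / 2)⁻¹
    have e1 : ((δ / 2)⁻¹ • tvf ((δ / 2) • X) : ∀ x : F, TangentSpace (𝓡 2) x) = tvf X := by
      funext z
      change (δ / 2)⁻¹ • ((δ / 2) • X z) = X z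
      rw [smul_smul, inv_mul_cancel₀ ha.ne', one_smul]
    simp only [e1] at h2
    refine h2.mono ?_
    intro t ht
    simp only [mem_ofPred_eq, mem_Ioo] at ht ⊢
    rw [← div_eq_mul_inv, lt_div_iff₀ ha, div_lt_iff₀ ha]
    constructor <;> linarith [ht.1, ht.2]
  choose φ' hφ0 hφ using hex
  let φ : ℝ → F → F := fun t x => φ' x t
  have hgrp : ∀ s t x, φ (s + t) x = φ s (φ t x) := by
    intro s t x
    have h1 := (hφ x).comp_add t
    have h2 := hφ (φ' x t)
    have := isMIntegralCurve_Ioo_eq_of_contMDiff_boundaryless (t₀ := 0) hv h1 h2 (by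
      simp [hφ0])
    exact congrFun this s
  have hloc : ∀ (n : ℕ), n ≠ 0 → ∀ x : F, ContMDiffAt (𝓘(ℝ, ℝ).prod (𝓡 2)) (𝓡 2) n
      (fun p : ℝ × F => φ p.1 p.2) ((0 : ℝ), x) := by
    intro n hn x
    obtain ⟨ψ, hψ, hev⟩ := local_flow X hX x n hn
    have hd : ContMDiff (𝓘(ℝ, ℝ).prod (𝓡 2)) (𝓘(ℝ, ℝ).prod (𝓡 2)) n
        (fun p : ℝ × F => ((2 : ℝ) * p.1, p.2)) := by
      refine ContMDiff.prodMk ?_ contMDiff_snd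
      exact (contDiff_const.mul contDiff_id).contMDiff.comp contMDiff_fst
    have hpt : (fun p : ℝ × F => ((2 : ℝ) * p.1, p.2)) ((0 : ℝ), x) = ((0 : ℝ), x) := by simp
    have h1 : ContMDiffAt (𝓘(ℝ, ℝ).prod (𝓡 2)) (𝓡 2) n
        (fun p : ℝ × F => ψ ((2 : ℝ) * p.1, p.2) (1 / 2)) ((0 : ℝ), x) :=
      ContMDiffAt.comp ((0 : ℝ), x) (g := fun p => ψ p (1 / 2))
        (f := fun p : ℝ × F => ((2 : ℝ) * p.1, p.2)) (by simpa using hψ) hd.contMDiffAt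
    refine h1.congr_of_eventuallyEq ?_
    have hc : Tendsto (fun p : ℝ × F => ((2 : ℝ) * p.1, p.2)) (𝓝 ((0 : ℝ), x)) (𝓝 ((0 : ℝ), x)) := by
      have := hd.continuous.tendsto ((0 : ℝ), x)
      simpa using this
    filter_upwards [hc.eventually hev] with p hp
    have h2 := (hφ p.2).comp_mul (2 * p.1)
    have h3 := isMIntegralCurveOn_Ioo_eqOn_of_contMDiff_boundaryless (t₀ := 0)
      (a := -1) (b := 1) (by norm_num) ((hX.smul (2 * p.1)).asSection) hp.2
      (h2.isMIntegralCurveOn _) (by simp [hφ0, hp.1])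
    have h4 := h3 (show (1 / 2 : ℝ) ∈ Ioo (-1 : ℝ) 1 by norm_num)
    change φ' p.2 p.1 = _
    rw [h4]
    simp only [comp]
    congr 1; ring
  refine ⟨φ, ?_, hφ0, hgrp, hφ⟩
  refine contMDiff_infty.2 (fun n => ?_)
  suffices H : ∀ n : ℕ, n ≠ 0 → ContMDiff (𝓘(ℝ, ℝ).prod (𝓡 2)) (𝓡 2) n
      (fun p : ℝ × F => φ p.1 p.2) by
    exact (H (n + 1) (by omega)).of_le (by exact_mod_cast Nat.le_succ n)
  intro n hn
  obtain ⟨δ, hδ, hP⟩ := tube_zero (F := F)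
    (P := fun p => ContMDiffAt (𝓘(ℝ, ℝ).prod (𝓡 2)) (𝓡 2) n (fun p : ℝ × F => φ p.1 p.2) p)
    (fun x => (contMDiffAt_iff_contMDiffAt_nhds (by simp)).1 (hloc n hn x))
  have hsl : ∀ t : ℝ, |t| < δ → ContMDiff (𝓡 2) (𝓡 2) n (φ t) := by
    intro t ht x
    exact ContMDiffAt.comp x (g := fun p : ℝ × F => φ p.1 p.2) (f := fun z => (t, z)) (hP t ht x)
      (contMDiffAt_const.prodMk contMDiffAt_id)
  have hit : ∀ (m : ℕ) (t : ℝ), |t| < δ → ContMDiff (𝓡 2) (𝓡 2) n (φ (m * t)) := by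
    intro m t ht
    induction m with
    | zero =>
      have : φ ((0 : ℕ) * t) = id := by funext x; simpa [φ] using hφ0 x
      rw [this]; exact contMDiff_id
    | succ m ih =>
      have : φ ((m + 1 : ℕ) * t) = φ t ∘ φ (m * t) := by
        funext x
        rw [comp_apply, ← hgrp]; congr 1; push_cast; ring
      rw [this]
      exact (hsl t ht).comp ih
  have hall : ∀ t : ℝ, ContMDiff (𝓡 2) (𝓡 2) n (φ t) := by
    intro t
    obtain ⟨m, hm⟩ := exists_nat_gt (|t| / δ)
    have hm0 : (0 : ℝ) < m := lt_of_le_of_lt (by positivity) hm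
    have := hit m (t / m) (by
      rw [abs_div, abs_of_pos hm0, div_lt_iff₀ hm0]
      rw [div_lt_iff₀ hδ] at hm; linarith)
    rwa [mul_div_cancel₀ _ hm0.ne'] at this
  rintro ⟨t, x⟩
  have e : (fun p : ℝ × F => φ p.1 p.2) =
      (fun p : ℝ × F => φ p.1 p.2) ∘ fun p : ℝ × F => (p.1 - t, φ t p.2) := by
    funext p
    simp only [comp]
    rw [← hgrp]; congr 1; ring
  rw [e]
  refine ContMDiffAt.comp (I' := 𝓘(ℝ, ℝ).prod (𝓡 2)) (t, x) (g := fun p : ℝ × F => φ p.1 p.2)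
    (f := fun p : ℝ × F => (p.1 - t, φ t p.2)) ?_ ?_
  · simp only [sub_self]
    exact hloc n hn _
  · have h1 : ContMDiff (𝓘(ℝ, ℝ).prod (𝓡 2)) 𝓘(ℝ, ℝ) n (fun p : ℝ × F => p.1 - t) :=
      ContMDiff.comp (I' := 𝓘(ℝ, ℝ)) (g := fun s : ℝ => s - t) (f := fun p : ℝ × F => p.1)
        (contDiff_id.sub contDiff_const).contMDiff contMDiff_fst
    have h2 : ContMDiff (𝓘(ℝ, ℝ).prod (𝓡 2)) (𝓡 2) n (fun p : ℝ × F => φ t p.2) :=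
      (hall t).comp contMDiff_snd
    exact (h1.prodMk h2).contMDiffAt

end Flow2

section OneForms
open Topology Filter

/-- (unregularised) one-forms -/
abbrev Form1 (F : Type*) : Type _ := F → (Esp 2 →L[ℝ] ℝ)

variable {F : Type*} [TopologicalSpace F] [ChartedSpace (Esp 2) F]

/-- smooth function at a point -/
abbrev SmAt (u : F → ℝ) (z : F) : Prop := ContMDiffAt (𝓡 2) 𝓘(ℝ, ℝ) (⊤ : ℕ∞) u z

/-- locally exact -/
def LEx (α : Form1 F) : Prop :=
  ∀ x, ∃ u : F → ℝ, ∀ᶠ z in 𝓝 x, SmAt u z ∧ dfun u z = α z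

/-- globally exact -/
def GEx (α : Form1 F) : Prop := ∃ u : F → ℝ, ∀ z, SmAt u z ∧ dfun u z = α z

/-- pull back of a one-form -/
def pb (f : F → F) : Form1 F →ₗ[ℝ] Form1 F where
  toFun := fun α x => (α (f x)).comp (DD f x)
  map_add' := by intros; ext; simp
  map_smul' := by intros; ext; simp

lemma pb_apply (f : F → F) (α : Form1 F) (x : F) (w : Esp 2) : pb f α x w = α (f x) (DD f x w) := rfl

lemma two_le_top : (2 : WithTop ℕ∞) ≤ ((⊤ : ℕ∞) : WithTop ℕ∞) :=
  WithTop.coe_le_coe.2 (le_top : (2 : ℕ∞) ≤ ⊤)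

lemma SmAt.hasMF {u : F → ℝ} {z : F} (h : SmAt u z) :
    HasMFDerivAt (𝓡 2) 𝓘(ℝ, ℝ) u z (dfun u z) := (h.mdifferentiableAt top_ne).hasMFDerivAt

lemma dfun_add {u v : F → ℝ} {z : F} (hu : SmAt u z) (hv : SmAt v z) :
    dfun (u + v) z = dfun u z + dfun v z := (hu.hasMF.add hv.hasMF).mfderiv

lemma dfun_smul {u : F → ℝ} {z : F} (hu : SmAt u z) (c : ℝ) :
    dfun (c • u) z = c • dfun u z := (hu.hasMF.const_smul c).mfderiv

lemma dfun_const {z : F} (c : ℝ) : dfun (fun _ : F => c) z = 0 :=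
  (hasMFDerivAt_const (I := 𝓡 2) (I' := 𝓘(ℝ, ℝ)) c z).mfderiv

lemma SmAt.add {u v : F → ℝ} {z : F} (hu : SmAt u z) (hv : SmAt v z) : SmAt (u + v) z :=
  ContMDiffAt.add hu hv

lemma SmAt.smul {u : F → ℝ} {z : F} (hu : SmAt u z) (c : ℝ) : SmAt (c • u) z :=
  (contDiff_const_smul c).contMDiff.contMDiffAt.comp z hu

lemma SmAt.const {z : F} (c : ℝ) : SmAt (fun _ : F => c) z := contMDiffAt_const

/-- closed forms -/
def ZF (F : Type*) [TopologicalSpace F] [ChartedSpace (Esp 2) F] : Submodule ℝ (Form1 F) where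
  carrier := {α | LEx α}
  add_mem' := by
    intro α β hα hβ x
    obtain ⟨u, hu⟩ := hα x
    obtain ⟨v, hv⟩ := hβ x
    refine ⟨u + v, ?_⟩
    filter_upwards [hu, hv] with z h1 h2
    exact ⟨h1.1.add h2.1, by rw [dfun_add h1.1 h2.1, h1.2, h2.2]; rfl⟩
  zero_mem' := fun x => ⟨fun _ => 0, Eventually.of_forall fun z => ⟨SmAt.const 0, dfun_const 0⟩⟩
  smul_mem' := by
    intro c α hα x
    obtain ⟨u, hu⟩ := hα x
    refine ⟨c • u, ?_⟩
    filter_upwards [hu] with z h1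
    exact ⟨h1.1.smul c, by rw [dfun_smul h1.1, h1.2]; rfl⟩

/-- exact forms -/
def EF (F : Type*) [TopologicalSpace F] [ChartedSpace (Esp 2) F] : Submodule ℝ (Form1 F) where
  carrier := {α | GEx α}
  add_mem' := by
    rintro α β ⟨u, hu⟩ ⟨v, hv⟩
    refine ⟨u + v, fun z => ?_⟩
    exact ⟨(hu z).1.add (hv z).1, by rw [dfun_add (hu z).1 (hv z).1, (hu z).2, (hv z).2]; rfl⟩
  zero_mem' := ⟨fun _ => 0, fun z => ⟨SmAt.const 0, dfun_const 0⟩⟩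
  smul_mem' := by
    rintro c α ⟨u, hu⟩
    exact ⟨c • u, fun z => ⟨(hu z).1.smul c, by rw [dfun_smul (hu z).1, (hu z).2]; rfl⟩⟩

lemma mem_ZF {α : Form1 F} : α ∈ ZF F ↔ LEx α := Iff.rfl
lemma mem_EF {α : Form1 F} : α ∈ EF F ↔ GEx α := Iff.rfl

lemma EF_le_ZF : EF F ≤ ZF F := fun α ⟨u, hu⟩ x => ⟨u, Eventually.of_forall hu⟩

/-- smooth self map at a point -/
abbrev SmMap (f : F → F) : Prop := ContMDiff (𝓡 2) (𝓡 2) (⊤ : ℕ∞) f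

lemma SmMap.hasMF {f : F → F} (h : SmMap f) (z : F) :
    HasMFDerivAt (𝓡 2) (𝓡 2) f z (DD f z) := ((h z).mdifferentiableAt top_ne).hasMFDerivAt

lemma SmAt.comp {u : F → ℝ} {f : F → F} (hf : SmMap f) {z : F} (hu : SmAt u (f z)) :
    SmAt (u ∘ f) z := ContMDiffAt.comp z hu (hf z)

lemma dfun_comp {u : F → ℝ} {f : F → F} (hf : SmMap f) {z : F} (hu : SmAt u (f z)) :
    dfun (u ∘ f) z = (dfun u (f z)).comp (DD f z) := (hu.hasMF.comp z (hf.hasMF z)).mfderiv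

lemma DD_comp {f k : F → F} (hf : SmMap f) (hk : SmMap k) (z : F) :
    DD (f ∘ k) z = (DD f (k z)).comp (DD k z) := ((hf.hasMF (k z)).comp z (hk.hasMF z)).mfderiv

lemma DD_id (z : F) : DD (fun x : F => x) z = ContinuousLinearMap.id ℝ _ :=
  (hasMFDerivAt_id (I := 𝓡 2) z).mfderiv

lemma pb_comp {f k : F → F} (hf : SmMap f) (hk : SmMap k) (α : Form1 F) :
    pb (f ∘ k) α = pb k (pb f α) := by
  ext z w
  rw [pb_apply, pb_apply, pb_apply, DD_comp hf hk]; rfl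

lemma pb_id (α : Form1 F) : pb (fun x => x) α = α := by
  ext z w
  rw [pb_apply, DD_id]; rfl

lemma pb_ZF {f : F → F} (hf : SmMap f) {α : Form1 F} (h : α ∈ ZF F) : pb f α ∈ ZF F := by
  intro x
  obtain ⟨u, hu⟩ := h (f x)
  refine ⟨u ∘ f, ?_⟩
  filter_upwards [(hf.continuous.tendsto x).eventually hu] with z hz
  exact ⟨hz.1.comp hf, by rw [dfun_comp hf hz.1, hz.2]; rfl⟩

lemma pb_EF {f : F → F} (hf : SmMap f) {α : Form1 F} (h : α ∈ EF F) : pb f α ∈ EF F := by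
  obtain ⟨u, hu⟩ := h
  refine ⟨u ∘ f, fun z => ?_⟩
  exact ⟨(hu _).1.comp hf, by rw [dfun_comp hf (hu _).1, (hu _).2]; rfl⟩

variable [IsManifold (𝓡 2) (⊤ : ℕ∞) F]

/-- chart representative -/
def crep (α : Form1 F) (x : F) (y : Esp 2) : Esp 2 →L[ℝ] ℝ := (α ((ch x).symm y)).comp (dsy x y)

lemma chart_prim {u : F → ℝ} {x : F} {y : Esp 2} (hy : y ∈ (ch x).target)
    (hu : SmAt u ((ch x).symm y)) : ContDiffAt ℝ (⊤ : ℕ∞) (u ∘ (ch x).symm) y ∧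
      HasFDerivAt (u ∘ (ch x).symm) ((dfun u ((ch x).symm y)).comp (dsy x y)) y := by
  constructor
  · exact (ContMDiffAt.comp y hu (chsy_smooth x hy)).contDiffAt
  · exact (hu.hasMF.comp y (chsy_hasMF x hy)).hasFDerivAt

lemma LEx_crep {α : Form1 F} (h : LEx α) (x : F) {y : Esp 2} (hy : y ∈ (ch x).target) :
    ContDiffAt ℝ (⊤ : ℕ∞) (crep α x) y ∧
      ∀ v w, fderiv ℝ (crep α x) y v w = fderiv ℝ (crep α x) y w v := by
  obtain ⟨u, hu⟩ := h ((ch x).symm y)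
  have h1 : ∀ᶠ y' in 𝓝 y, fderiv ℝ (u ∘ (ch x).symm) y' = crep α x y' := by
    filter_upwards [ch_target_mem x hy, (ch_symm_contAt x hy).eventually hu] with y' h1 h2
    rw [(chart_prim h1 h2.1).2.fderiv, h2.2]; rfl
  have h2 := (chart_prim hy hu.self_of_nhds.1).1
  have h3 : ContDiffAt ℝ (⊤ : ℕ∞) (fderiv ℝ (u ∘ (ch x).symm)) y :=
    h2.fderiv_right (m := (⊤ : ℕ∞)) (by simp)
  refine ⟨h3.congr_of_eventuallyEq (EventuallyEq.symm h1), fun v w => ?_⟩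
  rw [← EventuallyEq.fderiv_eq h1]
  have := h2.isSymmSndFDerivAt (by simpa using two_le_top)
  exact this v w

lemma ball_prim {α : Form1 F} (x : F) {s : Set (Esp 2)} (hs : Convex ℝ s) (hso : IsOpen s)
    (hst : s ⊆ (ch x).target)
    (hd : ∀ y ∈ s, ContDiffAt ℝ (⊤ : ℕ∞) (crep α x) y ∧
      ∀ v w, fderiv ℝ (crep α x) y v w = fderiv ℝ (crep α x) y w v) :
    ∃ f : Esp 2 → ℝ, (∀ y ∈ s, HasFDerivAt f (crep α x y) y) ∧
      ∀ z ∈ (ch x).source, ch x z ∈ s → SmAt (f ∘ ch x) z ∧ dfun (f ∘ ch x) z = α z := by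
  obtain ⟨f, hf⟩ := hs.exists_forall_hasFDerivAt_of_fderiv_symmetric hso
    (fun y hy => ((hd y hy).1.differentiableAt top_ne).differentiableWithinAt)
    (fun a ha v w => (hd a ha).2 v w)
  refine ⟨f, hf, fun z hz hzs => ?_⟩
  have hfs : ContDiffAt ℝ (⊤ : ℕ∞) f (ch x z) := by
    have : ContDiffOn ℝ ((⊤ : ℕ∞) + 1 : WithTop ℕ∞) f s := by
      rw [contDiffOn_succ_iff_fderiv_of_isOpen hso]
      refine ⟨fun y hy => (hf y hy).differentiableAt.differentiableWithinAt, by simp, ?_⟩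
      refine ContDiffOn.congr (f := crep α x) (fun y hy => (hd y hy).1.contDiffWithinAt) ?_
      intro y hy; exact (hf y hy).fderiv
    exact (this.of_le (by simp)).contDiffAt (hso.mem_nhds hzs)
  refine ⟨ContMDiffAt.comp z hfs.contMDiffAt (ch_smooth x hz), ?_⟩
  have h1 := ((hf _ hzs).hasMFDerivAt.comp z (ch_hasMF x hz)).mfderiv
  refine (show dfun (f ∘ ch x) z = (crep α x (ch x z)).comp (dch x z) from h1).trans ?_
  ext w
  have h2 := dsy_dch x ((ch x).map_source hz) w
  simp only [(ch x).left_inv hz] at h2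
  simp only [crep, ContinuousLinearMap.comp_apply, (ch x).left_inv hz, h2]

end OneForms

section OneFormsB
open Topology Filter

lemma symm_pullback {a b : Esp 2 → (Esp 2 →L[ℝ] ℝ)} {τ : Esp 2 → Esp 2} {y : Esp 2}
    (hτ : ContDiffAt ℝ (⊤ : ℕ∞) τ y) (hb : DifferentiableAt ℝ b (τ y))
    (hs : ∀ v w, fderiv ℝ b (τ y) v w = fderiv ℝ b (τ y) w v)
    (hab : a =ᶠ[𝓝 y] fun y => (b (τ y)).comp (fderiv ℝ τ y)) (v w : Esp 2) :
    fderiv ℝ a y v w = fderiv ℝ a y w v := by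
  have hτ1 : HasFDerivAt τ (fderiv ℝ τ y) y := (hτ.differentiableAt top_ne).hasFDerivAt
  have hτ2 : HasFDerivAt (fderiv ℝ τ) (fderiv ℝ (fderiv ℝ τ) y) y :=
    ((hτ.fderiv_right (m := (⊤ : ℕ∞)) (by simp)).differentiableAt top_ne).hasFDerivAt
  have hc := (hb.hasFDerivAt.comp y hτ1).clm_comp hτ2
  have hc' := hc.congr_of_eventuallyEq hab
  rw [hc'.fderiv]
  have h2 := hτ.isSymmSndFDerivAt (by simpa using two_le_top)
  have h3 := h2 v w
  simp only [_root_.add_apply, ContinuousLinearMap.comp_apply,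
    ContinuousLinearMap.compL_apply, ContinuousLinearMap.flip_apply]
  rw [h3, hs]

variable {F : Type*} [TopologicalSpace F] [ChartedSpace (Esp 2) F]
  [IsManifold (𝓡 2) (⊤ : ℕ∞) F]

lemma trans_smooth (x z : F) {y : Esp 2} (hy : y ∈ (ch x).target)
    (hz : (ch x).symm y ∈ (ch z).source) :
    ContDiffAt ℝ (⊤ : ℕ∞) (ch z ∘ (ch x).symm) y ∧
    HasFDerivAt (ch z ∘ (ch x).symm) ((dch z ((ch x).symm y)).comp (dsy x y)) y :=
  ⟨(ContMDiffAt.comp y (ch_smooth z hz) (chsy_smooth x hy)).contDiffAt,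
    ((ch_hasMF z hz).comp y (chsy_hasMF x hy)).hasFDerivAt⟩

lemma crep_trans (α : Form1 F) (x z : F) {y : Esp 2} (hy : y ∈ (ch x).target)
    (hz : (ch x).symm y ∈ (ch z).source) :
    crep α x y = (crep α z ((ch z ∘ (ch x).symm) y)).comp
      (fderiv ℝ (ch z ∘ (ch x).symm) y) := by
  rw [(trans_smooth x z hy hz).2.fderiv]
  ext w
  have h2 := dsy_dch z ((ch z).map_source hz) (dsy x y w)
  simp only [(ch z).left_inv hz] at h2
  simp only [crep, ContinuousLinearMap.comp_apply, comp_apply, (ch z).left_inv hz, h2]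

/-- the raw form of a one-form -/
def rawOf (α : Form1 F) : RawForm (𝓡 2) F 1 := fun x v => α x (v 0)

lemma chartRep_rawOf (α : Form1 F) (x : F) (y : Esp 2) (v : Fin 1 → Esp 2) :
    chartRep (rawOf α) x y v = crep α x y (v 0) := rfl

lemma dValC_rawOf (α : Form1 F) (x : F) (h : DifferentiableAt ℝ (crep α x) (ch x x))
    (v : Fin 2 → Esp 2) :
    dValC (rawOf α) x v = fderiv ℝ (crep α x) (ch x x) (v 0) (v 1)
      - fderiv ℝ (crep α x) (ch x x) (v 1) (v 0) := by
  have hmem : (ch x).target ∈ 𝓝 (ch x x) := ch_target_mem x ((ch x).map_source (mem_ch_source x))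
  have key : ∀ w : Esp 2, fderivWithin ℝ (fun y => crep α x y w) (ch x).target (ch x x) =
      (fderiv ℝ (crep α x) (ch x x)).flip w := by
    intro w
    rw [fderivWithin_of_mem_nhds hmem]
    have h1 := h.hasFDerivAt.clm_apply (hasFDerivAt_const w (ch x x))
    rw [h1.fderiv]
    ext u; simp
  have e : dValC (rawOf α) x v = ∑ i : Fin 2, (-1 : ℝ) ^ (i : ℕ) *
      fderivWithin ℝ (fun y => crep α x y ((v ∘ i.succAbove) 0)) (ch x).target (ch x x) (v i) := rfl
  rw [e, Fin.sum_univ_two, key, key]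
  simp [Fin.succAbove]
  ring

lemma closed_SForm (A : SForm (𝓡 2) F 1) (hA : IsClosedRaw A.val) :
    ∃ α ∈ ZF F, A.val = rawOf α := by
  choose a ha using A.alt
  let α : Form1 F := fun x => (ContinuousAlternatingMap.ofSubsingleton ℝ (Esp 2) ℝ (0 : Fin 1)).symm (a x)
  have hα : A.val = rawOf α := by
    funext x v
    rw [ha x v]
    change a x v = a x (fun _ => v 0)
    congr 1
    funext i
    rw [Subsingleton.elim i 0]
  have hsm : ∀ (x : F), ∀ y ∈ (ch x).target, ContDiffAt ℝ (⊤ : ℕ∞) (crep α x) y := by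
    intro x y hy
    have : ContDiffOn ℝ (⊤ : ℕ∞) (crep α x) (ch x).target := by
      rw [contDiffOn_clm_apply]
      intro w
      have := A.smooth x (fun _ => w)
      rw [hα] at this
      exact this
    exact this.contDiffAt (ch_target_mem x hy)
  have hsy : ∀ (x : F), ∀ y ∈ (ch x).target,
      ∀ v w, fderiv ℝ (crep α x) y v w = fderiv ℝ (crep α x) y w v := by
    intro x y hy
    set z := (ch x).symm y with hz
    have hzt := (ch z).map_source (mem_ch_source z)
    have hzz : (ch x).symm y ∈ (ch z).source := mem_ch_source z
    refine symm_pullback (b := crep α z) (τ := ch z ∘ (ch x).symm) (trans_smooth x z hy hzz).1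
      ((hsm z _ hzt).differentiableAt top_ne) ?_ ?_
    · intro v w
      have h1 := hA z ![v, w]
      rw [hα, dValC_rawOf α z ((hsm z _ hzt).differentiableAt top_ne)] at h1
      exact sub_eq_zero.1 h1
    · filter_upwards [ch_target_mem x hy,
        (ch_symm_contAt x hy).eventually ((ch_source_open z).mem_nhds hzz)] with y' h1 h2
      exact crep_trans α x z h1 h2
  refine ⟨α, fun x => ?_, hα⟩
  have hx : ch x x ∈ (ch x).target := (ch x).map_source (mem_ch_source x)
  obtain ⟨r, hr, hb⟩ := Metric.mem_nhds_iff.1 (ch_target_mem x hx)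
  obtain ⟨f, _, hf⟩ := ball_prim (α := α) x (convex_ball (ch x x) r) Metric.isOpen_ball hb
    (fun y hy => ⟨hsm x y (hb hy), hsy x y (hb hy)⟩)
  refine ⟨f ∘ ch x, ?_⟩
  filter_upwards [(ch_source_open x).mem_nhds (mem_ch_source x),
    (ch_contAt x (mem_ch_source x)).eventually (Metric.ball_mem_nhds (ch x x) hr)] with z h1 h2
  exact hf z h1 h2

lemma SForm_of_ZF (α : Form1 F) (hα : α ∈ ZF F) :
    ∃ B : SForm (𝓡 2) F 1, IsClosedRaw B.val ∧ B.val = rawOf α := by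
  refine ⟨⟨rawOf α, ?_, ?_⟩, ?_, rfl⟩
  · intro x
    refine ⟨ContinuousAlternatingMap.ofSubsingleton ℝ (Esp 2) ℝ (0 : Fin 1) (α x), fun v => rfl⟩
  · intro x v y hy
    have h1 := (LEx_crep hα x hy).1
    exact (h1.clm_apply contDiffAt_const).contDiffWithinAt
  · intro x v
    have hx : ch x x ∈ (ch x).target := (ch x).map_source (mem_ch_source x)
    have h1 := LEx_crep hα x hx
    have := dValC_rawOf α x (h1.1.differentiableAt top_ne) v
    rw [h1.2, sub_self] at this
    exact this

lemma isExact1_iff (α : Form1 F) : IsExact1 (rawOf α) ↔ α ∈ EF F := by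
  constructor
  · rintro ⟨u, hu, h⟩
    refine ⟨u, fun z => ⟨hu z, ?_⟩⟩
    ext w
    exact (h z (fun _ => w)).symm
  · rintro ⟨u, hu⟩
    refine ⟨u, fun z => (hu z).1, fun x v => ?_⟩
    have := DFunLike.congr_fun (hu x).2 (v 0)
    exact this.symm

end OneFormsB

section Joint
open Topology Filter

/-- the determinant on the plane -/
def det2 (v w : Esp 2) : ℝ := v 0 * w 1 - v 1 * w 0

/-- local pull-back -/
def Thet (ρ : Esp 2 → ℝ) (H : ℝ × Esp 2 → Esp 2) (a b : ℝ × Esp 2) (q : ℝ × Esp 2) : ℝ :=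
  ρ (H q) * det2 (fderiv ℝ H q a) (fderiv ℝ H q b)

lemma Thet_smooth {ρ : Esp 2 → ℝ} {H : ℝ × Esp 2 → Esp 2} {q : ℝ × Esp 2}
    (hH : ContDiffAt ℝ (⊤ : ℕ∞) H q) (hρ : ContDiffAt ℝ (⊤ : ℕ∞) ρ (H q)) (a b : ℝ × Esp 2) :
    ContDiffAt ℝ (⊤ : ℕ∞) (Thet ρ H a b) q := by
  have h2 : ContDiffAt ℝ (⊤ : ℕ∞) (fderiv ℝ H) q := hH.fderiv_right (m := (⊤ : ℕ∞)) (by simp)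
  have h3 : ∀ (a : ℝ × Esp 2) (i : Fin 2), ContDiffAt ℝ (⊤ : ℕ∞) (fun q => (fderiv ℝ H q a) i) q := by
    intro a i
    exact (contDiffAt_euclidean.1 (h2.clm_apply contDiffAt_const)) i
  exact (hρ.comp q hH).mul (((h3 a 0).mul (h3 b 1)).sub ((h3 a 1).mul (h3 b 0)))

lemma fn2_lin (L : Esp 2 →L[ℝ] ℝ) (v : Esp 2) :
    L v = v 0 * L (EuclideanSpace.single 0 1) + v 1 * L (EuclideanSpace.single 1 1) := by
  have : v = v 0 • EuclideanSpace.single 0 (1 : ℝ) + v 1 • EuclideanSpace.single 1 (1 : ℝ) := by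
    ext i
    fin_cases i <;> simp
  conv_lhs => rw [this]
  simp

lemma Thet_closed {ρ : Esp 2 → ℝ} {H : ℝ × Esp 2 → Esp 2} {q : ℝ × Esp 2}
    (hH : ContDiffAt ℝ (⊤ : ℕ∞) H q) (hρ : ContDiffAt ℝ (⊤ : ℕ∞) ρ (H q)) (a b e : ℝ × Esp 2) :
    fderiv ℝ (Thet ρ H a b) q e + fderiv ℝ (Thet ρ H b e) q a + fderiv ℝ (Thet ρ H e a) q b = 0 := by
  have h2 : HasFDerivAt (fderiv ℝ H) (fderiv ℝ (fderiv ℝ H) q) q :=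
    ((hH.fderiv_right (m := (⊤ : ℕ∞)) (by simp)).differentiableAt top_ne).hasFDerivAt
  have hs := hH.isSymmSndFDerivAt (by simpa using two_le_top)
  have h1 : HasFDerivAt H (fderiv ℝ H q) q := (hH.differentiableAt top_ne).hasFDerivAt
  have hr : HasFDerivAt ρ (fderiv ℝ ρ (H q)) (H q) := (hρ.differentiableAt top_ne).hasFDerivAt
  set D2 := fderiv ℝ (fderiv ℝ H) q with hD2
  have h3 : ∀ (a : ℝ × Esp 2) (i : Fin 2), HasFDerivAt (fun q => (fderiv ℝ H q a) i)
      ((EuclideanSpace.proj i : Esp 2 →L[ℝ] ℝ).comp (D2.flip a)) q := by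
    intro a i
    have := h2.clm_apply (hasFDerivAt_const a q)
    have h4 : HasFDerivAt (fun q => fderiv ℝ H q a) (D2.flip a) q := by
      rw [ContinuousLinearMap.comp_zero, zero_add] at this
      exact this
    exact (EuclideanSpace.proj i : Esp 2 →L[ℝ] ℝ).hasFDerivAt.comp q h4
  have key : ∀ a b e : ℝ × Esp 2, fderiv ℝ (Thet ρ H a b) q e =
      fderiv ℝ ρ (H q) (fderiv ℝ H q e) * det2 (fderiv ℝ H q a) (fderiv ℝ H q b)
      + ρ (H q) * (det2 (D2 e a) (fderiv ℝ H q b) + det2 (fderiv ℝ H q a) (D2 e b)) := by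
    intro a b e
    have h5 := (hr.comp q h1).mul (((h3 a 0).mul (h3 b 1)).sub ((h3 a 1).mul (h3 b 0)))
    have h6 : HasFDerivAt (Thet ρ H a b) _ q := h5
    rw [h6.fderiv]
    simp [det2]
    ring
  rw [key, key, key, hs b a, hs e a, hs e b, fn2_lin (fderiv ℝ ρ (H q)) (fderiv ℝ H q e),
    fn2_lin (fderiv ℝ ρ (H q)) (fderiv ℝ H q a), fn2_lin (fderiv ℝ ρ (H q)) (fderiv ℝ H q b)]
  simp only [det2]
  ring

variable {F : Type*} [TopologicalSpace F] [ChartedSpace (Esp 2) F]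

/-- jointly smooth families -/
abbrev JS (h : ℝ → F → F) : Prop :=
  ContMDiff (𝓘(ℝ, ℝ).prod (𝓡 2)) (𝓡 2) (⊤ : ℕ∞) (fun p : ℝ × F => h p.1 p.2)

lemma JS.slice {h : ℝ → F → F} (hh : JS h) (t : ℝ) : SmMap (h t) :=
  ContMDiff.comp (I' := 𝓘(ℝ, ℝ).prod (𝓡 2)) (g := fun p : ℝ × F => h p.1 p.2)
    (f := fun x => (t, x)) hh (contMDiff_const.prodMk contMDiff_id)

lemma JS.curve {h : ℝ → F → F} (hh : JS h) (x : F) :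
    ContMDiff 𝓘(ℝ, ℝ) (𝓡 2) (⊤ : ℕ∞) (fun t => h t x) :=
  ContMDiff.comp (I' := 𝓘(ℝ, ℝ).prod (𝓡 2)) (g := fun p : ℝ × F => h p.1 p.2)
    (f := fun t => (t, x)) hh (contMDiff_id.prodMk contMDiff_const)

/-- the joint derivative -/
def JD (h : ℝ → F → F) (t : ℝ) (x : F) : (ℝ × Esp 2) →L[ℝ] Esp 2 :=
  mfderiv (𝓘(ℝ, ℝ).prod (𝓡 2)) (𝓡 2) (fun p : ℝ × F => h p.1 p.2) (t, x)

lemma JS.hasMF {h : ℝ → F → F} (hh : JS h) (t : ℝ) (x : F) :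
    HasMFDerivAt (𝓘(ℝ, ℝ).prod (𝓡 2)) (𝓡 2) (fun p : ℝ × F => h p.1 p.2) (t, x) (JD h t x) :=
  ((hh (t, x)).mdifferentiableAt top_ne).hasMFDerivAt

lemma JS.JD_right {h : ℝ → F → F} (hh : JS h) (t : ℝ) (x : F) (v : Esp 2) :
    JD h t x (0, v) = DD (h t) x v := by
  have h1 : HasMFDerivAt (𝓡 2) (𝓘(ℝ, ℝ).prod (𝓡 2)) (fun x : F => (t, x)) x
      ((0 : Esp 2 →L[ℝ] ℝ).prod (ContinuousLinearMap.id ℝ (Esp 2))) :=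
    (hasMFDerivAt_const (I := 𝓡 2) (I' := 𝓘(ℝ, ℝ)) t x).prodMk (hasMFDerivAt_id (I := 𝓡 2) x)
  have h2 := (HasMFDerivAt.comp (I' := 𝓘(ℝ, ℝ).prod (𝓡 2)) x (hh.hasMF t x) h1).mfderiv
  exact (DFunLike.congr_fun h2 v).symm

lemma JS.JD_left {h : ℝ → F → F} (hh : JS h) (t : ℝ) (x : F) :
    JD h t x (1, 0) = vel (fun τ => h τ x) t := by
  have h1 : HasMFDerivAt 𝓘(ℝ, ℝ) (𝓘(ℝ, ℝ).prod (𝓡 2)) (fun t : ℝ => (t, x)) t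
      ((ContinuousLinearMap.id ℝ ℝ).prod (0 : ℝ →L[ℝ] Esp 2)) :=
    (hasMFDerivAt_id (I := 𝓘(ℝ, ℝ)) t).prodMk (hasMFDerivAt_const (I := 𝓘(ℝ, ℝ)) (I' := 𝓡 2) x t)
  have h2 := (HasMFDerivAt.comp (I' := 𝓘(ℝ, ℝ).prod (𝓡 2)) t (hh.hasMF t x) h1).mfderiv
  exact (DFunLike.congr_fun h2 (1 : ℝ)).symm

lemma JS.JD_apply {h : ℝ → F → F} (hh : JS h) (t : ℝ) (x : F) (a : ℝ) (v : Esp 2) :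
    JD h t x (a, v) = a • vel (fun τ => h τ x) t + DD (h t) x v := by
  have : ((a, v) : ℝ × Esp 2) = a • ((1, 0) : ℝ × Esp 2) + (0, v) := by simp
  rw [this, map_add, map_smul, hh.JD_left, hh.JD_right]

variable [IsManifold (𝓡 2) (⊤ : ℕ∞) F]

/-- local representative of a family -/
def Hloc (h : ℝ → F → F) (x z : F) (q : ℝ × Esp 2) : Esp 2 := ch z (h q.1 ((ch x).symm q.2))

lemma Hloc_deriv {h : ℝ → F → F} (hh : JS h) (x z : F) {q : ℝ × Esp 2} (hq : q.2 ∈ (ch x).target)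
    (hz : h q.1 ((ch x).symm q.2) ∈ (ch z).source) :
    ContDiffAt ℝ (⊤ : ℕ∞) (Hloc h x z) q ∧
    fderiv ℝ (Hloc h x z) q (1, 0) = dch z (h q.1 ((ch x).symm q.2))
      (vel (fun τ => h τ ((ch x).symm q.2)) q.1) ∧
    ∀ v, fderiv ℝ (Hloc h x z) q (0, v) = dch z (h q.1 ((ch x).symm q.2))
      (DD (h q.1) ((ch x).symm q.2) (dsy x q.2 v)) := by
  have hi : ContMDiffAt 𝓘(ℝ, ℝ × Esp 2) (𝓘(ℝ, ℝ).prod (𝓡 2)) (⊤ : ℕ∞)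
      (fun q : ℝ × Esp 2 => (q.1, (ch x).symm q.2)) q := by
    refine ContMDiffAt.prodMk contDiff_fst.contMDiff.contMDiffAt ?_
    exact ContMDiffAt.comp (I' := 𝓘(ℝ, Esp 2)) q (chsy_smooth x hq) contDiff_snd.contMDiff.contMDiffAt
  have hid : HasMFDerivAt 𝓘(ℝ, ℝ × Esp 2) (𝓘(ℝ, ℝ).prod (𝓡 2))
      (fun q : ℝ × Esp 2 => (q.1, (ch x).symm q.2)) q
      ((ContinuousLinearMap.fst ℝ ℝ (Esp 2)).prod
        ((dsy x q.2).comp (ContinuousLinearMap.snd ℝ ℝ (Esp 2)))) := by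
    refine HasMFDerivAt.prodMk (hasFDerivAt_fst).hasMFDerivAt ?_
    exact HasMFDerivAt.comp (I' := 𝓘(ℝ, Esp 2)) q (chsy_hasMF x hq) hasFDerivAt_snd.hasMFDerivAt
  have h1 := HasMFDerivAt.comp (I' := 𝓘(ℝ, ℝ).prod (𝓡 2)) q (hh.hasMF q.1 ((ch x).symm q.2)) hid
  have h2 := (HasMFDerivAt.comp (I' := 𝓡 2) q (ch_hasMF z hz) h1).hasFDerivAt
  have h3 : HasFDerivAt (Hloc h x z) ((dch z (h q.1 ((ch x).symm q.2))).comp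
    ((JD h q.1 ((ch x).symm q.2)).comp ((ContinuousLinearMap.fst ℝ ℝ (Esp 2)).prod
        ((dsy x q.2).comp (ContinuousLinearMap.snd ℝ ℝ (Esp 2)))))) q := h2
  refine ⟨?_, ?_, ?_⟩
  · have h4 : ContMDiffAt 𝓘(ℝ, ℝ × Esp 2) (𝓡 2) (⊤ : ℕ∞)
      (fun q : ℝ × Esp 2 => h q.1 ((ch x).symm q.2)) q :=
      ContMDiffAt.comp (I' := 𝓘(ℝ, ℝ).prod (𝓡 2)) (g := fun p : ℝ × F => h p.1 p.2)
        (f := (fun q : ℝ × Esp 2 => (q.1, (ch x).symm q.2))) q (hh _) hi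
    exact (ContMDiffAt.comp (I' := 𝓡 2) (g := ch z)
      (f := fun q : ℝ × Esp 2 => h q.1 ((ch x).symm q.2)) q (ch_smooth z hz) h4).contDiffAt
  · rw [h3.fderiv]
    simp [hh.JD_left]
  · intro v
    rw [h3.fderiv]
    simp [hh.JD_right]

end Joint

section AreaForms
open Topology Filter

/-- bilinear forms on tangent spaces -/
abbrev Form2 (F : Type*) : Type _ := F → (Esp 2 →L[ℝ] Esp 2 →L[ℝ] ℝ)

/-- first basis vector -/
abbrev e0 : Esp 2 := EuclideanSpace.single 0 1
/-- second basis vector -/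
abbrev e1 : Esp 2 := EuclideanSpace.single 1 1

variable {F : Type*} [TopologicalSpace F] [ChartedSpace (Esp 2) F]

/-- local density of a two-form -/
def rho (σ : Form2 F) (x : F) (y : Esp 2) : ℝ := σ ((ch x).symm y) (dsy x y e0) (dsy x y e1)

/-- smooth area forms -/
structure AreaF (σ : Form2 F) : Prop where
  alt : ∀ x v, σ x v v = 0
  smooth : ∀ x, ContDiffOn ℝ (⊤ : ℕ∞) (rho σ x) (ch x).target
  nondeg : ∀ x, ∃ v w, σ x v w ≠ 0

/-- preserving a two-form -/
def Pres (σ : Form2 F) (f : F → F) : Prop :=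
  ∀ x v w, σ (f x) (DD f x v) (DD f x w) = σ x v w

/-- the form contracting a two-form with the velocity of a family -/
def Ahat (σ : Form2 F) (h : ℝ → F → F) (t : ℝ) : Form1 F :=
  fun x => (σ (h t x) (vel (fun τ => h τ x) t)).comp (DD (h t) x)

lemma vec2_eq (v : Esp 2) : v = v 0 • e0 + v 1 • e1 := by
  ext i
  fin_cases i <;> simp

variable {σ : Form2 F}

lemma AreaF.anti (hσ : AreaF σ) (x : F) (v w : Esp 2) : σ x v w = - σ x w v := by
  have h := hσ.alt x (v + w)
  simp only [map_add, _root_.add_apply, hσ.alt] at h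
  linarith

lemma bil2 (B : Esp 2 →L[ℝ] Esp 2 →L[ℝ] ℝ) (hB : ∀ v, B v v = 0) (v w : Esp 2) :
    B v w = B e0 e1 * det2 v w := by
  have h := hB (e0 + e1)
  simp only [map_add, _root_.add_apply, hB] at h
  have e : B e1 e0 = - B e0 e1 := by linarith
  conv_lhs => rw [vec2_eq v, vec2_eq w]
  simp only [map_add, map_smul, _root_.add_apply, _root_.smul_apply, hB, e, det2,
    smul_eq_mul]
  ring

variable [IsManifold (𝓡 2) (⊤ : ℕ∞) F]

lemma AreaF.sig_dsy (hσ : AreaF σ) (x : F) (y : Esp 2) (v w : Esp 2) :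
    σ ((ch x).symm y) (dsy x y v) (dsy x y w) = rho σ x y * det2 v w := by
  let B : Esp 2 →L[ℝ] Esp 2 →L[ℝ] ℝ :=
    ((σ ((ch x).symm y)).bilinearComp (dsy x y) (dsy x y))
  exact bil2 B (fun v => hσ.alt _ _) v w

lemma AreaF.sig_dch (hσ : AreaF σ) (x : F) {z : F} (hz : z ∈ (ch x).source) (v w : Esp 2) :
    σ z v w = rho σ x (ch x z) * det2 (dch x z v) (dch x z w) := by
  rw [← hσ.sig_dsy, (ch x).left_inv hz]
  have := fun v => dsy_dch x ((ch x).map_source hz) v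
  simp only [(ch x).left_inv hz] at this
  rw [this, this]

lemma AreaF.rho_ne (hσ : AreaF σ) (x : F) {y : Esp 2} (hy : y ∈ (ch x).target) :
    rho σ x y ≠ 0 := by
  intro h0
  obtain ⟨v, w, h⟩ := hσ.nondeg ((ch x).symm y)
  rw [hσ.sig_dch x ((ch x).map_target hy), (ch x).right_inv hy, h0, zero_mul] at h
  exact h rfl

lemma AreaF.rho_smooth (hσ : AreaF σ) (x : F) {y : Esp 2} (hy : y ∈ (ch x).target) :
    ContDiffAt ℝ (⊤ : ℕ∞) (rho σ x) y := (hσ.smooth x).contDiffAt (ch_target_mem x hy)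

/-- points near which local representatives are defined -/
lemma near_ev {h : ℝ → F → F} (hh : JS h) (x : F) {q : ℝ × Esp 2} (hq : q.2 ∈ (ch x).target) :
    ∀ᶠ p in 𝓝 q, p.2 ∈ (ch x).target ∧
      h p.1 ((ch x).symm p.2) ∈ (ch (h q.1 ((ch x).symm q.2))).source := by
  have h1 : ∀ᶠ p : ℝ × Esp 2 in 𝓝 q, p.2 ∈ (ch x).target :=
    continuousAt_snd.eventually (ch_target_mem x hq)
  have h2 : ContinuousAt (fun p : ℝ × Esp 2 => h p.1 ((ch x).symm p.2)) q := by
    have h3 : ContinuousAt (fun p : ℝ × Esp 2 => (p.1, (ch x).symm p.2)) q :=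
      continuousAt_fst.prodMk (ContinuousAt.comp (ch_symm_contAt x hq) continuousAt_snd)
    exact ContinuousAt.comp (g := fun p : ℝ × F => h p.1 p.2)
      (f := fun p : ℝ × Esp 2 => (p.1, (ch x).symm p.2)) hh.continuous.continuousAt h3
  exact h1.and (h2.eventually ((ch_source_open _).mem_nhds (mem_ch_source _)))

lemma Ahat_Thet (hσ : AreaF σ) {h : ℝ → F → F} (hh : JS h) (x z : F) {q : ℝ × Esp 2}
    (hq : q.2 ∈ (ch x).target) (hz : h q.1 ((ch x).symm q.2) ∈ (ch z).source) (w : Esp 2) :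
    crep (Ahat σ h q.1) x q.2 w = Thet (rho σ z) (Hloc h x z) (1, 0) (0, w) q := by
  obtain ⟨_, h1, h2⟩ := Hloc_deriv hh x z hq hz
  rw [Thet, h1, h2]
  exact hσ.sig_dch z hz _ _

lemma pull_Thet (hσ : AreaF σ) {h : ℝ → F → F} (hh : JS h) (x z : F) {q : ℝ × Esp 2}
    (hq : q.2 ∈ (ch x).target) (hz : h q.1 ((ch x).symm q.2) ∈ (ch z).source) (v w : Esp 2) :
    σ (h q.1 ((ch x).symm q.2)) (DD (h q.1) ((ch x).symm q.2) (dsy x q.2 v))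
      (DD (h q.1) ((ch x).symm q.2) (dsy x q.2 w))
      = Thet (rho σ z) (Hloc h x z) (0, v) (0, w) q := by
  obtain ⟨_, h1, h2⟩ := Hloc_deriv hh x z hq hz
  rw [Thet, h2, h2]
  exact hσ.sig_dch z hz _ _

lemma Ahat_smooth (hσ : AreaF σ) {h : ℝ → F → F} (hh : JS h) (x : F) {q : ℝ × Esp 2}
    (hq : q.2 ∈ (ch x).target) :
    ContDiffAt ℝ (⊤ : ℕ∞) (fun q : ℝ × Esp 2 => crep (Ahat σ h q.1) x q.2) q := by
  have hop : IsOpen {q : ℝ × Esp 2 | q.2 ∈ (ch x).target} :=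
    (ch_target_open x).preimage continuous_snd
  suffices H : ContDiffOn ℝ (⊤ : ℕ∞) (fun q : ℝ × Esp 2 => crep (Ahat σ h q.1) x q.2)
      {q : ℝ × Esp 2 | q.2 ∈ (ch x).target} from H.contDiffAt (hop.mem_nhds hq)
  rw [contDiffOn_clm_apply]
  intro w q hq
  refine ContDiffAt.contDiffWithinAt ?_
  change q.2 ∈ (ch x).target at hq
  set z := h q.1 ((ch x).symm q.2) with hz
  have hev := near_ev hh x hq
  have hn := hev.self_of_nhds
  have := Thet_smooth (Hloc_deriv hh x z hn.1 hn.2).1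
    (hσ.rho_smooth z ((ch z).map_source hn.2)) (1, 0) (0, w)
  refine this.congr_of_eventuallyEq ?_
  filter_upwards [hev] with p hp
  exact Ahat_Thet hσ hh x z hp.1 hp.2 w

lemma Ahat_key (hσ : AreaF σ) {h : ℝ → F → F} (hh : JS h) (x : F) {t : ℝ} {y : Esp 2}
    (hy : y ∈ (ch x).target) :
    ContDiffAt ℝ (⊤ : ℕ∞) (crep (Ahat σ h t) x) y ∧ ∀ v w,
    HasDerivAt (fun τ => σ (h τ ((ch x).symm y)) (DD (h τ) ((ch x).symm y) (dsy x y v))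
      (DD (h τ) ((ch x).symm y) (dsy x y w)))
      (fderiv ℝ (crep (Ahat σ h t) x) y v w - fderiv ℝ (crep (Ahat σ h t) x) y w v) t := by
  have hsm := Ahat_smooth hσ hh x (q := (t, y)) hy
  have hin : ∀ v : Esp 2, HasFDerivAt (fun y : Esp 2 => ((t, y) : ℝ × Esp 2))
      (ContinuousLinearMap.inr ℝ ℝ (Esp 2)) y := fun v => hasFDerivAt_prodMk_right t y
  have hA : ContDiffAt ℝ (⊤ : ℕ∞) (crep (Ahat σ h t) x) y :=
    ContDiffAt.comp (g := fun q : ℝ × Esp 2 => crep (Ahat σ h q.1) x q.2)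
      (f := fun y : Esp 2 => ((t, y) : ℝ × Esp 2)) y hsm (contDiffAt_const.prodMk contDiffAt_id)
  refine ⟨hA, fun v w => ?_⟩
  set z := h t ((ch x).symm y) with hz
  have hev := near_ev hh x (q := (t, y)) hy
  have hn := hev.self_of_nhds
  have hT := fun a b => Thet_smooth (Hloc_deriv hh x z hn.1 hn.2).1
    (hσ.rho_smooth z ((ch z).map_source hn.2)) a b
  have hTc := Thet_closed (Hloc_deriv hh x z hn.1 hn.2).1
    (hσ.rho_smooth z ((ch z).map_source hn.2)) (0, v) (0, w) (1, 0)
  have hD : ∀ v w, fderiv ℝ (crep (Ahat σ h t) x) y v w =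
      fderiv ℝ (Thet (rho σ z) (Hloc h x z) (1, 0) (0, w)) (t, y) (0, v) := by
    intro v w
    have h1 := (hA.differentiableAt top_ne).hasFDerivAt.clm_apply (hasFDerivAt_const w y)
    have h2 := (((hT (1, 0) (0, w)).differentiableAt top_ne).hasFDerivAt.comp y (hin w))
    have h3 : (fun y => crep (Ahat σ h t) x y w) =ᶠ[𝓝 y]
        (Thet (rho σ z) (Hloc h x z) (1, 0) (0, w)) ∘ (fun y : Esp 2 => ((t, y) : ℝ × Esp 2)) := by
      have h4 : Tendsto (fun y : Esp 2 => ((t, y) : ℝ × Esp 2)) (𝓝 y) (𝓝 (t, y)) :=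
        (Continuous.prodMk_right t).tendsto y
      filter_upwards [h4.eventually hev] with y' hp
      exact Ahat_Thet hσ hh x z (q := (t, y')) hp.1 hp.2 w
    have h5 := (h2.congr_of_eventuallyEq h3).unique h1
    have h6 := DFunLike.congr_fun h5 v
    simpa using h6.symm
  have hneg : fderiv ℝ (Thet (rho σ z) (Hloc h x z) (0, w) (1, 0)) (t, y) (0, v) =
      - fderiv ℝ (Thet (rho σ z) (Hloc h x z) (1, 0) (0, w)) (t, y) (0, v) := by
    have : Thet (rho σ z) (Hloc h x z) (0, w) (1, 0) =
      - Thet (rho σ z) (Hloc h x z) (1, 0) (0, w) := by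
      funext q
      simp only [Thet, det2, Pi.neg_apply]
      ring
    rw [this, fderiv_neg]
    rfl
  rw [hneg] at hTc
  rw [hD, hD]
  have h2 := ((hT (0, v) (0, w)).differentiableAt top_ne).hasFDerivAt.comp_hasDerivAt t
    ((hasDerivAt_id t).prodMk (hasDerivAt_const t y))
  refine HasDerivAt.congr_of_eventuallyEq (f := (Thet (rho σ z) (Hloc h x z) (0, v) (0, w)) ∘
    (fun t : ℝ => ((t, y) : ℝ × Esp 2))) ?_ ?_
  · have e : fderiv ℝ (Thet (rho σ z) (Hloc h x z) (1, 0) (0, w)) (t, y) (0, v) -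
        fderiv ℝ (Thet (rho σ z) (Hloc h x z) (1, 0) (0, v)) (t, y) (0, w) =
        fderiv ℝ (Thet (rho σ z) (Hloc h x z) (0, v) (0, w)) (t, y) (1, 0) := by linarith
    rw [e]
    exact h2
  · have h4 : Tendsto (fun t : ℝ => ((t, y) : ℝ × Esp 2)) (𝓝 t) (𝓝 (t, y)) :=
        (Continuous.prodMk_left y).tendsto t
    filter_upwards [h4.eventually hev] with y' hp
    exact pull_Thet hσ hh x z (q := (y', y)) hp.1 hp.2 v w

lemma ZF_of_crep {α : Form1 F} (hd : ∀ x, ∀ y ∈ (ch x).target,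
    ContDiffAt ℝ (⊤ : ℕ∞) (crep α x) y ∧
      ∀ v w, fderiv ℝ (crep α x) y v w = fderiv ℝ (crep α x) y w v) : α ∈ ZF F := by
  intro x
  have hx : ch x x ∈ (ch x).target := (ch x).map_source (mem_ch_source x)
  obtain ⟨r, hr, hb⟩ := Metric.mem_nhds_iff.1 (ch_target_mem x hx)
  obtain ⟨f, _, hf⟩ := ball_prim (α := α) x (convex_ball (ch x x) r) Metric.isOpen_ball hb
    (fun y hy => hd x y (hb hy))
  refine ⟨f ∘ ch x, ?_⟩
  filter_upwards [(ch_source_open x).mem_nhds (mem_ch_source x),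
    (ch_contAt x (mem_ch_source x)).eventually (Metric.ball_mem_nhds (ch x x) hr)] with z h1 h2
  exact hf z h1 h2

lemma Ahat_ZF (hσ : AreaF σ) {h : ℝ → F → F} (hh : JS h) (hp : ∀ t, Pres σ (h t)) (t : ℝ) :
    Ahat σ h t ∈ ZF F := by
  refine ZF_of_crep fun x y hy => ?_
  obtain ⟨h1, h2⟩ := Ahat_key hσ hh x (t := t) hy
  refine ⟨h1, fun v w => ?_⟩
  have h3 := h2 v w
  simp only [hp _ _ _ _] at h3
  have := h3.unique (hasDerivAt_const t _)
  linarith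

lemma Pres_of_ZF (hσ : AreaF σ) {h : ℝ → F → F} (hh : JS h) (h0 : ∀ x, h 0 x = x)
    (hz : ∀ t, Ahat σ h t ∈ ZF F) (t : ℝ) : Pres σ (h t) := by
  intro x v w
  have hx : ch x x ∈ (ch x).target := (ch x).map_source (mem_ch_source x)
  have e : (ch x).symm (ch x x) = x := (ch x).left_inv (mem_ch_source x)
  obtain ⟨v', rfl⟩ : ∃ v', v = dsy x (ch x x) v' := ⟨_, (dsy_dch x hx v).symm⟩
  obtain ⟨w', rfl⟩ : ∃ w', w = dsy x (ch x x) w' := ⟨_, (dsy_dch x hx w).symm⟩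
  have hd : ∀ t, HasDerivAt (fun τ => σ (h τ x) (DD (h τ) x (dsy x (ch x x) v'))
      (DD (h τ) x (dsy x (ch x x) w'))) 0 t := by
    intro t
    have h1 := (Ahat_key hσ hh x (t := t) hx).2 v' w'
    rw [(LEx_crep (hz t) x hx).2 v' w', sub_self] at h1
    simp only [e] at h1
    exact h1
  have hc := is_const_of_deriv_eq_zero (fun t => (hd t).differentiableAt) (fun t => (hd t).deriv) t 0
  refine hc.trans ?_
  have hid : h 0 = fun x => x := funext h0
  rw [hid, DD_id]
  rfl

end AreaForms

section AreaFlows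
open Topology Filter

variable {F : Type*} [TopologicalSpace F] [ChartedSpace (Esp 2) F]
variable [IsManifold (𝓡 2) (⊤ : ℕ∞) F] {σ : Form2 F}

lemma up0 (v w u : Esp 2) : Function.update ![v, w] 0 u = ![u, w] := by
  funext i; fin_cases i <;> rfl

lemma up1 (v w u : Esp 2) : Function.update ![v, w] 1 u = ![v, u] := by
  funext i; fin_cases i <;> rfl

lemma exists_Form2 (σ : SForm (𝓡 2) F 2) (harea : IsAreaForm σ) :
    ∃ s : Form2 F, AreaF s ∧ ∀ x (v : Fin 2 → Esp 2), σ.val x v = s x (v 0) (v 1) := by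
  choose a ha using σ.alt
  have key : ∀ x, ∃ B : Esp 2 →L[ℝ] Esp 2 →L[ℝ] ℝ, ∀ v w, B v w = a x ![v, w] := by
    intro x
    let B : Esp 2 →ₗ[ℝ] Esp 2 →ₗ[ℝ] ℝ := LinearMap.mk₂ ℝ (fun v w => a x ![v, w])
      (by
        intro v v' w
        have := (a x).map_update_add ![v, w] 0 v v'
        simp only [up0, up1] at this
        exact this)
      (by
        intro c v w
        have := (a x).map_update_smul ![v, w] 0 c v
        simp only [up0, up1] at this
        exact this)
      (by
        intro v w w'
        have := (a x).map_update_add ![v, w] 1 w w'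
        simp only [up0, up1] at this
        exact this)
      (by
        intro c v w
        have := (a x).map_update_smul ![v, w] 1 c w
        simp only [up0, up1] at this
        exact this)
    exact ⟨LinearMap.toContinuousLinearMap
      ((LinearMap.toContinuousLinearMap : (Esp 2 →ₗ[ℝ] ℝ) ≃ₗ[ℝ] (Esp 2 →L[ℝ] ℝ)).toLinearMap ∘ₗ B),
      fun v w => rfl⟩
  choose s hs using key
  have hv : ∀ x (v : Fin 2 → Esp 2), σ.val x v = s x (v 0) (v 1) := by
    intro x v
    rw [hs]
    refine (ha x v).trans ?_
    congr 1
    funext i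
    fin_cases i <;> rfl
  refine ⟨s, ⟨?_, ?_, ?_⟩, hv⟩
  · intro x v
    rw [hs]
    exact (a x).map_eq_zero_of_eq ![v, v] (i := 0) (j := 1) rfl (by decide)
  · intro x
    refine (σ.smooth x ![e0, e1]).congr ?_
    intro y hy
    exact (hv ((ch x).symm y) (fun i => dsy x y (![e0, e1] i))).symm
  · intro x
    obtain ⟨v, h⟩ := harea x
    exact ⟨v 0, v 1, by rw [← hv]; exact h⟩

lemma exists_VF (hσ : AreaF σ) {B : Form1 F} (hB : B ∈ ZF F) :
    ∃ X : F → Esp 2, SmoothVF X ∧ ∀ x, σ x (X x) = B x := by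
  have hx : ∀ x : F, ch x x ∈ (ch x).target := fun x => (ch x).map_source (mem_ch_source x)
  have hex : ∀ x, ∃ v, σ x v = B x := by
    intro x
    have e : (ch x).symm (ch x x) = x := (ch x).left_inv (mem_ch_source x)
    have hr := hσ.rho_ne x (hx x)
    refine ⟨dsy x (ch x x) ((crep B x (ch x x) e1 / rho σ x (ch x x)) • e0 -
      (crep B x (ch x x) e0 / rho σ x (ch x x)) • e1), ?_⟩
    ext w
    obtain ⟨w', rfl⟩ : ∃ w', w = dsy x (ch x x) w' := ⟨_, (dsy_dch x (hx x) w).symm⟩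
    have h1 := hσ.sig_dsy x (ch x x) ((crep B x (ch x x) e1 / rho σ x (ch x x)) • e0 -
      (crep B x (ch x x) e0 / rho σ x (ch x x)) • e1) w'
    rw [e] at h1
    rw [h1]
    have h2 : B x (dsy x (ch x x) w') = crep B x (ch x x) w' := by
      rw [crep, e]; rfl
    rw [h2, fn2_lin (crep B x (ch x x)) w']
    generalize rho σ x (ch x x) = r at hr
    generalize crep B x (ch x x) = L
    simp [det2]
    field_simp
    ring
  choose X hX using hex
  refine ⟨X, fun x => ?_, hX⟩
  have hV : ∀ y ∈ (ch x).target, vch X x y = (crep B x y e1 / rho σ x y) • e0 -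
      (crep B x y e0 / rho σ x y) • e1 := by
    intro y hy
    have hr := hσ.rho_ne x hy
    have h1 : ∀ w, crep B x y w = rho σ x y * det2 (vch X x y) w := by
      intro w
      rw [← hσ.sig_dsy, vch, dsy_dch x hy, hX]
      rfl
    rw [h1, h1]
    ext i
    fin_cases i
    · simp [det2]; field_simp
    · simp [det2]; field_simp
  refine ContDiffOn.congr (f := fun y => (crep B x y e1 / rho σ x y) • e0 -
      (crep B x y e0 / rho σ x y) • e1) ?_ hV
  intro y hy
  have hr := hσ.rho_ne x hy
  have h1 := (LEx_crep hB x hy).1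
  have h2 := hσ.rho_smooth x hy
  have h3 : ∀ w, ContDiffAt ℝ (⊤ : ℕ∞) (fun y => crep B x y w / rho σ x y) y := fun w =>
    (h1.clm_apply contDiffAt_const).div h2 hr
  exact (((h3 e1).smul contDiffAt_const).sub ((h3 e0).smul contDiffAt_const)).contDiffWithinAt

/-- families of symplectic diffeomorphisms with smooth inverses -/
structure BI (σ : Form2 F) (h k : ℝ → F → F) : Prop where
  js : JS h
  js' : JS k
  hk : ∀ t x, h t (k t x) = x
  kh : ∀ t x, k t (h t x) = x
  pres : ∀ t, Pres σ (h t)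

lemma BI.symm {h k : ℝ → F → F} (H : BI σ h k) : BI σ k h := by
  refine ⟨H.js', H.js, H.kh, H.hk, fun t x v w => ?_⟩
  have h1 := H.pres t (k t x) (DD (k t) x v) (DD (k t) x w)
  have h2 : ∀ v, DD (h t) (k t x) (DD (k t) x v) = v := by
    intro v
    have h3 := DD_comp (H.js.slice t) (H.js'.slice t) x
    have h4 : (h t) ∘ (k t) = fun x => x := funext fun x => H.hk t x
    rw [h4, DD_id] at h3
    exact (DFunLike.congr_fun h3 v).symm
  rw [h2, h2, H.hk] at h1
  exact h1.symm

lemma JS.comp {h k : ℝ → F → F} (hk : JS k) (hh : JS h) : JS (fun t x => k t (h t x)) :=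
  ContMDiff.comp (I' := 𝓘(ℝ, ℝ).prod (𝓡 2)) (g := fun p : ℝ × F => k p.1 p.2)
    (f := fun p : ℝ × F => (p.1, h p.1 p.2)) hk (contMDiff_fst.prodMk hh)

lemma JS.reparam {h : ℝ → F → F} (hh : JS h) {b : ℝ → ℝ} (hb : ContDiff ℝ (⊤ : ℕ∞) b) :
    JS (fun t x => h (b t) x) :=
  ContMDiff.comp (I' := 𝓘(ℝ, ℝ).prod (𝓡 2)) (g := fun p : ℝ × F => h p.1 p.2)
    (f := fun p : ℝ × F => (b p.1, p.2)) hh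
    ((ContMDiff.comp (I' := 𝓘(ℝ, ℝ)) hb.contMDiff contMDiff_fst).prodMk contMDiff_snd)

lemma JS.const {f : F → F} (hf : SmMap f) : JS (fun _ x => f x) :=
  ContMDiff.comp (I' := 𝓡 2) hf contMDiff_snd

lemma vel_eq {γ : ℝ → F} {t : ℝ} {L : ℝ →L[ℝ] Esp 2}
    (h : HasMFDerivAt 𝓘(ℝ, ℝ) (𝓡 2) γ t L) : vel γ t = L 1 := by
  have := h.mfderiv
  exact DFunLike.congr_fun this (1 : ℝ)

/-- velocity as a linear map -/
def velL (γ : ℝ → F) (t : ℝ) : ℝ →L[ℝ] Esp 2 := mfderiv 𝓘(ℝ, ℝ) (𝓡 2) γ t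

lemma velL_hasMF {γ : ℝ → F} {t : ℝ} (h : ContMDiffAt 𝓘(ℝ, ℝ) (𝓡 2) (⊤ : ℕ∞) γ t) :
    HasMFDerivAt 𝓘(ℝ, ℝ) (𝓡 2) γ t (velL γ t) := (h.mdifferentiableAt top_ne).hasMFDerivAt

lemma velL_one (γ : ℝ → F) (t : ℝ) : velL γ t 1 = vel γ t := rfl

lemma vel_comp {k : ℝ → F → F} (hk : JS k) {γ : ℝ → F} {t : ℝ}
    (hγ : ContMDiffAt 𝓘(ℝ, ℝ) (𝓡 2) (⊤ : ℕ∞) γ t) :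
    vel (fun τ => k τ (γ τ)) t = vel (fun τ => k τ (γ t)) t + DD (k t) (γ t) (vel γ t) := by
  have h1 : HasMFDerivAt 𝓘(ℝ, ℝ) (𝓘(ℝ, ℝ).prod (𝓡 2)) (fun τ : ℝ => (τ, γ τ)) t
      ((ContinuousLinearMap.id ℝ ℝ).prod (velL γ t)) :=
    (hasMFDerivAt_id (I := 𝓘(ℝ, ℝ)) t).prodMk (velL_hasMF hγ)
  have h2 := vel_eq (γ := fun τ => k τ (γ τ))
    (HasMFDerivAt.comp (I' := 𝓘(ℝ, ℝ).prod (𝓡 2)) t (hk.hasMF t (γ t)) h1)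
  have h3 := hk.JD_apply t (γ t) 1 (vel γ t)
  rw [one_smul] at h3
  exact h2.trans h3

lemma Ahat_comp {h k : ℝ → F → F} (hk : JS k) (hh : JS h) (hp : ∀ t, Pres σ (k t)) (t : ℝ) :
    Ahat σ (fun t x => k t (h t x)) t = pb (h t) (Ahat σ k t) + Ahat σ h t := by
  ext x w
  have h1 := vel_comp hk (γ := fun τ => h τ x) (t := t) (hh.curve x t)
  have h2 := DD_comp (hk.slice t) (hh.slice t) x
  simp only [Ahat, h1]
  change σ _ _ (DD (k t ∘ h t) x w) = _
  rw [h2]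
  simp only [map_add, _root_.add_apply, Pi.add_apply, ContinuousLinearMap.comp_apply, pb_apply, hp t _ _ _]
  rfl

lemma vel_const (x : F) (t : ℝ) : vel (fun _ => x) t = 0 :=
  vel_eq (hasMFDerivAt_const (I := 𝓘(ℝ, ℝ)) (I' := 𝓡 2) x t)

lemma Ahat_const (f : F → F) (t : ℝ) : Ahat σ (fun _ x => f x) t = 0 := by
  ext x w
  simp [Ahat, vel_const]

lemma BI.comp {h k h' k' : ℝ → F → F} (H : BI σ h k) (H' : BI σ h' k') :
    BI σ (fun t x => h t (h' t x)) (fun t x => k' t (k t x)) := by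
  refine ⟨H.js.comp H'.js, H'.js'.comp H.js', ?_, ?_, ?_⟩
  · intro t x; rw [H'.hk, H.hk]
  · intro t x; rw [H.kh, H'.kh]
  · intro t x v w
    have h2 := DD_comp (H.js.slice t) (H'.js.slice t) x
    change σ _ (DD (h t ∘ h' t) x v) (DD (h t ∘ h' t) x w) = _
    rw [h2]
    exact (H.pres t _ _ _).trans (H'.pres t _ _ _)

lemma BI.Ahat_inv {h k : ℝ → F → F} (H : BI σ h k) (t : ℝ) :
    Ahat σ k t = - pb (k t) (Ahat σ h t) := by
  have h1 := Ahat_comp H.js H.js' H.pres t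
  have h2 : (fun t x => h t (k t x)) = fun (_ : ℝ) (x : F) => x := by
    funext t x; exact H.hk t x
  rw [h2, Ahat_const (fun x : F => x)] at h1
  exact eq_neg_of_add_eq_zero_right h1.symm

lemma BI.Ahat_ZF {h k : ℝ → F → F} (hσ : AreaF σ) (H : BI σ h k) (t : ℝ) : Ahat σ h t ∈ ZF F :=
  _root_.Ahat_ZF hσ H.js H.pres t

lemma exists_flow_BI [CompactSpace F] [T2Space F] (hσ : AreaF σ) {B : Form1 F} (hB : B ∈ ZF F) :
    ∃ φ : ℝ → F → F, (∀ x, φ 0 x = x) ∧ ∀ b : ℝ → ℝ, ContDiff ℝ (⊤ : ℕ∞) b →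
      b 0 = 0 →
      BI σ (fun t x => φ (b t) x) (fun t x => φ (-b t) x) ∧
      ∀ t, Ahat σ (fun t x => φ (b t) x) t = deriv b t • pb (φ (b t)) B := by
  obtain ⟨X, hX, hXB⟩ := exists_VF hσ hB
  obtain ⟨φ, hφ, h0, hadd, hIntg⟩ := exists_flow X hX
  have hJ : JS φ := hφ
  refine ⟨φ, h0, fun b hb hb0 => ?_⟩
  have hA : ∀ t, Ahat σ (fun t x => φ (b t) x) t = deriv b t • pb (φ (b t)) B := by
    intro t
    ext x w
    have h1 : vel (fun τ => φ (b τ) x) t = deriv b t • X (φ (b t) x) := by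
      have h2 := hIntg x (b t)
      have h3 : HasMFDerivAt 𝓘(ℝ, ℝ) 𝓘(ℝ, ℝ) b t
        (ContinuousLinearMap.toSpanSingleton ℝ (deriv b t)) :=
        ((hb.differentiable top_ne t).hasDerivAt).hasFDerivAt.hasMFDerivAt
      have h4 := vel_eq (γ := fun τ => φ (b τ) x)
        (HasMFDerivAt.comp (I' := 𝓘(ℝ, ℝ)) (g := fun τ => φ τ x) t h2 h3)
      rw [h4]
      change ((1 : ℝ) • deriv b t) • X (φ (b t) x) = _
      rw [one_smul]
    simp only [Ahat, h1, map_smul, _root_.smul_apply, ContinuousLinearMap.comp_apply, hXB, Pi.smul_apply]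
    rfl
  refine ⟨⟨hJ.reparam hb, hJ.reparam hb.neg, ?_, ?_, ?_⟩, hA⟩
  · intro t x; rw [← hadd, add_neg_cancel, h0]
  · intro t x; rw [← hadd, neg_add_cancel, h0]
  · refine Pres_of_ZF hσ (hJ.reparam hb) (by simp [hb0, h0]) ?_
    intro t
    rw [hA]
    exact (ZF F).smul_mem _ (pb_ZF (hJ.slice _) hB)

end AreaFlows

section Homotopy
open Topology Filter

variable {F : Type*} [TopologicalSpace F] [ChartedSpace (Esp 2) F]
variable [IsManifold (𝓡 2) (⊤ : ℕ∞) F]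

lemma hasDeriv_curve {u : F → ℝ} {γ : ℝ → F} {t : ℝ} (hu : SmAt u (γ t))
    (hγ : ContMDiffAt 𝓘(ℝ, ℝ) (𝓡 2) (⊤ : ℕ∞) γ t) :
    HasDerivAt (fun τ => u (γ τ)) (dfun u (γ t) (vel γ t)) t := by
  have h := (HasMFDerivAt.comp (I' := 𝓡 2) t hu.hasMF (velL_hasMF hγ)).hasFDerivAt
  have h1 : HasFDerivAt (fun τ => u (γ τ)) ((dfun u (γ t)).comp (velL γ t)) t := h
  exact h1.hasDerivAt

lemma homotopy_local [CompactSpace F] {α : Form1 F} (hα : α ∈ ZF F) {k : ℝ → F → F} (hk : JS k)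
    (t0 : ℝ) : ∀ᶠ t in 𝓝 t0, pb (k t) α - pb (k t0) α ∈ EF F := by
  let good : (F → ℝ) → F → Prop := fun u z => SmAt u z ∧ dfun u z = α z
  have hcont : Continuous (fun p : ℝ × F => k p.1 p.2) := hk.continuous
  have hP : ∀ x : F, x ∈ univ → ∀ᶠ p : ℝ × F in 𝓝 (t0, x),
      ∃ u, ∀ τ ∈ uIcc t0 p.1, ∀ᶠ z in 𝓝 (k τ p.2), good u z := by
    intro x _
    obtain ⟨u, hu⟩ := hα (k t0 x)
    have h1 := (hcont.tendsto (t0, x)).eventually (eventually_eventually_nhds.2 hu)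
    rw [nhds_prod_eq] at h1 ⊢
    obtain ⟨pa, hpa, pb', hpb, hab⟩ := eventually_prod_iff.1 h1
    obtain ⟨δ, hδ, hb⟩ := Metric.eventually_nhds_iff_ball.1 hpa
    refine eventually_prod_iff.2 ⟨fun t => t ∈ Metric.ball t0 δ,
      Metric.ball_mem_nhds t0 hδ, pb', hpb, fun {t} ht {x'} hx' => ⟨u, fun τ hτ => ?_⟩⟩
    refine hab (hb τ ?_) hx'
    have : uIcc t0 t ⊆ Metric.ball t0 δ :=
      (convex_ball t0 δ).ordConnected.uIcc_subset (Metric.mem_ball_self hδ) ht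
    exact this hτ
  have hev := isCompact_univ.eventually_forall_of_forall_eventually
    (P := fun t x => ∃ u, ∀ τ ∈ uIcc t0 t, ∀ᶠ z in 𝓝 (k τ x), good u z) hP
  filter_upwards [hev] with t ht
  choose! u hu using fun x => ht x (mem_univ x)
  have hend0 : t0 ∈ uIcc t0 t := left_mem_uIcc
  have hend1 : t ∈ uIcc t0 t := right_mem_uIcc
  refine ⟨fun x => u x (k t x) - u x (k t0 x), fun x => ?_⟩
  have hgx : ∀ τ ∈ uIcc t0 t, ∀ᶠ p : F × ℝ in 𝓝 (x, τ), good (u x) (k p.2 p.1) := by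
    intro τ hτ
    have h1 : Tendsto (fun p : F × ℝ => k p.2 p.1) (𝓝 (x, τ)) (𝓝 (k τ x)) :=
      (hcont.comp continuous_swap).tendsto (x, τ)
    exact h1.eventually (hu x τ hτ)
  have hgx' := isCompact_uIcc.eventually_forall_of_forall_eventually
    (P := fun x' τ => good (u x) (k τ x')) hgx
  have hloc : (fun x => u x (k t x) - u x (k t0 x)) =ᶠ[𝓝 x]
      (u x ∘ k t) + (-1 : ℝ) • (u x ∘ k t0) := by
    filter_upwards [hgx'] with x' hx'
    have hd : ∀ τ ∈ uIcc t0 t, HasDerivWithinAt (fun τ => u x (k τ x') - u x' (k τ x')) 0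
        (uIcc t0 t) τ := by
      intro τ hτ
      have g1 := hx' τ hτ
      have g2 := (hu x' τ hτ).self_of_nhds
      have d := (hasDeriv_curve g1.1 (hk.curve x' τ)).sub (hasDeriv_curve g2.1 (hk.curve x' τ))
      rw [g1.2, g2.2, sub_self] at d
      exact d.hasDerivWithinAt
    have hc := (convex_uIcc t0 t).norm_image_sub_le_of_norm_hasDerivWithin_le (C := 0) hd
      (by simp) hend0 hend1
    rw [zero_mul, norm_le_zero_iff] at hc
    simp only [Pi.add_apply, Pi.smul_apply, comp_apply, smul_eq_mul]
    linarith
  have g0 := (hu x t0 hend0).self_of_nhds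
  have g1 := (hu x t hend1).self_of_nhds
  have s0 := g0.1.comp (hk.slice t0)
  have s1 := g1.1.comp (hk.slice t)
  refine ⟨(s1.add (s0.smul (-1))).congr_of_eventuallyEq hloc, ?_⟩
  have e : dfun (fun x => u x (k t x) - u x (k t0 x)) x =
      dfun ((u x ∘ k t) + (-1 : ℝ) • (u x ∘ k t0)) x := hloc.mfderiv_eq
  rw [e, dfun_add s1 (s0.smul (-1)), dfun_smul s0, dfun_comp (hk.slice t) g1.1,
    dfun_comp (hk.slice t0) g0.1, g0.2, g1.2]
  ext w
  simp [pb_apply]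
  ring

lemma homotopy_inv [CompactSpace F] {α : Form1 F} (hα : α ∈ ZF F) {k : ℝ → F → F} (hk : JS k)
    (t s : ℝ) : pb (k t) α - pb (k s) α ∈ EF F := by
  have h : IsLocallyConstant (fun t => Submodule.Quotient.mk (p := EF F) (pb (k t) α)) := by
    rw [IsLocallyConstant.iff_eventually_eq]
    intro t0
    filter_upwards [homotopy_local hα hk t0] with t ht
    exact (Submodule.Quotient.eq _).2 ht
  exact (Submodule.Quotient.eq _).1 (h.apply_eq_of_preconnectedSpace t s)

lemma homotopy_id [CompactSpace F] {α : Form1 F} (hα : α ∈ ZF F) {k : ℝ → F → F} (hk : JS k)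
    (h0 : ∀ x, k 0 x = x) (t : ℝ) : pb (k t) α - α ∈ EF F := by
  have h := homotopy_inv hα hk t 0
  have e : k 0 = fun x => x := funext h0
  rwa [e, pb_id] at h

end Homotopy

section ParamInt
open Topology Filter MeasureTheory

lemma param_int_hasDeriv {G : ℝ × ℝ → ℝ}
    (hG : ∀ q : ℝ × ℝ, q.2 ∈ Icc (0 : ℝ) 1 → ContDiffAt ℝ (⊤ : ℕ∞) G q) (t0 : ℝ) :
    HasDerivAt (fun t => ∫ s in (0 : ℝ)..1, G (t, s)) (∫ s in (0 : ℝ)..1, fderiv ℝ G (t0, s) (1, 0)) t0 := by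
  have hG' : ∀ q : ℝ × ℝ, q.2 ∈ Icc (0 : ℝ) 1 → ContDiffAt ℝ (⊤ : ℕ∞) (fun q => fderiv ℝ G q (1, 0)) q :=
    fun q hq => ((hG q hq).fderiv_right (m := (⊤ : ℕ∞)) (by simp)).clm_apply contDiffAt_const
  have hsub : uIoc (0 : ℝ) 1 ⊆ Icc (0 : ℝ) 1 := by
    rw [uIoc_of_le zero_le_one]; exact Ioc_subset_Icc_self
  have hcs : ∀ {K : ℝ × ℝ → ℝ}, (∀ q : ℝ × ℝ, q.2 ∈ Icc (0 : ℝ) 1 → ContDiffAt ℝ (⊤ : ℕ∞) K q) →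
      ∀ t, ContinuousOn (fun s => K (t, s)) (Icc 0 1) := by
    intro K hK t s hs
    exact (ContinuousAt.comp (f := fun s : ℝ => (t, s)) (hK (t, s) hs).continuousAt
      (Continuous.prodMk_right t).continuousAt).continuousWithinAt
  have hmeas : ∀ {K : ℝ × ℝ → ℝ}, (∀ q : ℝ × ℝ, q.2 ∈ Icc (0 : ℝ) 1 → ContDiffAt ℝ (⊤ : ℕ∞) K q) →
      ∀ t, AEStronglyMeasurable (fun s => K (t, s)) (volume.restrict (uIoc (0 : ℝ) 1)) := by
    intro K hK t
    exact ((hcs hK t).mono hsub).aestronglyMeasurable measurableSet_uIoc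
  have hcpt : IsCompact (Icc (t0 - 1) (t0 + 1) ×ˢ Icc (0 : ℝ) 1) := isCompact_Icc.prod isCompact_Icc
  obtain ⟨C, hC⟩ := hcpt.exists_bound_of_continuousOn (f := fun q => fderiv ℝ G q (1, 0))
    (fun q hq => (hG' q hq.2).continuousAt.continuousWithinAt)
  refine (intervalIntegral.hasDerivAt_integral_of_dominated_loc_of_deriv_le (bound := fun _ => C)
    (F := fun t s => G (t, s)) (F' := fun t s => fderiv ℝ G (t, s) (1, 0))
    (Icc_mem_nhds (show t0 - 1 < t0 by linarith) (show t0 < t0 + 1 by linarith))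
    (Eventually.of_forall fun t => hmeas hG t) ?_ (hmeas hG' t0) ?_ ?_ ?_).2
  · refine ContinuousOn.intervalIntegrable ?_
    rw [uIcc_of_le zero_le_one]
    exact hcs hG t0
  · exact Eventually.of_forall fun s hs t ht => hC (t, s) ⟨ht, hsub hs⟩
  · exact intervalIntegrable_const
  · refine Eventually.of_forall fun s hs t ht => ?_
    have h1 := ((hG (t, s) (hsub hs)).differentiableAt top_ne).hasFDerivAt.comp_hasDerivAt t
      ((hasDerivAt_id t).prodMk (hasDerivAt_const t s))
    exact h1

lemma param_int_smooth_nat (n : ℕ) : ∀ {G : ℝ × ℝ → ℝ},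
    (∀ q : ℝ × ℝ, q.2 ∈ Icc (0 : ℝ) 1 → ContDiffAt ℝ (⊤ : ℕ∞) G q) →
    ContDiff ℝ (n : WithTop ℕ∞) (fun t => ∫ s in (0 : ℝ)..1, G (t, s)) := by
  induction n with
  | zero =>
    intro G hG
    rw [Nat.cast_zero, contDiff_zero, continuous_iff_continuousAt]
    exact fun t => (param_int_hasDeriv hG t).continuousAt
  | succ n ih =>
    intro G hG
    have e : ((n + 1 : ℕ) : WithTop ℕ∞) = (n : WithTop ℕ∞) + 1 := by norm_cast
    rw [e, contDiff_succ_iff_deriv]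
    refine ⟨fun t => (param_int_hasDeriv hG t).differentiableAt, by simp, ?_⟩
    have : deriv (fun t => ∫ s in (0 : ℝ)..1, G (t, s)) =
        fun t => ∫ s in (0 : ℝ)..1, fderiv ℝ G (t, s) (1, 0) := by
      funext t; exact (param_int_hasDeriv hG t).deriv
    rw [this]
    exact ih (G := fun q => fderiv ℝ G q (1, 0)) fun q hq =>
      ((hG q hq).fderiv_right (m := (⊤ : ℕ∞)) (by simp)).clm_apply contDiffAt_const

lemma param_int_smooth {G : ℝ × ℝ → ℝ}
    (hG : ∀ q : ℝ × ℝ, q.2 ∈ Icc (0 : ℝ) 1 → ContDiffAt ℝ (⊤ : ℕ∞) G q) :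
    ContDiff ℝ (⊤ : ℕ∞) (fun t => ∫ s in (0 : ℝ)..1, G (t, s)) := by
  rw [contDiff_infty]
  exact fun n => param_int_smooth_nat n hG

/-- primitives of smooth functions -/
lemma prim_smooth {β : ℝ → ℝ} (hβ : ContDiff ℝ (⊤ : ℕ∞) β) :
    ∃ b : ℝ → ℝ, ContDiff ℝ (⊤ : ℕ∞) b ∧ b 0 = 0 ∧ ∀ t, deriv b t = β t := by
  have hd : ∀ t, HasDerivAt (fun t => ∫ s in (0 : ℝ)..t, β s) (β t) t := fun t =>
    intervalIntegral.integral_hasDerivAt_right (hβ.continuous.intervalIntegrable 0 t)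
      (hβ.continuous.stronglyMeasurableAtFilter _ _) hβ.continuous.continuousAt
  refine ⟨fun t => ∫ s in (0 : ℝ)..t, β s, ?_, by simp, fun t => (hd t).deriv⟩
  rw [contDiff_infty_iff_deriv]
  refine ⟨fun t => (hd t).differentiableAt, ?_⟩
  have : deriv (fun t => ∫ s in (0 : ℝ)..t, β s) = β := funext fun t => (hd t).deriv
  rw [this]
  exact hβ

end ParamInt

section Coh
open Topology Filter MeasureTheory

variable {F : Type*} [TopologicalSpace F] [ChartedSpace (Esp 2) F]
variable [IsManifold (𝓡 2) (⊤ : ℕ∞) F]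

/-- smooth families of one-forms -/
def SmFam (A : ℝ → Form1 F) : Prop := ∀ (x : F) (q : ℝ × Esp 2), q.2 ∈ (ch x).target →
  ContDiffAt ℝ (⊤ : ℕ∞) (fun q : ℝ × Esp 2 => crep (A q.1) x q.2) q

lemma chart_ball (x : F) : ∃ (U : Set F) (ℓ : F → (ZF F →ₗ[ℝ] ℝ)), IsOpen U ∧ x ∈ U ∧
    (∀ α : ZF F, ∀ z ∈ U, SmAt (fun z => ℓ z α) z ∧ dfun (fun z => ℓ z α) z = α.1 z) ∧
    ∀ A : ℝ → ZF F, SmFam (fun t => (A t).1) → ∀ z ∈ U,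
      ContDiff ℝ (⊤ : ℕ∞) (fun t => ℓ z (A t)) := by
  have hx : ch x x ∈ (ch x).target := (ch x).map_source (mem_ch_source x)
  obtain ⟨r, hr, hb⟩ := Metric.mem_nhds_iff.1 (ch_target_mem x hx)
  set c := ch x x with hc
  let U : Set F := {z | z ∈ (ch x).source ∧ ch x z ∈ Metric.ball c r}
  have hU : IsOpen U := by
    rw [isOpen_iff_mem_nhds]
    intro z hz
    filter_upwards [(ch_source_open x).mem_nhds hz.1,
      (ch_contAt x hz.1).eventually (Metric.isOpen_ball.mem_nhds hz.2)] with z' h1 h2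
    exact ⟨h1, h2⟩
  have hseg : ∀ z ∈ U, ∀ s ∈ Icc (0 : ℝ) 1, c + s • (ch x z - c) ∈ Metric.ball c r := by
    intro z hz s hs
    exact (convex_ball c r).add_smul_sub_mem (Metric.mem_ball_self hr) hz.2 hs
  let J : Form1 F → F → ℝ := fun α z => ∫ s in (0 : ℝ)..1, crep α x (c + s • (ch x z - c)) (ch x z - c)
  have hpath : ∀ e : Esp 2, ContDiff ℝ (⊤ : ℕ∞) (fun s : ℝ => c + s • e) := fun e =>
    contDiff_const.add (contDiff_id.smul contDiff_const)
  have hIntg : ∀ α : ZF F, ∀ z ∈ U, IntervalIntegrable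
      (fun s => crep α.1 x (c + s • (ch x z - c)) (ch x z - c)) volume 0 1 := by
    intro α z hz
    refine ContinuousOn.intervalIntegrable ?_
    rw [uIcc_of_le zero_le_one]
    intro s hs
    have h1 := (LEx_crep α.2 x (hb (hseg z hz s hs))).1.continuousAt
    have h2 : ContinuousAt (fun s : ℝ => crep α.1 x (c + s • (ch x z - c))) s :=
      ContinuousAt.comp (f := fun s : ℝ => c + s • (ch x z - c)) h1 (hpath _).continuous.continuousAt
    exact (h2.clm_apply continuousAt_const).continuousWithinAt
  classical
  let ℓ : F → (ZF F →ₗ[ℝ] ℝ) := fun z => if hz : z ∈ U then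
    { toFun := fun α => J α.1 z
      map_add' := by
        intro α β
        change J (α.1 + β.1) z = _
        simp only [J]
        rw [← intervalIntegral.integral_add (hIntg α z hz) (hIntg β z hz)]
        rfl
      map_smul' := by
        intro a α
        change J (a • α.1) z = _
        simp only [J, RingHom.id_apply, smul_eq_mul]
        rw [← intervalIntegral.integral_const_mul]
        rfl } else 0
  have hℓ : ∀ z ∈ U, ∀ α : ZF F, ℓ z α = J α.1 z := by
    intro z hz α
    simp only [ℓ, dif_pos hz]
    rfl
  refine ⟨U, ℓ, hU, ⟨mem_ch_source x, Metric.mem_ball_self hr⟩, ?_, ?_⟩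
  · intro α z hz
    obtain ⟨f, hf, hfs⟩ := ball_prim (α := α.1) x (convex_ball c r) Metric.isOpen_ball hb
      (fun y hy => LEx_crep α.2 x (hb hy))
    have hJ : ∀ z ∈ U, ℓ z α = ((f ∘ ch x) + (fun _ : F => - f c) : F → ℝ) z := by
      intro z hz
      rw [hℓ z hz]
      have hd : ∀ s ∈ uIcc (0 : ℝ) 1, HasDerivAt (fun s : ℝ => f (c + s • (ch x z - c)))
          (crep α.1 x (c + s • (ch x z - c)) (ch x z - c)) s := by
        intro s hs
        rw [uIcc_of_le zero_le_one] at hs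
        have h1 : HasDerivAt (fun s : ℝ => c + s • (ch x z - c)) (ch x z - c) s := by
          have := ((hasDerivAt_id s).smul_const (ch x z - c)).const_add c
          simpa using this
        exact (hf _ (hseg z hz s hs)).comp_hasDerivAt s h1
      have := intervalIntegral.integral_eq_sub_of_hasDerivAt hd (hIntg α z hz)
      refine this.trans ?_
      simp [sub_eq_add_neg]
    have hev : (fun z => ℓ z α) =ᶠ[𝓝 z] ((f ∘ ch x) + (fun _ : F => - f c)) := by
      filter_upwards [hU.mem_nhds hz] with z' hz'
      exact hJ z' hz'
    have h1 := hfs z hz.1 hz.2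
    refine ⟨(h1.1.add (SmAt.const _)).congr_of_eventuallyEq hev, ?_⟩
    have e : dfun (fun z => ℓ z α) z = dfun ((f ∘ ch x) + (fun _ : F => - f c)) z := hev.mfderiv_eq
    rw [e, dfun_add h1.1 (SmAt.const _), dfun_const, add_zero, h1.2]
  · intro A hA z hz
    have e : (fun t => ℓ z (A t)) = fun t => J (A t).1 z := funext fun t => hℓ z hz (A t)
    rw [e]
    refine param_int_smooth (G := fun q => crep (A q.1).1 x (c + q.2 • (ch x z - c)) (ch x z - c)) ?_
    intro q hq
    have h1 := hA x (q.1, c + q.2 • (ch x z - c)) (hb (hseg z hz q.2 hq))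
    have h2 : ContDiffAt ℝ (⊤ : ℕ∞) (fun q : ℝ × ℝ => (q.1, c + q.2 • (ch x z - c))) q :=
      contDiffAt_fst.prodMk (contDiffAt_const.add (contDiffAt_snd.smul contDiffAt_const))
    exact (ContDiffAt.comp (g := fun q : ℝ × Esp 2 => crep (A q.1).1 x q.2) q h1 h2).clm_apply
      contDiffAt_const

end Coh

section Coh2
open Topology Filter MeasureTheory

universe u

variable {F : Type u} [TopologicalSpace F] [ChartedSpace (Esp 2) F]
variable [IsManifold (𝓡 2) (⊤ : ℕ∞) F]

lemma loc_const (z : F) {O : Set F} (hO : O ∈ 𝓝 z) : ∃ W : Set F, W ∈ 𝓝 z ∧ W ⊆ O ∧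
    ∀ w : F → ℝ, (∀ z' ∈ W, SmAt w z' ∧ dfun w z' = 0) → ∀ z' ∈ W, w z' = w z := by
  have hx : ch z z ∈ (ch z).target := (ch z).map_source (mem_ch_source z)
  have hz : (ch z).symm (ch z z) = z := (ch z).left_inv (mem_ch_source z)
  have h1 : ∀ᶠ y in 𝓝 (ch z z), (ch z).symm y ∈ O := by
    refine (ch_symm_contAt z hx).eventually ?_
    rw [hz]; exact hO
  obtain ⟨r, hr, hb⟩ := Metric.mem_nhds_iff.1 (inter_mem (ch_target_mem z hx) h1)
  refine ⟨{z' | z' ∈ (ch z).source ∧ ch z z' ∈ Metric.ball (ch z z) r}, ?_, ?_, ?_⟩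
  · filter_upwards [(ch_source_open z).mem_nhds (mem_ch_source z),
      (ch_contAt z (mem_ch_source z)).eventually (Metric.ball_mem_nhds _ hr)] with z' h1 h2
    exact ⟨h1, h2⟩
  · rintro z' ⟨h1, h2⟩
    have := (hb h2).2
    rwa [mem_ofPred_eq, (ch z).left_inv h1] at this
  · rintro w hw z' ⟨h1, h2⟩
    have hd : ∀ y ∈ Metric.ball (ch z z) r, HasFDerivWithinAt (w ∘ (ch z).symm)
        (0 : Esp 2 →L[ℝ] ℝ) (Metric.ball (ch z z) r) y := by
      intro y hy
      have hyt := (hb hy).1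
      have hm := hw ((ch z).symm y) ⟨(ch z).map_target hyt, by rwa [(ch z).right_inv hyt]⟩
      have := (chart_prim hyt hm.1).2
      rw [hm.2, ContinuousLinearMap.zero_comp] at this
      exact this.hasFDerivWithinAt
    have := (convex_ball (ch z z) r).norm_image_sub_le_of_norm_hasFDerivWithin_le (C := 0) hd
      (by simp) (Metric.mem_ball_self hr) h2
    rw [zero_mul, norm_le_zero_iff, comp_apply, comp_apply, (ch z).left_inv h1, hz] at this
    linarith

theorem exists_Phi [CompactSpace F] [T2Space F] : ∃ (ι : Type u) (_ : Finite ι)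
    (Φ : ZF F →ₗ[ℝ] (ι → ℝ)), (∀ α, Φ α = 0 → α.1 ∈ EF F) ∧
    ∀ A : ℝ → ZF F, SmFam (fun t => (A t).1) → ∀ i, ContDiff ℝ (⊤ : ℕ∞) (fun t => Φ (A t) i) := by
  choose U ℓ hUo hxU hℓ hℓs using chart_ball (F := F)
  obtain ⟨T, -, hT⟩ := isCompact_univ.elim_nhds_subcover U (fun x _ => (hUo x).mem_nhds (hxU x))
  obtain ⟨K, hKc, hKcl, hKU⟩ := exists_iUnion_eq_closed_subset (u := fun i : T => U i)
    (fun i => hUo i) (fun x => Set.toFinite _) (by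
      refine eq_univ_of_univ_subset (hT.trans ?_)
      intro z hz
      simp only [mem_iUnion] at hz ⊢
      obtain ⟨i, hi, h⟩ := hz
      exact ⟨⟨i, hi⟩, h⟩)
  -- vanishing differences
  have hdiff : ∀ (i j : T) (α : ZF F) (z : F), z ∈ U i → z ∈ U j →
      SmAt ((fun z => ℓ i z α) + (-1 : ℝ) • (fun z => ℓ j z α)) z ∧
      dfun ((fun z => ℓ i z α) + (-1 : ℝ) • (fun z => ℓ j z α)) z = 0 := by
    intro i j α z hi hj
    have h1 := hℓ i α z hi
    have h2 := hℓ j α z hj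
    refine ⟨h1.1.add (h2.1.smul (-1)), ?_⟩
    rw [dfun_add h1.1 (h2.1.smul (-1)), dfun_smul h2.1, h1.2, h2.2]
    module
  have hW : ∀ (p : T × T) (z : F), ∃ W : Set F, W ∈ 𝓝 z ∧ (z ∈ U p.1 ∩ U p.2 →
      ∀ α : ZF F, ∀ z' ∈ W, z' ∈ U p.1 ∩ U p.2 ∧
        ℓ p.1 z' α - ℓ p.2 z' α = ℓ p.1 z α - ℓ p.2 z α) := by
    intro p z
    by_cases hz : z ∈ U p.1 ∩ U p.2
    · obtain ⟨W, hW1, hW2, hW3⟩ := loc_const z (((hUo p.1).inter (hUo p.2)).mem_nhds hz)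
      refine ⟨W, hW1, fun _ α z' hz' => ⟨hW2 hz', ?_⟩⟩
      have := hW3 ((fun z => ℓ p.1 z α) + (-1 : ℝ) • (fun z => ℓ p.2 z α))
        (fun z hz => hdiff p.1 p.2 α z (hW2 hz).1 (hW2 hz).2) z' hz'
      simp only [Pi.add_apply, Pi.smul_apply, smul_eq_mul] at this
      linarith
    · exact ⟨univ, univ_mem, fun h => absurd h hz⟩
  choose W hWn hWd using hW
  have hZ : ∀ p : T × T, ∃ Z : Finset F, (∀ z ∈ Z, z ∈ K p.1 ∩ K p.2) ∧
      K p.1 ∩ K p.2 ⊆ ⋃ z ∈ Z, W p z := fun p =>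
    ((hKcl p.1).inter (hKcl p.2)).isCompact.elim_nhds_subcover (W p) (fun z _ => hWn p z)
  choose Z hZK hZc using hZ
  let ι : Type u := (p : T × T) × {z // z ∈ Z p}
  let Φ : ZF F →ₗ[ℝ] (ι → ℝ) := LinearMap.pi fun q => ℓ q.1.1 q.2.1 - ℓ q.1.2 q.2.1
  refine ⟨ι, inferInstance, Φ, ?_, ?_⟩
  · intro α hα
    have hΦ : ∀ (p : T × T), ∀ z ∈ Z p, ℓ p.1 z α - ℓ p.2 z α = 0 := by
      intro p z hz
      exact congrFun hα ⟨p, ⟨z, hz⟩⟩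
    have hKeq : ∀ (i j : T), ∀ x ∈ K i, x ∈ K j → ℓ i x α = ℓ j x α := by
      intro i j x hi hj
      have hx := hZc (i, j) ⟨hi, hj⟩
      simp only [mem_iUnion] at hx
      obtain ⟨z, hz, hxz⟩ := hx
      have hzK := hZK (i, j) z hz
      have := (hWd (i, j) z ⟨hKU i hzK.1, hKU j hzK.2⟩ α x hxz).2
      rw [hΦ (i, j) z hz] at this
      exact sub_eq_zero.1 this
    have hcov : ∀ x, ∃ i, x ∈ K i := by
      intro x
      have : x ∈ iUnion K := hKc ▸ mem_univ x
      simpa using this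
    choose I hI using hcov
    refine ⟨fun x => ℓ (I x) x α, fun x => ?_⟩
    have hev : (fun x => ℓ (I x) x α) =ᶠ[𝓝 x] fun z => ℓ (I x) z α := by
      have : ∀ j : T, ∀ᶠ x' in 𝓝 x, x' ∈ K j → ℓ j x' α = ℓ (I x) x' α := by
        intro j
        by_cases hj : x ∈ K j
        · filter_upwards [hWn (j, I x) x] with x' hx' _
          have := (hWd (j, I x) x ⟨hKU _ hj, hKU _ (hI x)⟩ α x' hx').2
          simp only at this
          rw [hKeq j (I x) x hj (hI x), sub_self] at this
          exact sub_eq_zero.1 this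
        · filter_upwards [(hKcl j).isOpen_compl.mem_nhds hj] with x' hx' h
          exact absurd h hx'
      filter_upwards [eventually_all.2 this] with x' hx'
      exact hx' (I x') (hI x')
    have h1 := hℓ (I x) α x (hKU _ (hI x))
    refine ⟨h1.1.congr_of_eventuallyEq hev, ?_⟩
    have e : dfun (fun x => ℓ (I x) x α) x = dfun (fun z => ℓ (I x) z α) x := hev.mfderiv_eq
    rw [e, h1.2]
  · rintro A hA ⟨p, z, hz⟩
    have hzK := hZK p z hz
    exact (hℓs p.1 A hA z (hKU _ hzK.1)).sub (hℓs p.2 A hA z (hKU _ hzK.2))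

end Coh2

section LinAlg

lemma linalg_aux {V ι : Type*} [AddCommGroup V] [Module ℝ V] [Fintype ι] (E : Submodule ℝ V)
    (T : V →ₗ[ℝ] V) (hTE : ∀ v ∈ E, T v ∈ E) (hT : ∀ v, T v ∈ E → v ∈ E)
    (Φ : V →ₗ[ℝ] (ι → ℝ)) (hΦ : ∀ v, Φ v = 0 → v ∈ E) :
    ∃ B : ι → V, ∀ v, v - ∑ i, Φ v i • T (B i) ∈ E := by
  classical
  -- a generalized inverse of Φ
  obtain ⟨r, hr⟩ := Φ.rangeRestrict.exists_rightInverse_of_surjective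
    (LinearMap.range_eq_top.2 Φ.surjective_rangeRestrict)
  obtain ⟨p, hp⟩ := (LinearMap.range Φ).subtype.exists_leftInverse_of_injective
    (Submodule.ker_subtype _)
  let s : (ι → ℝ) →ₗ[ℝ] V := r ∘ₗ p
  have hs : ∀ v, v - s (Φ v) ∈ E := by
    intro v
    apply hΦ
    have h1 : p (Φ v) = Φ.rangeRestrict v := by
      have := LinearMap.congr_fun hp (Φ.rangeRestrict v)
      simpa using this
    have h2 : Φ (r (Φ.rangeRestrict v)) = Φ v := by
      have := LinearMap.congr_fun hr (Φ.rangeRestrict v)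
      exact congrArg Subtype.val this
    simp [s, h1, h2]
  have hsurj : Surjective (E.mkQ ∘ₗ s) := by
    intro q
    obtain ⟨v, rfl⟩ := E.mkQ_surjective q
    refine ⟨Φ v, ?_⟩
    exact ((Submodule.Quotient.eq E).2 (hs v)).symm
  have : FiniteDimensional ℝ (V ⧸ E) := Module.Finite.of_surjective _ hsurj
  let Tb : (V ⧸ E) →ₗ[ℝ] (V ⧸ E) := E.mapQ E T hTE
  have hinj : Injective Tb := by
    rw [← LinearMap.ker_eq_bot, LinearMap.ker_eq_bot']
    intro q hq
    obtain ⟨v, rfl⟩ := E.mkQ_surjective q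
    have h1 : T v ∈ E := (Submodule.Quotient.mk_eq_zero E).1 hq
    exact (Submodule.Quotient.mk_eq_zero E).2 (hT v h1)
  have hTs : Surjective Tb := LinearMap.injective_iff_surjective.1 hinj
  obtain ⟨R, hR⟩ := Tb.exists_rightInverse_of_surjective (LinearMap.range_eq_top.2 hTs)
  obtain ⟨q, hq⟩ := E.mkQ.exists_rightInverse_of_surjective
    (LinearMap.range_eq_top.2 E.mkQ_surjective)
  let L : (ι → ℝ) →ₗ[ℝ] V := q ∘ₗ R ∘ₗ E.mkQ ∘ₗ s
  refine ⟨fun i => L (Pi.single i 1), fun v => ?_⟩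
  have h1 : ∑ i, Φ v i • T (L (Pi.single i 1)) = T (L (Φ v)) := by
    conv_rhs => rw [pi_eq_sum_univ' (Φ v)]
    simp only [map_sum, map_smul]
  rw [h1]
  have h2 : E.mkQ (T (L (Φ v))) = E.mkQ (s (Φ v)) := by
    have e1 : E.mkQ (T (L (Φ v))) = Tb (E.mkQ (L (Φ v))) := rfl
    have e2 : E.mkQ (L (Φ v)) = R (E.mkQ (s (Φ v))) := LinearMap.congr_fun hq _
    rw [e1, e2]
    exact LinearMap.congr_fun hR _
  have h3 : s (Φ v) - T (L (Φ v)) ∈ E := (Submodule.Quotient.eq E).1 h2.symm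
  have := E.add_mem (hs v) h3
  simpa using this

end LinAlg

section Assemble
open Filter Topology

variable {F : Type*} [TopologicalSpace F] [ChartedSpace (Esp 2) F]
variable [IsManifold (𝓡 2) (⊤ : ℕ∞) F] [CompactSpace F] [T2Space F] {σ : Form2 F}

lemma BI.refl : BI σ (fun _ x => x) (fun _ x => x) := by
  have h : SmMap (fun x : F => x) := contMDiff_id
  refine ⟨JS.const h, JS.const h, fun _ _ => rfl, fun _ _ => rfl, fun t x v w => ?_⟩
  simp [DD_id]

lemma exists_family (hσ : AreaF σ) {ι : Type*} (S : Finset ι) (B : ι → Form1 F)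
    (hB : ∀ i, B i ∈ ZF F) (β : ι → ℝ → ℝ) (hβ : ∀ i, ContDiff ℝ (⊤ : ℕ∞) (β i)) :
    ∃ f k : ℝ → F → F, BI σ f k ∧ (∀ x, f 0 x = x) ∧
      ∀ t, Ahat σ f t - ∑ i ∈ S, β i t • B i ∈ EF F := by
  classical
  induction S using Finset.induction_on with
  | empty =>
    refine ⟨_, _, BI.refl, fun _ => rfl, fun t => ?_⟩
    rw [Ahat_const (fun x => x)]
    simp
  | insert i S hi ih =>
    obtain ⟨f, k, H, h0, hA⟩ := ih
    obtain ⟨φ, hφ0, hφ⟩ := exists_flow_BI hσ (hB i)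
    obtain ⟨b, hb, hb0, hb'⟩ := prim_smooth (hβ i)
    obtain ⟨H2, hA2⟩ := hφ b hb hb0
    refine ⟨_, _, H2.comp H, fun x => by simp [hb0, hφ0, h0], fun t => ?_⟩
    have e := Ahat_comp H2.js H.js H2.pres t
    rw [e, hA2, hb', Finset.sum_insert hi]
    have h1 : pb (f t) (pb (φ (b t)) (B i)) - B i ∈ EF F := by
      rw [← pb_comp (H2.js.slice t) (H.js.slice t)]
      exact homotopy_id (k := fun t x => φ (b t) (f t x)) (hB i) (H2.js.comp H.js)
        (fun x => by simp [hb0, hφ0, h0]) t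
    have h2 := (EF F).add_mem ((EF F).smul_mem (β i t) h1) (hA t)
    rw [map_smul]
    convert h2 using 1
    module

/-- the commutator family -/
lemma comm_family {f k : ℝ → F → F} {g g' : F → F} (hσ : AreaF σ)
    (H : BI σ f k) (h0 : ∀ x, f 0 x = x) (G : BI σ (fun _ x => g x) (fun _ x => g' x)) :
    BI σ (fun t x => g (f t (g' (k t x)))) (fun t x => f t (g (k t (g' x)))) ∧
    (∀ t, Ahat σ (fun t x => g (f t (g' (k t x)))) t
      - (pb g' (Ahat σ f t) - Ahat σ f t) ∈ EF F) := by
  have H1 := G.symm.comp H.symm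
  have H2 := H.comp H1
  have H3 := G.comp H2
  refine ⟨H3, fun t => ?_⟩
  have e3 := Ahat_comp G.js H2.js G.pres t
  have e2 := Ahat_comp H.js H1.js H.pres t
  have e1 := Ahat_comp G.symm.js H.symm.js G.symm.pres t
  have e0 := H.Ahat_inv t
  rw [Ahat_const g] at e3
  rw [Ahat_const g'] at e1
  rw [map_zero, zero_add] at e1 e3
  have hg' : SmMap g' := G.js'.slice 0
  have e4 : pb (fun x => g' (k t x)) (Ahat σ f t) = pb (k t) (pb g' (Ahat σ f t)) :=
    pb_comp hg' (H.js'.slice t) _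
  rw [e3, e2, e1, e0, e4]
  have hz : pb g' (Ahat σ f t) - Ahat σ f t ∈ ZF F :=
    (ZF F).sub_mem (pb_ZF hg' (H.Ahat_ZF hσ t)) (H.Ahat_ZF hσ t)
  have hk0 : ∀ x, k 0 x = x := fun x => by
    have := H.kh 0 x
    rwa [h0] at this
  have h5 := homotopy_id hz H.js' hk0 t
  rw [map_sub] at h5
  convert h5 using 1
  abel

end Assemble


section Periods
open Filter Topology

variable {F : Type*} [TopologicalSpace F] [ChartedSpace (Esp 2) F]
variable [IsManifold (𝓡 2) (⊤ : ℕ∞) F] {σ : Form2 F}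

lemma period_cont {α : Form1 F} (hα : α ∈ ZF F) {γ : ℝ → F}
    (hγ : ContMDiff 𝓘(ℝ, ℝ) (𝓡 2) (⊤ : ℕ∞) γ) :
    Continuous (fun s => α (γ s) (vel γ s)) := by
  rw [continuous_iff_continuousAt]
  intro s
  obtain ⟨u, hu⟩ := hα (γ s)
  have hev : ∀ᶠ s' in 𝓝 s, SmAt u (γ s') ∧ dfun u (γ s') = α (γ s') :=
    hγ.continuous.continuousAt.eventually hu
  have h1 : ContDiffAt ℝ (⊤ : ℕ∞) (fun τ => u (γ τ)) s :=
    (ContMDiffAt.comp (I' := 𝓡 2) s hev.self_of_nhds.1 (hγ s)).contDiffAt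
  have h2 : ContinuousAt (deriv (fun τ => u (γ τ))) s := by
    have h3 : ContDiffAt ℝ 0 (fderiv ℝ (fun τ => u (γ τ))) s :=
      h1.fderiv_right (m := 0) (by norm_cast)
    have h4 := h3.continuousAt.clm_apply (continuousAt_const (y := (1 : ℝ)))
    refine h4.congr (Eventually.of_forall fun _ => ?_)
    exact fderiv_apply_one_eq_deriv
  refine h2.congr ?_
  filter_upwards [hev] with s' hs'
  rw [(hasDeriv_curve hs'.1 (hγ s')).deriv, hs'.2]

lemma period_exact {α : Form1 F} (hα : α ∈ EF F) {γ : ℝ → F}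
    (hγ : IsLoop (I := 𝓡 2) γ) : ∫ s in (0:ℝ)..1, α (γ s) (vel γ s) = 0 := by
  have hc := period_cont (EF_le_ZF hα) hγ.1
  obtain ⟨u, hu⟩ := hα
  have := intervalIntegral.integral_eq_sub_of_hasDerivAt (a := 0) (b := 1)
    (f := fun s => u (γ s)) (f' := fun s => α (γ s) (vel γ s))
    (fun s _ => by
      have := hasDeriv_curve (hu (γ s)).1 (hγ.1 s)
      rwa [(hu (γ s)).2] at this) (hc.intervalIntegrable _ _)
  rw [this]
  have h1 := hγ.2 0
  rw [zero_add] at h1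
  rw [h1, sub_self]

lemma vel_slice {h : ℝ → F → F} (hh : JS h) {γ : ℝ → F}
    (hγ : ContMDiff 𝓘(ℝ, ℝ) (𝓡 2) (⊤ : ℕ∞) γ) (t s : ℝ) :
    vel (fun τ => h t (γ τ)) s = DD (h t) (γ s) (vel γ s) := by
  have := vel_comp (k := fun _ x => h t x) (JS.const (hh.slice t)) (hγ s)
  rw [vel_const, zero_add] at this
  exact this

lemma swept_eq {S : RawForm (𝓡 2) F 2} (hS : ∀ x (v : Fin 2 → Esp 2), S x v = σ x (v 0) (v 1))
    (hσ : AreaF σ) {h : ℝ → F → F} (hh : JS h) (hp : ∀ t, Pres σ (h t))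
    {A : Form1 F} (hA : A ∈ ZF F) (hex : ∀ t, Ahat σ h t - A ∈ EF F)
    {γ : ℝ → F} (hγ : IsLoop (I := 𝓡 2) γ) :
    sweptArea S h γ = loopPeriod (rawOf A) γ := by
  have hin : ∀ t, (∫ s in (0:ℝ)..1, S (h t (γ s)) ![mfderiv 𝓘(ℝ, ℝ) (𝓡 2) (fun τ => h τ (γ s)) t (1:ℝ),
      mfderiv 𝓘(ℝ, ℝ) (𝓡 2) (fun τ => h t (γ τ)) s (1:ℝ)]) = ∫ s in (0:ℝ)..1, A (γ s) (vel γ s) := by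
    intro t
    have e1 : ∀ s, S (h t (γ s)) ![mfderiv 𝓘(ℝ, ℝ) (𝓡 2) (fun τ => h τ (γ s)) t (1:ℝ),
      mfderiv 𝓘(ℝ, ℝ) (𝓡 2) (fun τ => h t (γ τ)) s (1:ℝ)] = A (γ s) (vel γ s) +
        (Ahat σ h t - A) (γ s) (vel γ s) := by
      intro s
      have e2 := hS (h t (γ s)) ![vel (fun τ => h τ (γ s)) t, vel (fun τ => h t (γ τ)) s]
      refine Eq.trans e2 ?_
      change σ (h t (γ s)) (vel (fun τ => h τ (γ s)) t) (vel (fun τ => h t (γ τ)) s) = _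
      rw [vel_slice hh hγ.1]
      change _ = A (γ s) (vel γ s) + (Ahat σ h t (γ s) (vel γ s) - A (γ s) (vel γ s))
      rw [add_sub_cancel]
      rfl
    simp_rw [e1]
    rw [intervalIntegral.integral_add, period_exact (hex t) hγ, add_zero]
    · exact (period_cont hA hγ.1).intervalIntegrable _ _
    · exact (period_cont (EF_le_ZF (hex t)) hγ.1).intervalIntegrable _ _
  unfold sweptArea loopPeriod
  simp_rw [hin]
  rw [intervalIntegral.integral_const]
  simp [rawOf, vel]

/-- the inverse of a smooth area preserving bijection is differentiable. -/
lemma inv_mdiff [CompactSpace F] [T2Space F] (hσ : AreaF σ) {f k : F → F} (hf : SmMap f)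
    (hp : Pres σ f) (hfk : ∀ x, f (k x) = x) (hkf : ∀ x, k (f x) = x) (z : F) :
    MDifferentiableAt (𝓡 2) (𝓡 2) k z ∧ Surjective (DD f (k z)) := by
  have hinj : Injective (DD f (k z)) := by
    rw [injective_iff_map_eq_zero]
    intro v hv
    have h1 : ∀ w, σ (k z) v w = 0 := fun w => by rw [← hp, hv]; simp
    have h2 := fun w => bil2 (σ (k z)) (hσ.alt (k z)) v w
    have h3 : σ (k z) e0 e1 ≠ 0 := by
      intro h4
      obtain ⟨a, b, hab⟩ := hσ.nondeg (k z)
      rw [bil2 (σ (k z)) (hσ.alt (k z)) a b, h4, zero_mul] at hab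
      exact hab rfl
    have h5 : ∀ w, det2 v w = 0 := by
      intro w
      have := h2 w
      rw [h1] at this
      exact (mul_eq_zero.1 this.symm).resolve_left h3
    have h6 := h5 e0
    have h7 := h5 e1
    simp [det2] at h6 h7
    ext i
    fin_cases i
    · simpa using h7
    · simpa using h6
  have hsurj : Surjective (DD f (k z)) :=
    (LinearMap.injective_iff_surjective (f := (DD f (k z) : Esp 2 →ₗ[ℝ] Esp 2))).1 hinj
  refine ⟨?_, hsurj⟩
  have hkc : Continuous k := by
    let e : F ≃ F := ⟨f, k, hkf, hfk⟩
    exact (Continuous.homeoOfEquivCompactToT2 (f := e) hf.continuous).symm.continuous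
  set x := k z with hx
  have hz : f x = z := hfk z
  have hxs := mem_ch_source x
  have hyt : ch x x ∈ (ch x).target := (ch x).map_source hxs
  have hzs := mem_ch_source z
  have hzt : ch z z ∈ (ch z).target := (ch z).map_source hzs
  have esx : (ch x).symm (ch x x) = x := (ch x).left_inv hxs
  have esz : (ch z).symm (ch z z) = z := (ch z).left_inv hzs
  let f₁ : Esp 2 → Esp 2 := fun y => ch z (f ((ch x).symm y))
  let k₁ : Esp 2 → Esp 2 := fun y => ch x (k ((ch z).symm y))
  let L : Esp 2 →L[ℝ] Esp 2 := (dch z z).comp ((DD f x).comp (dsy x (ch x x)))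
  have hL : HasFDerivAt f₁ L (ch x x) := by
    have a1 := chsy_hasMF x hyt
    have a2 : HasMFDerivAt (𝓡 2) (𝓡 2) f ((ch x).symm (ch x x)) (DD f x) := by
      rw [esx]; exact hf.hasMF x
    have a3 : HasMFDerivAt (𝓡 2) 𝓘(ℝ, Esp 2) (ch z) ((f ∘ (ch x).symm) (ch x x)) (dch z z) := by
      have : (f ∘ (ch x).symm) (ch x x) = z := by
        change f ((ch x).symm (ch x x)) = z
        rw [esx, hz]
      rw [this]; exact ch_hasMF z hzs
    exact (HasMFDerivAt.comp (I' := 𝓡 2) _ a3 (HasMFDerivAt.comp (I' := 𝓡 2) _ a2 a1)).hasFDerivAt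
  have hLinj : Injective L := by
    rw [injective_iff_map_eq_zero]
    intro v hv
    have b1 : DD f x (dsy x (ch x x) v) = 0 := by
      have := dsy_dch z hzt
      rw [esz] at this
      rw [← this (DD f x (dsy x (ch x x) v))]
      change dsy z (ch z z) (L v) = 0
      rw [hv, map_zero]
    have b2 : dsy x (ch x x) v = 0 := (injective_iff_map_eq_zero _).1 hinj _ b1
    have := dch_dsy x hyt v
    rw [b2, map_zero] at this
    exact this.symm
  let Le : Esp 2 ≃L[ℝ] Esp 2 :=
    (LinearEquiv.ofInjectiveEndo (L : Esp 2 →ₗ[ℝ] Esp 2) hLinj).toContinuousLinearEquiv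
  have hLe : (Le : Esp 2 →L[ℝ] Esp 2) = L := by ext v; rfl
  have ek : k₁ (ch z z) = ch x x := by
    change ch x (k ((ch z).symm (ch z z))) = _
    rw [esz]
  have hkc1 : ContinuousAt (fun y => k ((ch z).symm y)) (ch z z) :=
    hkc.continuousAt.comp (ch_symm_contAt z hzt)
  have hkz : k ((ch z).symm (ch z z)) = x := by rw [esz]
  have hk₁c : ContinuousAt k₁ (ch z z) :=
    ContinuousAt.comp (g := ch x) (by rw [hkz]; exact ch_contAt x hxs) hkc1
  have hd : HasFDerivAt k₁ (Le.symm : Esp 2 →L[ℝ] Esp 2) (ch z z) := by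
    refine HasFDerivAt.of_local_left_inverse (f := f₁) hk₁c (by rw [ek, hLe]; exact hL) ?_
    have c1 : ∀ᶠ y in 𝓝 (ch z z), k ((ch z).symm y) ∈ (ch x).source :=
      hkc1.eventually (by change ∀ᶠ y in 𝓝 (k ((ch z).symm (ch z z))), y ∈ _; rw [hkz]; exact (ch_source_open x).mem_nhds hxs)
    filter_upwards [c1, ch_target_mem z hzt] with y hy1 hy2
    change ch z (f ((ch x).symm (ch x (k ((ch z).symm y))))) = y
    rw [(ch x).left_inv hy1, hfk, (ch z).right_inv hy2]
  rw [mdifferentiableAt_iff]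
  refine ⟨hkc.continuousAt, ?_⟩
  have : DifferentiableAt ℝ k₁ (ch z z) := hd.differentiableAt
  exact this.differentiableWithinAt

end Periods

section Final
open Filter Topology

variable {F : Type*} [TopologicalSpace F] [ChartedSpace (Esp 2) F]
variable [IsManifold (𝓡 2) (⊤ : ℕ∞) F] {σ : Form2 F}

lemma smFam_const {α : Form1 F} (hα : α ∈ ZF F) : SmFam (fun _ => α) := by
  intro x q hq
  exact ContDiffAt.comp (f := fun q : ℝ × Esp 2 => q.2) (g := crep α x) q
    (LEx_crep hα x hq).1 contDiffAt_snd

lemma pres_raw {S : RawForm (𝓡 2) F 2} (hS : ∀ x (v : Fin 2 → Esp 2), S x v = σ x (v 0) (v 1))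
    (f : F → F) : Pres σ f ↔ ∀ (x : F) (v : Fin 2 → TangentSpace (𝓡 2) x),
      pullbackRaw f S x v = S x v := by
  have e : ∀ x (v : Fin 2 → Esp 2), pullbackRaw f S x v = σ (f x) (DD f x (v 0)) (DD f x (v 1)) :=
    fun x v => hS (f x) (fun i => DD f x (v i))
  constructor
  · intro h x v
    exact (e x v).trans ((h x (v 0) (v 1)).trans (hS x v).symm)
  · intro h x v w
    have h1 := (e x ![v, w]).symm.trans ((h x ![v, w]).trans (hS x ![v, w]))
    exact h1

variable [CompactSpace F] [T2Space F]

lemma exists_commutator_family (hσ : AreaF σ) {g g' : F → F}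
    (G : BI σ (fun _ x => g x) (fun _ x => g' x))
    (hinj : ∀ α ∈ ZF F, pb g α - α ∈ EF F → α ∈ EF F)
    (A : ℝ → Form1 F) (hA : ∀ t, A t ∈ ZF F) (hsm : SmFam A) :
    ∃ f k : ℝ → F → F, BI σ f k ∧ (∀ x, f 0 x = x) ∧
      BI σ (fun t x => g (f t (g' (k t x)))) (fun t x => f t (g (k t (g' x)))) ∧
      ∀ t, Ahat σ (fun t x => g (f t (g' (k t x)))) t - A t ∈ EF F := by
  have hgs : SmMap g := G.js.slice 0
  have hgs' : SmMap g' := G.js'.slice 0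
  obtain ⟨ι, hι, Φ, hΦ, hΦs⟩ := exists_Phi (F := F)
  have := Fintype.ofFinite ι
  let Q : ZF F →ₗ[ℝ] ZF F :=
    { toFun := fun v => ⟨pb g' v.1 - v.1, (ZF F).sub_mem (pb_ZF hgs' v.2) v.2⟩
      map_add' := fun v w => Subtype.ext (by
        change pb g' (v.1 + w.1) - (v.1 + w.1) = (pb g' v.1 - v.1) + (pb g' w.1 - w.1)
        rw [map_add]; abel)
      map_smul' := fun c v => Subtype.ext (by
        change pb g' (c • v.1) - c • v.1 = c • (pb g' v.1 - v.1)
        rw [map_smul, smul_sub]) }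
  have hQ : ∀ v : ZF F, (Q v : Form1 F) = pb g' v.1 - v.1 := fun v => rfl
  let E : Submodule ℝ (ZF F) := (EF F).comap (ZF F).subtype
  have hE : ∀ v : ZF F, v ∈ E ↔ v.1 ∈ EF F := fun v => Iff.rfl
  obtain ⟨B, hB⟩ := linalg_aux E Q
    (by
      intro v hv
      rw [hE] at hv ⊢
      rw [hQ]
      exact (EF F).sub_mem (pb_EF hgs' hv) hv)
    (by
      intro v hv
      rw [hE] at hv ⊢
      have h1 : pb g' v.1 - v.1 ∈ EF F := by rw [← hQ]; exact hv
      have h2 := pb_EF hgs h1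
      have h3 : pb g (pb g' v.1) = v.1 := by
        rw [← pb_comp hgs' hgs]
        have : g' ∘ g = fun x => x := funext fun x => G.kh 0 x
        rw [this, pb_id]
      rw [map_sub, h3] at h2
      refine hinj v.1 v.2 ?_
      have := (EF F).neg_mem h2
      rwa [neg_sub] at this)
    Φ (fun v hv => (hE v).2 (hΦ v hv))
  let A' : ℝ → ZF F := fun t => ⟨A t, hA t⟩
  obtain ⟨f, k, H, h0, hf⟩ := exists_family hσ Finset.univ (fun i => (B i).1) (fun i => (B i).2)
    (fun i t => Φ (A' t) i) (hΦs A' hsm)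
  obtain ⟨H1, H2⟩ := comm_family hσ H h0 G
  refine ⟨f, k, H, h0, H1, fun t => ?_⟩
  have h1 := H2 t
  have h2 := (EF F).sub_mem (pb_EF hgs' (hf t)) (hf t)
  have h3 : A t - ∑ i, Φ (A' t) i • (pb g' (B i).1 - (B i).1) ∈ EF F := by
    have := (hE _).1 (hB (A' t))
    have e : ((A' t - ∑ i, Φ (A' t) i • Q (B i) : ZF F) : Form1 F) =
        A t - ∑ i, Φ (A' t) i • (pb g' (B i).1 - (B i).1) := by
      rw [Submodule.coe_sub, Submodule.coe_sum]
      rfl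
    rw [← e]
    exact this
  have h4 := (EF F).sub_mem ((EF F).add_mem h1 h2) h3
  convert h4 using 1
  simp only [map_sub, map_sum, map_smul, smul_sub, Finset.sum_sub_distrib]
  abel

/-- Isotopies with exact contraction are Hamiltonian. -/
lemma ham_of_exact {S : RawForm (𝓡 2) F 2}
    (hS : ∀ x (v : Fin 2 → Esp 2), S x v = σ x (v 0) (v 1)) (hσ : AreaF σ)
    (iso : SympIsotopy S) (hex : ∀ t, Ahat σ iso.h t ∈ EF F) {φ : F → F}
    (hφ : ∀ x, iso.h 1 x = φ x) : IsHamiltonianDiffeo S φ := by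
  have hJ : JS iso.h := iso.smooth
  have hp : ∀ t, Pres σ (iso.h t) := fun t => (pres_raw hS _).2 (iso.pres t)
  choose u hu using hex
  let k : ℝ → F → F := fun t => (Equiv.ofBijective _ (iso.bij t)).symm
  have hk : ∀ t x, iso.h t (k t x) = x := fun t x => (Equiv.ofBijective _ (iso.bij t)).apply_symm_apply x
  have kh : ∀ t x, k t (iso.h t x) = x := fun t x => (Equiv.ofBijective _ (iso.bij t)).symm_apply_apply x
  refine ⟨iso, fun t z => vel (fun τ => iso.h τ (k t z)) t, fun t z => u t (k t z), hφ, ?_, ?_⟩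
  · intro t z
    change _ = vel (fun τ => iso.h τ (k t (iso.h t z))) t
    rw [kh]
    rfl
  · intro t z w
    obtain ⟨hd, hs⟩ := inv_mdiff hσ (hJ.slice t) (hp t) (hk t) (kh t) z
    obtain ⟨w', hw'⟩ := hs w
    have e1 : HasMFDerivAt (𝓡 2) 𝓘(ℝ, ℝ) (fun z => u t (k t z)) z (dfun (fun z => u t (k t z)) z) := by
      have h1 : MDifferentiableAt (𝓡 2) 𝓘(ℝ, ℝ) (fun z => u t (k t z)) z :=
        MDifferentiableAt.comp (I' := 𝓡 2) z ((hu t (k t z)).1.mdifferentiableAt top_ne) hd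
      exact h1.hasMFDerivAt
    have e1' : HasMFDerivAt (𝓡 2) 𝓘(ℝ, ℝ) (fun z => u t (k t z)) (iso.h t (k t z))
        (dfun (fun z => u t (k t z)) z) := by rw [hk]; exact e1
    have e2 := (HasMFDerivAt.comp (I' := 𝓡 2) (k t z) e1' ((hJ.slice t).hasMF (k t z))).mfderiv
    have e3 : (fun z => u t (k t z)) ∘ iso.h t = u t := funext fun x => by simp [kh]
    rw [e3] at e2
    have e4 : dfun (u t) (k t z) w' = dfun (fun z => u t (k t z)) z w := by
      rw [← hw']
      exact DFunLike.congr_fun e2 w'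
    have e5 : Ahat σ iso.h t (k t z) w' = σ z (vel (fun τ => iso.h τ (k t z)) t) w := by
      change σ (iso.h t (k t z)) _ (DD (iso.h t) (k t z) w') = _
      rw [hw', hk]
    refine (hS z ![vel (fun τ => iso.h τ (k t z)) t, w]).trans ?_
    change σ z (vel (fun τ => iso.h τ (k t z)) t) w = dfun (fun z => u t (k t z)) z w
    rw [← e4, ← e5, (hu t (k t z)).2]

/-- a two-sided family as isotopy -/
lemma BI.bij {h k : ℝ → F → F} (H : BI σ h k) (t : ℝ) : Bijective (h t) :=
  bijective_iff_has_inverse.2 ⟨k t, H.kh t, H.hk t⟩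

theorem main_thm
    (σ : SForm (𝓡 2) F 2) (harea : IsAreaForm σ)
    (g : Equiv.Perm F) (hg : g ∈ SympPermSet σ.val)
    (heig : ∀ B : SForm (𝓡 2) F 1, IsClosedRaw B.val →
      IsExact1 (fun x v => pullbackRaw (⇑g) B.val x v - B.val x v) → IsExact1 B.val) :
    (∀ A : SForm (𝓡 2) F 1, IsClosedRaw A.val →
      ∃ f : Equiv.Perm F, InIdentityComponent σ.val ⇑f ∧
        HasFluxForm σ.val ⇑(g * f * g⁻¹ * f⁻¹) A.val) ∧
    (∀ e : Equiv.Perm F, InIdentityComponent σ.val ⇑e →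
      ∃ f : Equiv.Perm F, InIdentityComponent σ.val ⇑f ∧
        IsHamiltonianDiffeo σ.val ⇑(e * (g * f * g⁻¹ * f⁻¹)⁻¹)) := by
  obtain ⟨s, hs, hσs⟩ := exists_Form2 σ harea
  have G : BI s (fun _ x => g x) (fun _ x => g.symm x) :=
    ⟨JS.const hg.1, JS.const hg.2.1, fun _ x => g.apply_symm_apply x,
      fun _ x => g.symm_apply_apply x, fun _ => (pres_raw hσs g).2 hg.2.2⟩
  have hinj : ∀ α ∈ ZF F, pb g α - α ∈ EF F → α ∈ EF F := by
    intro α hα hex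
    obtain ⟨B, hB, hBα⟩ := SForm_of_ZF α hα
    have h1 := heig B hB (by
      rw [hBα]
      exact (isExact1_iff (pb g α - α)).2 hex)
    rw [hBα] at h1
    exact (isExact1_iff α).1 h1
  have toIso : ∀ {h k : ℝ → F → F} (H : BI s h k) (h0 : ∀ x, h 0 x = x),
      ∃ iso : SympIsotopy σ.val, iso.h = h := fun {h k} H h0 =>
    ⟨⟨h, H.js, H.bij, fun t => (pres_raw hσs (h t)).1 (H.pres t), h0⟩, rfl⟩
  constructor
  · intro A hA
    obtain ⟨α, hα, hAα⟩ := closed_SForm A hA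
    obtain ⟨f, k, H, h0, Hc, hc⟩ := exists_commutator_family hs G hinj (fun _ => α) (fun _ => hα) (smFam_const hα)
    let fe : Equiv.Perm F := ⟨f 1, k 1, H.kh 1, H.hk 1⟩
    obtain ⟨iso, hiso⟩ := toIso H h0
    have hk0 : ∀ x, k 0 x = x := fun x => by
      have := H.kh 0 x
      rwa [h0] at this
    obtain ⟨isoc, hisoc⟩ := toIso Hc (fun x => by simp [h0, hk0])
    refine ⟨fe, ⟨iso, fun x => by rw [hiso]; rfl⟩, ⟨isoc, fun x => by rw [hisoc]; rfl, ?_⟩⟩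
    intro γ hγ
    rw [hAα, hisoc]
    exact swept_eq hσs hs Hc.js Hc.pres hα hc hγ
  · rintro e ⟨ei, hei⟩
    have heJ : JS ei.h := ei.smooth
    have heP : ∀ t, Pres s (ei.h t) := fun t => (pres_raw hσs _).2 (ei.pres t)
    obtain ⟨f, k, H, h0, Hc, hc⟩ := exists_commutator_family hs G hinj (fun t => Ahat s ei.h t)
      (Ahat_ZF hs heJ heP) (fun x q hq => Ahat_smooth hs heJ x hq)
    let fe : Equiv.Perm F := ⟨f 1, k 1, H.kh 1, H.hk 1⟩
    obtain ⟨iso, hiso⟩ := toIso H h0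
    have hk0 : ∀ x, k 0 x = x := fun x => by
      have := H.kh 0 x
      rwa [h0] at this
    obtain ⟨isoc, hisoc⟩ := toIso Hc.symm (fun x => by simp [h0, hk0])
    let c' : ℝ → F → F := fun t x => f t (g (k t (g.symm x)))
    let hh : SympIsotopy σ.val :=
      { h := fun t x => ei.h t (c' t x)
        smooth := heJ.comp Hc.js'
        bij := fun t => (ei.bij t).comp (Hc.symm.bij t)
        pres := fun t => (pres_raw hσs _).1 (by
          intro x v w
          have h2 := DD_comp (heJ.slice t) (Hc.js'.slice t) x
          change s _ (DD (ei.h t ∘ c' t) x v) (DD (ei.h t ∘ c' t) x w) = _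
          rw [h2]
          exact (heP t _ _ _).trans (Hc.symm.pres t x v w))
        start := fun x => by simp [c', h0, hk0, ei.start] }
    refine ⟨fe, ⟨iso, fun x => by rw [hiso]; rfl⟩, ?_⟩
    refine ham_of_exact hσs hs hh ?_ ?_
    · intro t
      have e1 := Ahat_comp heJ Hc.js' heP t
      have e2 := Hc.Ahat_inv t
      change Ahat s (fun t x => ei.h t (c' t x)) t ∈ EF F
      rw [e1, e2]
      have h3 := (EF F).neg_mem (pb_EF (Hc.js'.slice t) (hc t))
      rw [map_sub, neg_sub] at h3
      rw [← sub_eq_add_neg]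
      exact h3
    · intro x
      change ei.h 1 (c' 1 x) = _
      rw [hei]
      rfl

end Final

section Statement15

variable {F : Type*} [TopologicalSpace F] [ChartedSpace (Esp 2) F]
  [IsManifold (𝓡 2) (⊤ : ℕ∞) F] [CompactSpace F] [T2Space F]

/-- **(Eliashberg, after Lalonde–Polterovich.)**  Let `(F, σ)` be a closed oriented surface
with an area form and `g` a symplectomorphism whose action `g^*` on `H¹(F; ℝ)` has no
eigenvalue `1` (equivalently, `g^* - id` is injective on `H¹`: if `g^*B - B` is exact for a
closed 1-form `B`, then `B` is exact).  Then `f ↦ Flux([g, f])` maps `D₀` onto `H¹(F; ℝ)`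
(every class, represented by a closed 1-form `A`, is attained); in particular every element
of `D₀` is, up to Hamiltonian isotopy, a single commutator `[g, f]` with `f ∈ D₀`. -/
theorem commutator_flux_surjective
    (σ : SForm (𝓡 2) F 2) (harea : IsAreaForm σ)
    (g : Equiv.Perm F) (hg : g ∈ SympPermSet σ.val)
    (heig : ∀ B : SForm (𝓡 2) F 1, IsClosedRaw B.val →
      IsExact1 (fun x v => pullbackRaw (⇑g) B.val x v - B.val x v) → IsExact1 B.val) :
    (∀ A : SForm (𝓡 2) F 1, IsClosedRaw A.val →
      ∃ f : Equiv.Perm F, InIdentityComponent σ.val ⇑f ∧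
        HasFluxForm σ.val ⇑(g * f * g⁻¹ * f⁻¹) A.val) ∧
    (∀ e : Equiv.Perm F, InIdentityComponent σ.val ⇑e →
      ∃ f : Equiv.Perm F, InIdentityComponent σ.val ⇑f ∧
        IsHamiltonianDiffeo σ.val ⇑(e * (g * f * g⁻¹ * f⁻¹)⁻¹)) := by
  exact main_thm σ harea g hg heig

end Statement15

end
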